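/- arXiv:1605.02548 — 4 statements merged into one kernel-verified Lean document; each statement's English description precedes it below -/
import Mathlib

section
/- Let V = ℝ^n (n ≥ 1) and let C ⊆ V be a nonempty open convex cone containing no affine line (a sharp convex open cone). Then the dual cone C* = {φ ∈ V* : φ(v) > 0 for all v ∈ closure(C) \ {0}} is a nonempty open convex cone in the dual space V* containing no affine line, and under the canonical isomorphism V ≅ V** one has (C*)* = C. -/
open Topology

section SharpCone

variable {E : Type*} [NormedAddCommGroup E] [NormedSpace ℝ E] {C : Set E}

/-- In an open set one can move a little in any direction. -/
theorem IsOpen.exists_pos_add_smul_mem (hopen : IsOpen C) {x : E} (hx : x ∈ C) (w : E) :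
    ∃ ε : ℝ, 0 < ε ∧ x + ε • w ∈ C := by
  have hcont : ContinuousAt (fun t : ℝ => x + t • w) 0 := by fun_prop
  have hev : ∀ᶠ t in 𝓝[>] (0 : ℝ), x + t • w ∈ C :=
    (hcont.eventually (hopen.mem_nhds (by simpa using hx))).filter_mono nhdsWithin_le_nhds
  obtain ⟨ε, hε, hpos⟩ := (hev.and self_mem_nhdsWithin).exists
  exact ⟨ε, hpos, hε⟩

theorem smul_mem_closure_of_cone (hcone : ∀ x ∈ C, ∀ t : ℝ, 0 < t → t • x ∈ C)
    {x : E} (hx : x ∈ closure C) {t : ℝ} (ht : 0 < t) : t • x ∈ closure C :=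
  map_mem_closure (continuous_const_smul t) hx fun y hy => hcone y hy t ht

theorem add_mem_of_mem_of_mem_closure_of_cone (hopen : IsOpen C) (hconv : Convex ℝ C)
    (hcone : ∀ x ∈ C, ∀ t : ℝ, 0 < t → t • x ∈ C) {x y : E} (hx : x ∈ C)
    (hy : y ∈ closure C) : x + y ∈ C := by
  have h := hconv.combo_interior_closure_mem_interior (hopen.interior_eq.symm ▸ hx) hy
    (a := 1 / 2) (b := 1 / 2) (by norm_num) (by norm_num) (by norm_num)
  have h2 := hcone _ (interior_subset h) 2 (by norm_num)
  simpa [smul_add, smul_smul] using h2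

/-- The closure of a nonempty sharp open convex cone is salient. -/
theorem neg_notMem_closure_of_sharp (hne : C.Nonempty) (hopen : IsOpen C) (hconv : Convex ℝ C)
    (hcone : ∀ x ∈ C, ∀ t : ℝ, 0 < t → t • x ∈ C)
    (hsharp : ¬ ∃ x v : E, v ≠ 0 ∧ ∀ t : ℝ, x + t • v ∈ C)
    {v : E} (hv : v ∈ closure C) (hv0 : v ≠ 0) : -v ∉ closure C := by
  intro hneg
  obtain ⟨x, hx⟩ := hne
  refine hsharp ⟨x, v, hv0, fun t => ?_⟩
  rcases lt_trichotomy t 0 with ht | rfl | ht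
  · apply add_mem_of_mem_of_mem_closure_of_cone hopen hconv hcone hx
    simpa using smul_mem_closure_of_cone hcone hneg (neg_pos.mpr ht)
  · simpa using hx
  · exact add_mem_of_mem_of_mem_closure_of_cone hopen hconv hcone hx
      (smul_mem_closure_of_cone hcone hv ht)

/-- A functional that is bounded below on a cone is nonnegative on it. -/
theorem ContinuousLinearMap.nonneg_of_bddBelow_cone (hcone : ∀ x ∈ C, ∀ t : ℝ, 0 < t → t • x ∈ C)
    {φ : E →L[ℝ] ℝ} {m : ℝ} (h : ∀ w ∈ C, m ≤ φ w) {w : E} (hw : w ∈ C) : 0 ≤ φ w := by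
  by_contra! hneg
  have hle := h _ (hcone w hw ((|m| + 1) / -φ w) (div_pos (by positivity) (neg_pos.mpr hneg)))
  have heq : (|m| + 1) / -φ w * φ w = -(|m| + 1) := by
    field_simp [hneg.ne]
  rw [map_smul, smul_eq_mul, heq] at hle
  linarith [neg_abs_le m]

/-- Positivity on a closed cone minus the origin is positivity on its unit vectors. -/
theorem forall_closure_pos_iff_forall_sphere
    (hcone : ∀ x ∈ C, ∀ t : ℝ, 0 < t → t • x ∈ C) (φ : E →L[ℝ] ℝ) :
    (∀ v ∈ closure C, v ≠ 0 → 0 < φ v) ↔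
      ∀ v ∈ closure C ∩ Metric.sphere 0 1, 0 < φ v := by
  refine ⟨fun h v hv => h v hv.1 (ne_zero_of_mem_unit_sphere ⟨v, hv.2⟩), fun h v hv hv0 => ?_⟩
  have hpos : 0 < ‖v‖⁻¹ := inv_pos.mpr (norm_pos_iff.mpr hv0)
  have h1 := h (‖v‖⁻¹ • v) ⟨smul_mem_closure_of_cone hcone hv hpos, by
    simp [norm_smul, norm_ne_zero_iff.mpr hv0]⟩
  rw [map_smul, smul_eq_mul] at h1
  exact pos_of_mul_pos_right h1 hpos.le

theorem IsCompact.isOpen_setOf_forall_clm_pos {S : Set E} (hS : IsCompact S) :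
    IsOpen {φ : E →L[ℝ] ℝ | ∀ v ∈ S, 0 < φ v} := by
  rw [isOpen_iff_mem_nhds]
  intro φ hφ
  have hcont : Continuous fun p : (E →L[ℝ] ℝ) × E => p.1 p.2 := by fun_prop
  exact hS.eventually_forall_of_forall_eventually fun v hv =>
    hcont.continuousAt.eventually (lt_mem_nhds (hφ v hv))

theorem exists_forall_closure_pos_of_sharp [FiniteDimensional ℝ E] (hne : C.Nonempty)
    (hopen : IsOpen C) (hconv : Convex ℝ C) (hcone : ∀ x ∈ C, ∀ t : ℝ, 0 < t → t • x ∈ C)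
    (hsharp : ¬ ∃ x v : E, v ≠ 0 ∧ ∀ t : ℝ, x + t • v ∈ C) :
    ∃ φ : E →L[ℝ] ℝ, ∀ v ∈ closure C, v ≠ 0 → 0 < φ v := by
  have : ProperSpace E := FiniteDimensional.proper_real E
  have hS : IsCompact (closure C ∩ Metric.sphere (0 : E) 1) :=
    (isCompact_sphere 0 1).inter_left isClosed_closure
  suffices h : ∃ φ : E →L[ℝ] ℝ, (∀ v ∈ closure C, 0 ≤ φ v) ∧
      ∀ v ∈ closure C ∩ Metric.sphere 0 1, 0 < φ v by
    obtain ⟨φ, -, hφ⟩ := h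
    exact ⟨φ, (forall_closure_pos_iff_forall_sphere hcone φ).mpr hφ⟩
  refine hS.induction_on (p := fun S => ∃ φ : E →L[ℝ] ℝ, (∀ v ∈ closure C, 0 ≤ φ v) ∧
      ∀ v ∈ S, v ∈ closure C → 0 < φ v) ?_ ?_ ?_ ?_ |>.imp fun φ h =>
        ⟨h.1, fun v hv => h.2 v hv hv.1⟩
  · exact ⟨0, by simp, by simp⟩
  · rintro s t hst ⟨φ, h, hφ⟩
    exact ⟨φ, h, fun v hv => hφ v (hst hv)⟩
  · rintro s t ⟨φ, h, hφ⟩ ⟨χ, h', hχ⟩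
    refine ⟨φ + χ, fun v hv => add_nonneg (h v hv) (h' v hv), ?_⟩
    rintro v (hv | hv) hvC
    · exact add_pos_of_pos_of_nonneg (hφ v hv hvC) (h' v hvC)
    · exact add_pos_of_nonneg_of_pos (h v hvC) (hχ v hv hvC)
  · intro v hv
    obtain ⟨φ, u, hu, hφ⟩ := geometric_hahn_banach_point_closed hconv.closure isClosed_closure
      (neg_notMem_closure_of_sharp hne hopen hconv hcone hsharp hv.1
        (ne_zero_of_mem_unit_sphere ⟨v, hv.2⟩))
    have hnonneg : ∀ w ∈ closure C, 0 ≤ φ w := fun w hw =>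
      φ.nonneg_of_bddBelow_cone (fun x hx t ht => smul_mem_closure_of_cone hcone hx ht)
        (fun w hw => (hφ w hw).le) hw
    have hpos : 0 < φ v := by
      refine (hnonneg v hv.1).lt_of_ne fun h0 => ?_
      have := hφ v hv.1
      rw [map_neg] at hu
      linarith
    exact ⟨{w | 0 < φ w}, mem_nhdsWithin_of_mem_nhds
      (φ.continuous.continuousAt.eventually (lt_mem_nhds hpos)), φ, hnonneg, fun w hw _ => hw⟩

theorem ContinuousLinearMap.eq_zero_of_forall_mem_isOpen (hne : C.Nonempty) (hopen : IsOpen C)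
    {χ : E →L[ℝ] ℝ} (h : ∀ v ∈ C, χ v = 0) : χ = 0 := by
  obtain ⟨x, hx⟩ := hne
  ext w
  obtain ⟨ε, hε, hmem⟩ := hopen.exists_pos_add_smul_mem hx w
  simpa [h x hx, hε.ne'] using h _ hmem

/-- A nonzero functional that is nonnegative on an open set is positive on it. -/
theorem ContinuousLinearMap.pos_of_nonneg_of_isOpen (hopen : IsOpen C) {φ : E →L[ℝ] ℝ}
    (hφ : φ ≠ 0) (h : ∀ v ∈ C, 0 ≤ φ v) {v : E} (hv : v ∈ C) : 0 < φ v := by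
  refine (h v hv).lt_of_ne' fun h0 => hφ ?_
  ext w
  obtain ⟨ε, hε, hmem⟩ := hopen.exists_pos_add_smul_mem hv w
  obtain ⟨δ, hδ, hmem'⟩ := hopen.exists_pos_add_smul_mem hv (-w)
  have h1 := h _ hmem
  have h2 := h _ hmem'
  simp only [map_add, map_smul, map_neg, h0, zero_add, smul_eq_mul, mul_neg, neg_nonneg]
    at h1 h2
  exact le_antisymm (nonpos_of_mul_nonpos_right h2 hδ) (nonneg_of_mul_nonneg_right h1 hε)

/-- A point outside an open convex cone is separated from it by a nonzero functional that is
nonnegative on the cone. -/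
theorem exists_nonneg_clm_of_notMem_cone (hne : C.Nonempty) (hopen : IsOpen C)
    (hconv : Convex ℝ C) (hcone : ∀ x ∈ C, ∀ t : ℝ, 0 < t → t • x ∈ C) {v : E} (hv : v ∉ C) :
    ∃ φ : E →L[ℝ] ℝ, φ ≠ 0 ∧ (∀ w ∈ closure C, 0 ≤ φ w) ∧ φ v ≤ 0 := by
  obtain ⟨φ, hφ⟩ := geometric_hahn_banach_point_open hconv hopen hv
  have hray : ∀ w ∈ C, ∀ t : ℝ, 0 < t → φ v < t * φ w := fun w hw t ht => by
    simpa using hφ _ (hcone w hw t ht)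
  obtain ⟨x, hx⟩ := hne
  refine ⟨φ, ?_, fun w hw => ?_, ?_⟩
  · rintro rfl
    simpa using hφ x hx
  · exact closure_minimal (t := {w | 0 ≤ φ w})
      (fun w hw => φ.nonneg_of_bddBelow_cone hcone (fun w hw => (hφ w hw).le) hw)
      (isClosed_le continuous_const φ.continuous) hw
  · have hlim : Filter.Tendsto (fun t : ℝ => t * φ x) (𝓝[>] 0) (𝓝 0) := by
      have : ContinuousAt (fun t : ℝ => t * φ x) 0 := by fun_prop
      simpa using this.tendsto.mono_left (nhdsWithin_le_nhds (s := Set.Ioi 0))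
    exact ge_of_tendsto hlim (by
      filter_upwards [self_mem_nhdsWithin] with t ht using (hray x hx t ht).le)

end SharpCone

/-- The dual of a sharp convex open cone `C ⊆ ℝⁿ` is a sharp convex open cone in the dual
space, and the double dual of `C` (under the canonical identification of `V` with `V**`,
i.e. `v` corresponds to evaluation at `v`) is `C` itself. -/
theorem dual_of_sharp_convex_open_cone (n : ℕ) (hn : 1 ≤ n)
    (C : Set (EuclideanSpace ℝ (Fin n)))
    (hne : C.Nonempty) (hopen : IsOpen C) (hconv : Convex ℝ C)
    (hcone : ∀ x ∈ C, ∀ t : ℝ, 0 < t → t • x ∈ C)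
    (hsharp : ¬ ∃ x v : EuclideanSpace ℝ (Fin n), v ≠ 0 ∧ ∀ t : ℝ, x + t • v ∈ C)
    (Cstar : Set (EuclideanSpace ℝ (Fin n) →L[ℝ] ℝ))
    (hCstar : Cstar = {φ | ∀ v ∈ closure C, v ≠ 0 → 0 < φ v}) :
    Cstar.Nonempty ∧ IsOpen Cstar ∧ Convex ℝ Cstar ∧
    (∀ φ ∈ Cstar, ∀ t : ℝ, 0 < t → t • φ ∈ Cstar) ∧
    (¬ ∃ ψ χ : EuclideanSpace ℝ (Fin n) →L[ℝ] ℝ, χ ≠ 0 ∧ ∀ t : ℝ, ψ + t • χ ∈ Cstar) ∧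
    {v : EuclideanSpace ℝ (Fin n) | ∀ φ ∈ closure Cstar, φ ≠ 0 → 0 < φ v} = C := by
  subst hCstar
  have : Nonempty (Fin n) := ⟨⟨0, hn⟩⟩
  have h0 : (0 : EuclideanSpace ℝ (Fin n)) ∉ C := fun h => by
    obtain ⟨v, hv⟩ := exists_ne (0 : EuclideanSpace ℝ (Fin n))
    refine neg_notMem_closure_of_sharp hne hopen hconv hcone hsharp (v := v) ?_ hv ?_
    all_goals
      obtain ⟨ε, hε, hmem⟩ := hopen.exists_pos_add_smul_mem h _
      rw [zero_add] at hmem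
      have := hcone _ hmem ε⁻¹ (inv_pos.mpr hε)
      rw [inv_smul_smul₀ hε.ne'] at this
      exact subset_closure this
  have hC0 : ∀ v ∈ C, v ≠ 0 := fun v hv h => h0 (h ▸ hv)
  obtain ⟨ψ, hψ⟩ := exists_forall_closure_pos_of_sharp hne hopen hconv hcone hsharp
  refine ⟨⟨ψ, hψ⟩, ?_, ?_, ?_, ?_, ?_⟩
  · simp only [forall_closure_pos_iff_forall_sphere hcone]
    exact ((isCompact_sphere 0 1).inter_left isClosed_closure).isOpen_setOf_forall_clm_pos
  · rw [convex_iff_forall_pos]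
    intro φ hφ χ hχ a b ha hb _ v hv hv0
    exact add_pos (mul_pos ha (hφ v hv hv0)) (mul_pos hb (hχ v hv hv0))
  · exact fun φ hφ t ht v hv hv0 => mul_pos ht (hφ v hv hv0)
  · rintro ⟨φ, χ, hχ, hline⟩
    refine hχ (ContinuousLinearMap.eq_zero_of_forall_mem_isOpen hne hopen fun v hv => ?_)
    by_contra hne0
    have h := hline (-φ v / χ v) v (subset_closure hv) (hC0 v hv)
    simp [hne0] at h
  · ext v
    refine ⟨fun hv => ?_, fun hv φ hφ hφ0 => ?_⟩
    · by_contra hvC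
      obtain ⟨φ, hφ0, hφ, hφv⟩ := exists_nonneg_clm_of_notMem_cone hne hopen hconv hcone hvC
      refine (hv φ ?_ hφ0).not_ge hφv
      have hcont : ContinuousAt (fun t : ℝ => φ + t • ψ) 0 := by fun_prop
      have hlim : Filter.Tendsto (fun t : ℝ => φ + t • ψ) (𝓝[>] 0) (𝓝 φ) := by
        simpa using hcont.tendsto.mono_left (nhdsWithin_le_nhds (s := Set.Ioi 0))
      refine mem_closure_of_tendsto hlim ?_
      filter_upwards [self_mem_nhdsWithin] with t ht w hw hw0
      exact add_pos_of_nonneg_of_pos (hφ w hw) (mul_pos ht (hψ w hw hw0))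
    · refine ContinuousLinearMap.pos_of_nonneg_of_isOpen hopen hφ0 (fun w hw => ?_) hv
      refine closure_minimal (t := {φ : EuclideanSpace ℝ (Fin n) →L[ℝ] ℝ | 0 ≤ φ w})
        (fun χ hχ => (hχ w (subset_closure hw) (hC0 w hw)).le)
        (isClosed_le continuous_const (by fun_prop)) hφ
end

section
/- Let X ⊆ SL₃(ℝ) be the set of elements that are positive hyperbolic or quasi-hyperbolic, with the subspace topology, and let X/∼ be the quotient of X by the conjugation action of SL₃(ℝ), with the quotient topology. For γ ∈ X let λ(γ) be the smallest eigenvalue of γ and τ(γ) the sum of the other two eigenvalues (so τ(γ) = trace(γ) − λ(γ)). Then the map [γ] ↦ (λ(γ), τ(γ)) is well defined and is a homeomorphism from X/∼ onto the region R = {(λ, τ) ∈ ℝ² : 0 < λ < 1 and 2/√λ ≤ τ ≤ λ + λ⁻²} with its subspace topology from ℝ². Moreover, interior points of R correspond exactly to positive hyperbolic classes and boundary points of R to quasi-hyperbolic classes. -/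
open Matrix Polynomial

noncomputable section

/-- A matrix is positive hyperbolic if it has three distinct positive real eigenvalues. -/
def PosHyperbolic (A : Matrix (Fin 3) (Fin 3) ℝ) : Prop :=
  ∃ l m n : ℝ, 0 < l ∧ l < m ∧ m < n ∧
    A.charpoly = (X - C l) * (X - C m) * (X - C n)

/-- A matrix is quasi-hyperbolic if it has exactly two distinct eigenvalues, both positive
real (necessarily `λ, λ, λ⁻²` with `λ ≠ 1`), and is not diagonalizable. -/
def QuasiHyperbolic (A : Matrix (Fin 3) (Fin 3) ℝ) : Prop :=
  (∃ l : ℝ, 0 < l ∧ l ≠ 1 ∧ A.charpoly = (X - C l) ^ 2 * (X - C (l⁻¹ ^ 2))) ∧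
  ¬ ∃ P D : Matrix (Fin 3) (Fin 3) ℝ, IsUnit P.det ∧ D.IsDiag ∧ A = P * D * P⁻¹

/-- The smallest (real) eigenvalue of a matrix. -/
def smallestEig (A : Matrix (Fin 3) (Fin 3) ℝ) : ℝ :=
  sInf {r : ℝ | A.charpoly.IsRoot r}

/-- The set `X` of positive hyperbolic or quasi-hyperbolic elements of `SL₃(ℝ)`. -/
def PosQH : Set (Matrix (Fin 3) (Fin 3) ℝ) :=
  {A | A.det = 1 ∧ (PosHyperbolic A ∨ QuasiHyperbolic A)}

/-- Conjugacy in `SL₃(ℝ)`, as a relation on `X`. -/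
def ConjSL3 (A B : PosQH) : Prop :=
  ∃ P : Matrix (Fin 3) (Fin 3) ℝ, P.det = 1 ∧ (A : Matrix (Fin 3) (Fin 3) ℝ) = P * B * P⁻¹

/-- The region `R = {(λ, τ) : 0 < λ < 1, 2/√λ ≤ τ ≤ λ + λ⁻²}`. -/
def RegionR : Set (ℝ × ℝ) :=
  {p | 0 < p.1 ∧ p.1 < 1 ∧ 2 / Real.sqrt p.1 ≤ p.2 ∧ p.2 ≤ p.1 + (p.1 ^ 2)⁻¹}

/-- The second elementary symmetric function of the eigenvalues of a `3 × 3` matrix. -/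
def secondSymm (A : Matrix (Fin 3) (Fin 3) ℝ) : ℝ :=
  A 0 0 * A 1 1 - A 0 1 * A 1 0 + (A 0 0 * A 2 2 - A 0 2 * A 2 0)
    + (A 1 1 * A 2 2 - A 1 2 * A 2 1)

lemma charpoly_fin_three_eq (A : Matrix (Fin 3) (Fin 3) ℝ) :
    A.charpoly = X ^ 3 - C A.trace * X ^ 2 + C (secondSymm A) * X - C A.det := by
  simp only [Matrix.charpoly, Matrix.det_fin_three, Matrix.charmatrix_apply, Matrix.trace_fin_three,
    secondSymm]
  simp
  ring

lemma charpoly_eq_iff (A : Matrix (Fin 3) (Fin 3) ℝ) (l m n : ℝ) :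
    A.charpoly = (X - C l) * (X - C m) * (X - C n) ↔
      A.trace = l + m + n ∧ secondSymm A = l * m + l * n + m * n ∧ A.det = l * m * n := by
  rw [charpoly_fin_three_eq]
  constructor
  · intro h
    have h0 := congrArg (eval 0) h
    have h1 := congrArg (eval 1) h
    have h2 := congrArg (eval (-1)) h
    simp at h0 h1 h2
    refine ⟨?_, ?_, ?_⟩ <;> linarith
  · rintro ⟨h1, h2, h3⟩
    rw [h1, h2, h3]
    simp
    ring

lemma ne_inv_sq {l : ℝ} (hl : 0 < l) (hl1 : l ≠ 1) : l ≠ l⁻¹ ^ 2 := by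
  intro h
  have : l ^ 3 = 1 := by
    calc l ^ 3 = l ^ 2 * l := by ring
      _ = l ^ 2 * l⁻¹ ^ 2 := by rw [← h]
      _ = 1 := by field_simp
  exact hl1 ((pow_eq_one_iff_of_nonneg hl.le (by norm_num)).1 this)

lemma PosQH.exists_roots {A : Matrix (Fin 3) (Fin 3) ℝ} (hA : A ∈ PosQH) :
    ∃ l m n : ℝ, 0 < l ∧ l ≤ m ∧ m ≤ n ∧ l < n ∧ l * m * n = 1 ∧
      A.charpoly = (X - C l) * (X - C m) * (X - C n) := by
  obtain ⟨hdet, ⟨l, m, n, h0, h1, h2, h⟩ | ⟨⟨l, h0, h1, h⟩, -⟩⟩ := hA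
  · exact ⟨l, m, n, h0, h1.le, h2.le, h1.trans h2,
      by rw [← ((charpoly_eq_iff A l m n).1 h).2.2, hdet], h⟩
  · have hp : l * l * l⁻¹ ^ 2 = 1 := by field_simp
    have hne := ne_inv_sq h0 h1
    rcases le_total l (l⁻¹ ^ 2) with hl | hl
    · exact ⟨l, l, _, h0, le_rfl, hl, lt_of_le_of_ne hl hne, hp, by rw [h]; ring⟩
    · exact ⟨_, l, l, by positivity, hl, le_rfl, lt_of_le_of_ne hl hne.symm,
        by rw [← hp]; ring, by rw [h]; ring⟩

lemma smallestEig_eq {A : Matrix (Fin 3) (Fin 3) ℝ} {l m n : ℝ} (hlm : l ≤ m) (hmn : m ≤ n)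
    (h : A.charpoly = (X - C l) * (X - C m) * (X - C n)) : smallestEig A = l := by
  refine IsLeast.csInf_eq ⟨?_, ?_⟩
  · simp [h]
  · intro r hr
    simp only [h, Set.mem_ofPred_eq, IsRoot.def, eval_mul, eval_sub, eval_X, eval_C, mul_eq_zero,
      sub_eq_zero] at hr
    rcases hr with (rfl | rfl) | rfl <;> linarith

lemma pos_iff_symm_pos {a b d : ℝ} (hab : a ≤ b) (hbd : b ≤ d) :
    0 < a ↔ 0 < a + b + d ∧ 0 < a * b + a * d + b * d ∧ 0 < a * b * d := by
  constructor
  · intro ha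
    have hb := ha.trans_le hab
    have hd := hb.trans_le hbd
    refine ⟨?_, ?_, ?_⟩ <;> positivity
  · rintro ⟨h1, h2, h3⟩
    by_contra! ha
    have key : a ^ 3 = (a + b + d) * a ^ 2 + (a * b + a * d + b * d) * (-a) + a * b * d := by ring
    have h4 : a ^ 3 ≤ 0 := by nlinarith [sq_nonneg a]
    have h5 : 0 ≤ (a * b + a * d + b * d) * (-a) := mul_nonneg h2.le (by linarith)
    have h6 : 0 ≤ (a + b + d) * a ^ 2 := mul_nonneg h1.le (sq_nonneg a)
    linarith

lemma nonneg_iff_symm_nonneg {a b d : ℝ} (hab : a ≤ b) (hbd : b ≤ d) :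
    0 ≤ a ↔ 0 ≤ a + b + d ∧ 0 ≤ a * b + a * d + b * d ∧ 0 ≤ a * b * d := by
  constructor
  · intro ha
    have hb := ha.trans hab
    have hd := hb.trans hbd
    refine ⟨?_, ?_, ?_⟩ <;> positivity
  · rintro ⟨h1, h2, h3⟩
    by_contra! ha
    have key : a ^ 3 = (a + b + d) * a ^ 2 + (a * b + a * d + b * d) * (-a) + a * b * d := by ring
    have h4 : a ^ 3 < 0 := Odd.pow_neg (by decide) ha
    have h5 : 0 ≤ (a * b + a * d + b * d) * (-a) := mul_nonneg h2 (by linarith)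
    have h6 : 0 ≤ (a + b + d) * a ^ 2 := mul_nonneg h1 (sq_nonneg a)
    linarith

lemma symm_shift {A : Matrix (Fin 3) (Fin 3) ℝ} {l m n : ℝ} (c : ℝ)
    (h : A.charpoly = (X - C l) * (X - C m) * (X - C n)) :
    A.trace - 3 * c = (l - c) + (m - c) + (n - c) ∧
    secondSymm A - 2 * c * A.trace + 3 * c ^ 2 =
      (l - c) * (m - c) + (l - c) * (n - c) + (m - c) * (n - c) ∧
    A.det - c * secondSymm A + c ^ 2 * A.trace - c ^ 3 = (l - c) * (m - c) * (n - c) := by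
  obtain ⟨h1, h2, h3⟩ := (charpoly_eq_iff A l m n).1 h
  rw [h1, h2, h3]
  refine ⟨?_, ?_, ?_⟩ <;> ring

lemma lt_smallestEig_iff {A : Matrix (Fin 3) (Fin 3) ℝ} (hA : A ∈ PosQH) (c : ℝ) :
    c < smallestEig A ↔ 0 < A.trace - 3 * c ∧ 0 < secondSymm A - 2 * c * A.trace + 3 * c ^ 2 ∧
      0 < A.det - c * secondSymm A + c ^ 2 * A.trace - c ^ 3 := by
  obtain ⟨l, m, n, -, hlm, hmn, -, -, h⟩ := PosQH.exists_roots hA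
  obtain ⟨h1, h2, h3⟩ := symm_shift c h
  rw [smallestEig_eq hlm hmn h, h1, h2, h3, ← pos_iff_symm_pos (by linarith) (by linarith), sub_pos]

lemma le_smallestEig_iff {A : Matrix (Fin 3) (Fin 3) ℝ} (hA : A ∈ PosQH) (c : ℝ) :
    c ≤ smallestEig A ↔ 0 ≤ A.trace - 3 * c ∧ 0 ≤ secondSymm A - 2 * c * A.trace + 3 * c ^ 2 ∧
      0 ≤ A.det - c * secondSymm A + c ^ 2 * A.trace - c ^ 3 := by
  obtain ⟨l, m, n, -, hlm, hmn, -, -, h⟩ := PosQH.exists_roots hA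
  obtain ⟨h1, h2, h3⟩ := symm_shift c h
  rw [smallestEig_eq hlm hmn h, h1, h2, h3, ← nonneg_iff_symm_nonneg (by linarith) (by linarith),
    sub_nonneg]

lemma continuous_secondSymm : Continuous secondSymm := by
  unfold secondSymm
  fun_prop

lemma continuous_smallestEig : Continuous fun A : PosQH => smallestEig A := by
  have hs : Continuous fun A : PosQH => secondSymm A :=
    continuous_secondSymm.comp continuous_subtype_val
  have ht : Continuous fun A : PosQH => (A : Matrix (Fin 3) (Fin 3) ℝ).trace :=
    continuous_subtype_val.matrix_trace
  have hd : Continuous fun A : PosQH => (A : Matrix (Fin 3) (Fin 3) ℝ).det :=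
    continuous_subtype_val.matrix_det
  rw [continuous_iff_lower_upperSemicontinuous, lowerSemicontinuous_iff_isOpen_preimage,
    upperSemicontinuous_iff_isOpen_preimage]
  constructor
  · intro c
    simp only [Set.preimage, Set.mem_Ioi, lt_smallestEig_iff (Subtype.prop _)]
    refine IsOpen.and (isOpen_lt ?_ ?_) (IsOpen.and (isOpen_lt ?_ ?_) (isOpen_lt ?_ ?_)) <;> fun_prop
  · intro c
    rw [← isClosed_compl_iff, ← Set.preimage_compl, Set.compl_Iio]
    simp only [Set.preimage, Set.mem_Ici, le_smallestEig_iff (Subtype.prop _)]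
    refine IsClosed.and (isClosed_le ?_ ?_) (IsClosed.and (isClosed_le ?_ ?_) (isClosed_le ?_ ?_))
      <;> fun_prop

lemma exists_eq_conj_of_linearIndependent {A M : Matrix (Fin 3) (Fin 3) ℝ}
    {v : Fin 3 → Fin 3 → ℝ} (hv : LinearIndependent ℝ v)
    (h : ∀ j, A *ᵥ v j = ∑ i, M i j • v i) :
    ∃ P : Matrix (Fin 3) (Fin 3) ℝ, IsUnit P.det ∧ A = P * M * P⁻¹ := by
  have hP : IsUnit (Matrix.of v)ᵀ.det := by
    rw [← Matrix.isUnit_iff_isUnit_det]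
    exact Matrix.linearIndependent_cols_iff_isUnit.1 hv
  refine ⟨(Matrix.of v)ᵀ, hP, ?_⟩
  have hAM : A * (Matrix.of v)ᵀ = (Matrix.of v)ᵀ * M := by
    ext i j
    have := congrFun (h j) i
    simp only [Finset.sum_apply, Pi.smul_apply, smul_eq_mul] at this
    simp only [Matrix.mul_apply, Matrix.transpose_apply, Matrix.of_apply]
    simpa only [Matrix.mulVec, dotProduct, mul_comm (M _ _)] using this
  rw [← hAM, Matrix.mul_nonsing_inv_cancel_right _ _ hP]

lemma isConj_of_eq_conj {A M P : Matrix (Fin 3) (Fin 3) ℝ} (hP : IsUnit P.det)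
    (h : A = P * M * P⁻¹) : IsConj M A := by
  refine ⟨((Matrix.isUnit_iff_isUnit_det P).2 hP).unit, ?_⟩
  simp only [SemiconjBy, IsUnit.unit_spec]
  rw [h, Matrix.nonsing_inv_mul_cancel_right _ _ hP]

lemma exists_pow_three_eq (a : ℝ) : ∃ r : ℝ, r ^ 3 = a := by
  rcases le_total 0 a with ha | ha
  · exact ⟨_, Real.rpow_inv_natCast_pow ha three_ne_zero⟩
  · refine ⟨-(-a) ^ ((3 : ℕ) : ℝ)⁻¹, ?_⟩
    rw [Odd.neg_pow (by decide), Real.rpow_inv_natCast_pow (neg_nonneg.2 ha) three_ne_zero, neg_neg]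

lemma exists_det_one_of_isConj {A B : Matrix (Fin 3) (Fin 3) ℝ} (h : IsConj B A) :
    ∃ P : Matrix (Fin 3) (Fin 3) ℝ, P.det = 1 ∧ A = P * B * P⁻¹ := by
  obtain ⟨c, hc⟩ := h
  have hu : (c : Matrix (Fin 3) (Fin 3) ℝ).det ≠ 0 :=
    ((Matrix.isUnit_iff_isUnit_det _).1 c.isUnit).ne_zero
  obtain ⟨r, hr⟩ : ∃ r : ℝ, r ^ 3 = (c : Matrix (Fin 3) (Fin 3) ℝ).det⁻¹ :=
    exists_pow_three_eq _
  have hQ : (r • (c : Matrix (Fin 3) (Fin 3) ℝ)).det = 1 := by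
    rw [Matrix.det_smul, Fintype.card_fin, hr, inv_mul_cancel₀ hu]
  refine ⟨r • (c : Matrix (Fin 3) (Fin 3) ℝ), hQ, ?_⟩
  rw [Matrix.smul_mul, hc.eq, ← Matrix.mul_smul,
    Matrix.mul_nonsing_inv_cancel_right _ _ (by simp [hQ])]

lemma exists_eigenvector {A : Matrix (Fin 3) (Fin 3) ℝ} {l : ℝ} (h : A.charpoly.IsRoot l) :
    ∃ v ≠ 0, A *ᵥ v = l • v := by
  rw [IsRoot.def, Matrix.eval_charpoly] at h
  obtain ⟨v, hv, h⟩ := Matrix.exists_mulVec_eq_zero_iff.2 h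
  refine ⟨v, hv, ?_⟩
  rw [Matrix.sub_mulVec, sub_eq_zero] at h
  rw [← h]
  simp

lemma isConj_diagonal_of_distinct {A : Matrix (Fin 3) (Fin 3) ℝ} {l m n : ℝ} (hlm : l < m)
    (hmn : m < n) (h : A.charpoly = (X - C l) * (X - C m) * (X - C n)) :
    IsConj (diagonal ![l, m, n]) A := by
  have hroot : ∀ i, A.charpoly.IsRoot (![l, m, n] i) := by
    intro i
    fin_cases i <;> simp [h]
  choose v hv hAv using fun i => exists_eigenvector (hroot i)
  have hinj : Function.Injective ![l, m, n] := by
    intro i j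
    fin_cases i <;> fin_cases j <;> simp <;> intro <;> linarith
  have hli : LinearIndependent ℝ v :=
    Module.End.eigenvectors_linearIndependent' (Matrix.toLin' A) _ hinj v fun i =>
      Module.End.hasEigenvector_iff.2 ⟨Module.End.mem_eigenspace_iff.2 (by simpa using hAv i), hv i⟩
  obtain ⟨P, hP, hA⟩ := exists_eq_conj_of_linearIndependent (A := A) (M := diagonal ![l, m, n])
    hli
    (fun j => by simp [hAv, Matrix.diagonal_apply])
  exact isConj_of_eq_conj hP hA

lemma exists_diagonalization_of_mul_eq_zero {A : Matrix (Fin 3) (Fin 3) ℝ} {l k : ℝ} (hlk : l ≠ k)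
    (h : ∀ v, A *ᵥ (A *ᵥ v) = (l + k) • A *ᵥ v - (l * k) • v) :
    ∃ P D : Matrix (Fin 3) (Fin 3) ℝ, IsUnit P.det ∧ D.IsDiag ∧ A = P * D * P⁻¹ := by
  let s : Set (Fin 3 → ℝ) := {v | ∃ μ : ℝ, A *ᵥ v = μ • v}
  have hs : ⊤ ≤ Submodule.span ℝ s := by
    intro v _
    have h1 : A *ᵥ v - l • v ∈ s := ⟨k, by rw [Matrix.mulVec_sub, Matrix.mulVec_smul, h]; module⟩
    have h2 : A *ᵥ v - k • v ∈ s := ⟨l, by rw [Matrix.mulVec_sub, Matrix.mulVec_smul, h]; module⟩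
    have h3 : v = (k - l)⁻¹ • ((A *ᵥ v - l • v) - (A *ᵥ v - k • v)) := by
      rw [sub_sub_sub_cancel_left, ← sub_smul, smul_smul, inv_mul_cancel₀ (sub_ne_zero.2 hlk.symm),
        one_smul]
    rw [h3]
    exact Submodule.smul_mem _ _
      (Submodule.sub_mem _ (Submodule.subset_span h1) (Submodule.subset_span h2))
  let b := Module.Basis.ofSpan hs
  have hb : ∀ i, b i ∈ s := fun i => Module.Basis.ofSpan_subset hs ⟨i, rfl⟩
  let e := b.indexEquiv (Pi.basisFun ℝ (Fin 3))
  choose μ hμ using fun j : Fin 3 => hb (e.symm j)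
  obtain ⟨P, hP, hA⟩ := exists_eq_conj_of_linearIndependent (A := A) (M := diagonal μ)
    (b.reindex e).linearIndependent (fun j => by simp [hμ, Matrix.diagonal_apply])
  exact ⟨P, _, hP, Matrix.isDiag_diagonal μ, hA⟩

lemma cayley_hamilton_mulVec {A : Matrix (Fin 3) (Fin 3) ℝ} {l m n : ℝ}
    (h : A.charpoly = (X - C l) * (X - C m) * (X - C n)) (v : Fin 3 → ℝ) :
    A *ᵥ (A *ᵥ (A *ᵥ v)) = (l + m + n) • A *ᵥ (A *ᵥ v) - (l * m + l * n + m * n) • A *ᵥ v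
      + (l * m * n) • v := by
  have h1 := Matrix.aeval_self_charpoly A
  have h2 : (X - C l) * (X - C m) * (X - C n) = X ^ 3 - C (l + m + n) * X ^ 2
      + C (l * m + l * n + m * n) * X - C (l * m * n) := by
    simp
    ring
  rw [h, h2] at h1
  replace h1 := congrArg (· *ᵥ v) h1
  simp only [map_add, map_sub, map_mul, aeval_X, aeval_C, Algebra.algebraMap_eq_smul_one,
    pow_succ, pow_zero, one_mul, smul_mul_assoc, ← add_smul, ← mul_smul, Matrix.add_mulVec,
    Matrix.sub_mulVec, Matrix.smul_mulVec, ← Matrix.mulVec_mulVec, Matrix.one_mulVec,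
    Matrix.zero_mulVec] at h1
  rw [← sub_eq_zero, ← h1]
  module

lemma isConj_jordan {A : Matrix (Fin 3) (Fin 3) ℝ} {l k : ℝ} (hlk : l ≠ k)
    (h : A.charpoly = (X - C l) ^ 2 * (X - C k))
    (hA : ¬ ∃ P D : Matrix (Fin 3) (Fin 3) ℝ, IsUnit P.det ∧ D.IsDiag ∧ A = P * D * P⁻¹) :
    IsConj !![l, 1, 0; 0, l, 0; 0, 0, k] A := by
  rw [pow_two] at h
  obtain ⟨w, hw⟩ : ∃ w, A *ᵥ (A *ᵥ w) - ((l + k) • A *ᵥ w - (l * k) • w) ≠ 0 := by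
    by_contra! hw
    exact hA (exists_diagonalization_of_mul_eq_zero hlk fun v => sub_eq_zero.1 (hw v))
  have hCH := cayley_hamilton_mulVec h w
  obtain ⟨u, hu, hAu⟩ := exists_eigenvector (A := A) (l := k) (by simp [h])
  set w₂ := A *ᵥ (A *ᵥ w) - ((l + k) • A *ᵥ w - (l * k) • w) with hw₂
  set w₁ := A *ᵥ w - k • w with hw₁
  have h2 : A *ᵥ w₂ = l • w₂ := by
    simp only [hw₂, Matrix.mulVec_sub, Matrix.mulVec_smul, hCH]
    module
  have h1 : A *ᵥ w₁ = w₂ + l • w₁ := by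
    simp only [hw₂, hw₁, Matrix.mulVec_sub, Matrix.mulVec_smul]
    module
  have hli : LinearIndependent ℝ ![w₂, w₁, u] := by
    rw [Fintype.linearIndependent_iff]
    intro g hg
    simp only [Fin.sum_univ_three, Matrix.cons_val] at hg
    have hg1 : g 1 • w₂ + (g 2 * (k - l)) • u = 0 := by
      have := congrArg (fun x => A *ᵥ x - l • x) hg
      simp only [Matrix.mulVec_add, Matrix.mulVec_smul, h1, h2, hAu, Matrix.mulVec_zero, smul_zero,
        sub_zero] at this
      rw [← this]
      module
    have hg2 : (g 2 * (k - l) * (k - l)) • u = 0 := by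
      have := congrArg (fun x => A *ᵥ x - l • x) hg1
      simp only [Matrix.mulVec_add, Matrix.mulVec_smul, h2, hAu, Matrix.mulVec_zero, smul_zero,
        sub_zero] at this
      rw [← this]
      module
    have e2 : g 2 = 0 := by
      simpa [hu, sub_ne_zero.2 hlk.symm] using hg2
    have e1 : g 1 = 0 := by
      simpa [e2, hw] using hg1
    have e0 : g 0 = 0 := by
      simpa [e1, e2, hw] using hg
    intro i
    fin_cases i <;> assumption
  obtain ⟨P, hP, hA⟩ := exists_eq_conj_of_linearIndependent (A := A)
    (M := !![l, 1, 0; 0, l, 0; 0, 0, k]) hli (fun j => by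
      fin_cases j <;> simp [Fin.sum_univ_three, h1, h2, hAu])
  exact isConj_of_eq_conj hP hA

lemma isConj_of_charpoly_eq {A B : Matrix (Fin 3) (Fin 3) ℝ} (hA : A ∈ PosQH) (hB : B ∈ PosQH)
    (h : A.charpoly = B.charpoly) : IsConj A B := by
  have key : ∀ {A B : Matrix (Fin 3) (Fin 3) ℝ}, A.charpoly = B.charpoly → PosHyperbolic A →
      IsConj A B := by
    rintro A B h ⟨l, m, n, -, hlm, hmn, hA⟩
    exact (isConj_diagonal_of_distinct hlm hmn hA).symm.trans
      (isConj_diagonal_of_distinct hlm hmn (h ▸ hA))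
  obtain ⟨-, hA | ⟨⟨l, hl, hl1, hA⟩, hA'⟩⟩ := hA
  · exact key h hA
  obtain ⟨-, hB | ⟨-, hB'⟩⟩ := hB
  · exact (key h.symm hB).symm
  have hlk := ne_inv_sq hl hl1
  exact (isConj_jordan hlk hA hA').symm.trans (isConj_jordan hlk (h ▸ hA) hB')

lemma two_div_sqrt_le_iff {l t : ℝ} (hl : 0 < l) (ht : 0 < t) :
    2 / √l ≤ t ↔ 4 ≤ l * t ^ 2 := by
  rw [div_le_iff₀ (Real.sqrt_pos.2 hl), ← sq_le_sq₀ zero_le_two (by positivity), mul_pow,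
    Real.sq_sqrt hl.le, mul_comm l]
  norm_num

lemma two_div_sqrt_lt_iff {l t : ℝ} (hl : 0 < l) (ht : 0 < t) :
    2 / √l < t ↔ 4 < l * t ^ 2 := by
  rw [div_lt_iff₀ (Real.sqrt_pos.2 hl), ← sq_lt_sq₀ zero_le_two (by positivity), mul_pow,
    Real.sq_sqrt hl.le, mul_comm l]
  norm_num

lemma mem_interior_regionR_iff (p : ℝ × ℝ) :
    p ∈ interior RegionR ↔
      0 < p.1 ∧ p.1 < 1 ∧ 2 / √p.1 < p.2 ∧ p.2 < p.1 + (p.1 ^ 2)⁻¹ := by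
  constructor
  · intro hp
    obtain ⟨h0, h1, -, -⟩ := interior_subset hp
    refine ⟨h0, h1, ?_⟩
    have hc : Continuous fun s : ℝ => (p.1, p.2 + s) := by fun_prop
    have hs : ∀ᶠ s in nhds (0 : ℝ), (p.1, p.2 + s) ∈ RegionR := by
      refine hc.continuousAt.eventually_mem ?_
      simpa using mem_interior_iff_mem_nhds.1 hp
    obtain ⟨ε, hε, h⟩ := Metric.eventually_nhds_iff.1 hs
    have h2 := h (y := ε / 2) (by rw [Real.dist_eq, sub_zero, abs_of_pos (by positivity)]; linarith)
    have h3 := h (y := -(ε / 2))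
      (by rw [Real.dist_eq, sub_zero, abs_neg, abs_of_pos (by positivity)]; linarith)
    have h4 := h3.2.2.1
    have h5 := h2.2.2.2
    dsimp only at h4 h5
    constructor <;> linarith
  · rintro ⟨h0, h1, h2, h3⟩
    have hu : ContinuousAt (fun q : ℝ × ℝ => 2 / √q.1) p :=
      continuousAt_const.div continuousAt_fst.sqrt (Real.sqrt_pos.2 h0).ne'
    have hv : ContinuousAt (fun q : ℝ × ℝ => q.1 + (q.1 ^ 2)⁻¹) p :=
      continuousAt_fst.add ((continuousAt_fst.pow 2).inv₀ (pow_ne_zero 2 h0.ne'))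
    rw [mem_interior_iff_mem_nhds]
    filter_upwards [continuousAt_const.eventually_lt continuousAt_fst h0,
      continuousAt_fst.eventually_lt continuousAt_const h1,
      hu.eventually_lt continuousAt_snd h2, continuousAt_snd.eventually_lt hv h3] with q a b c d
    exact ⟨a, b, c.le, d.le⟩

/-- The region bounds are sign conditions on the discriminant and on the value at `l` of the
quadratic with roots `m`, `n`. -/
lemma region_bounds {l m n : ℝ} (hl : 0 < l) (hlm : l ≤ m) (hmn : m ≤ n) (h : l * m * n = 1) :
    (2 / √l ≤ m + n ∧ m + n ≤ l + (l ^ 2)⁻¹) ∧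
      (2 / √l < m + n ↔ m < n) ∧ (m + n < l + (l ^ 2)⁻¹ ↔ l < m ∧ l < n) := by
  have hm : 0 < m := hl.trans_le hlm
  have hn : 0 < n := hm.trans_le hmn
  have h1 : l * (m + n) ^ 2 - 4 = l * (n - m) ^ 2 := by linear_combination 4 * h
  have h2 : l + (l ^ 2)⁻¹ - (m + n) = (m - l) * (n - l) / l := by
    field_simp
    linear_combination (-1) * h
  refine ⟨⟨?_, ?_⟩, ?_, ?_⟩
  · rw [two_div_sqrt_le_iff hl (by positivity)]
    have := mul_nonneg hl.le (sq_nonneg (n - m))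
    linarith
  · have : 0 ≤ (m - l) * (n - l) / l :=
      div_nonneg (mul_nonneg (by linarith) (by linarith)) hl.le
    linarith
  · rw [two_div_sqrt_lt_iff hl (by positivity), ← sub_pos, h1, mul_pos_iff_of_pos_left hl,
      sq_pos_iff, sub_ne_zero]
    exact ⟨fun h => lt_of_le_of_ne hmn h.symm, fun h => h.ne'⟩
  · rw [← sub_pos, h2, div_pos_iff_of_pos_right hl]
    constructor
    · intro h
      rcases mul_pos_iff.1 h with ⟨a, b⟩ | ⟨a, b⟩ <;> constructor <;> linarith
    · rintro ⟨a, b⟩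
      exact mul_pos (by linarith) (by linarith)

lemma exists_roots_of_mem_regionR {p : ℝ × ℝ} (hp : p ∈ RegionR) :
    ∃ m n : ℝ, p.1 ≤ m ∧ m ≤ n ∧ p.1 * m * n = 1 ∧ p.2 = m + n := by
  obtain ⟨l, t⟩ := p
  obtain ⟨hl, hl1, h1, h2⟩ := hp
  dsimp only at *
  have ht : 0 < t := lt_of_lt_of_le (div_pos two_pos (Real.sqrt_pos.2 hl)) h1
  rw [two_div_sqrt_le_iff hl ht] at h1
  have hd : 0 ≤ t ^ 2 - 4 / l := by
    rw [sub_nonneg, div_le_iff₀ hl]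
    linarith
  have hs := Real.sq_sqrt hd
  set s := √(t ^ 2 - 4 / l)
  have hs0 : 0 ≤ s := Real.sqrt_nonneg _
  have hls : l * s ^ 2 = l * t ^ 2 - 4 := by
    rw [hs]
    field_simp
  have h2' : l ^ 2 * t ≤ l ^ 3 + 1 := by
    have := mul_le_mul_of_nonneg_left h2 (sq_nonneg l)
    rw [mul_add, mul_inv_cancel₀ (by positivity)] at this
    linarith
  have h2l : 2 * l < t := by
    by_contra! hc
    have : t ^ 2 ≤ (2 * l) ^ 2 := pow_le_pow_left₀ ht.le hc 2
    have h3 : l ^ 3 < 1 := pow_lt_one₀ hl.le hl1 three_ne_zero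
    nlinarith
  refine ⟨(t - s) / 2, (t + s) / 2, ?_, by linarith, ?_, by ring⟩
  · have : s ≤ t - 2 * l := by
      refine le_of_sq_le_sq ?_ (by linarith)
      have : l * s ^ 2 ≤ l * (t - 2 * l) ^ 2 := by
        rw [hls]
        nlinarith
      exact le_of_mul_le_mul_left this hl
    linarith
  · linear_combination (-1 / 4) * hls

/-- The companion matrix of `(X - l) * (X ^ 2 - t * X + l⁻¹)` for `p = (l, t)`. -/
def companionOfInvariant (p : ℝ × ℝ) : Matrix (Fin 3) (Fin 3) ℝ :=
  !![0, 0, 1; 1, 0, -(p.1 * p.2 + p.1⁻¹); 0, 1, p.1 + p.2]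

lemma charpoly_companionOfInvariant {p : ℝ × ℝ} {m n : ℝ} (h : p.1 * m * n = 1)
    (ht : p.2 = m + n) :
    (companionOfInvariant p).charpoly = (X - C p.1) * (X - C m) * (X - C n) := by
  have hmn : p.1⁻¹ = m * n := inv_eq_of_mul_eq_one_right (by linarith)
  rw [charpoly_eq_iff, h]
  refine ⟨?_, ?_, ?_⟩
  · simp [companionOfInvariant, Matrix.trace_fin_three, ht]
    ring
  · simp [companionOfInvariant, secondSymm, ht, hmn]
    ring
  · simp [companionOfInvariant, Matrix.det_fin_three]

lemma trace_companionOfInvariant (p : ℝ × ℝ) : (companionOfInvariant p).trace = p.1 + p.2 := by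
  simp [companionOfInvariant, Matrix.trace_fin_three]

lemma det_companionOfInvariant (p : ℝ × ℝ) : (companionOfInvariant p).det = 1 := by
  simp [companionOfInvariant, Matrix.det_fin_three]

lemma charpoly_eq_of_isConj {A B : Matrix (Fin 3) (Fin 3) ℝ} (h : IsConj A B) :
    A.charpoly = B.charpoly := by
  obtain ⟨c, hc⟩ := h
  rw [← Matrix.charpoly_units_conj c, ← Matrix.coe_units_inv, hc.eq, Units.mul_inv_cancel_right]

lemma sq_eq_of_eq_conj_isDiag {A P D : Matrix (Fin 3) (Fin 3) ℝ} {a b : ℝ} (hP : IsUnit P.det)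
    (hD : D.IsDiag) (hA : A = P * D * P⁻¹) (h : A.charpoly = (X - C a) ^ 2 * (X - C b)) :
    A * A = (a + b) • A - (a * b) • 1 := by
  have hc : D.charpoly = (X - C a) ^ 2 * (X - C b) := by
    rw [← h, charpoly_eq_of_isConj (isConj_of_eq_conj hP hA)]
  obtain ⟨d, rfl⟩ : ∃ d, D = diagonal d := ⟨_, hD.diagonal_diag.symm⟩
  have hd : ∀ i, d i = a ∨ d i = b := by
    intro i
    have h0 : (diagonal d).charpoly.eval (d i) = 0 := by
      rw [Matrix.charpoly_diagonal, eval_prod]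
      exact Finset.prod_eq_zero (Finset.mem_univ i) (by simp)
    rw [hc] at h0
    simpa [sub_eq_zero] using h0
  have hDD : diagonal d * diagonal d = (a + b) • diagonal d - (a * b) • 1 := by
    rw [Matrix.diagonal_mul_diagonal, ← Matrix.diagonal_one, ← Matrix.diagonal_smul,
      ← Matrix.diagonal_smul, Matrix.diagonal_sub]
    congr 1
    ext i
    simp only [Pi.smul_apply, smul_eq_mul]
    rcases hd i with h | h <;> rw [h] <;> ring
  have hPP : P * P⁻¹ = 1 := Matrix.mul_nonsing_inv _ hP
  calc A * A = P * diagonal d * (P⁻¹ * P) * diagonal d * P⁻¹ := by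
        rw [hA]
        simp only [Matrix.mul_assoc]
    _ = P * (diagonal d * diagonal d) * P⁻¹ := by
        rw [Matrix.nonsing_inv_mul _ hP, Matrix.mul_one, Matrix.mul_assoc P]
    _ = (a + b) • A - (a * b) • 1 := by
        rw [hDD, hA, Matrix.mul_sub, Matrix.sub_mul, Matrix.mul_smul, Matrix.mul_smul,
          Matrix.smul_mul, Matrix.smul_mul, Matrix.mul_one, hPP]

lemma companionOfInvariant_not_diagonalizable {p : ℝ × ℝ} {a b : ℝ}
    (h : (companionOfInvariant p).charpoly = (X - C a) ^ 2 * (X - C b)) :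
    ¬ ∃ P D : Matrix (Fin 3) (Fin 3) ℝ, IsUnit P.det ∧ D.IsDiag ∧
      companionOfInvariant p = P * D * P⁻¹ := by
  rintro ⟨P, D, hP, hD, hA⟩
  have := congrFun (congrFun (sq_eq_of_eq_conj_isDiag hP hD hA h) 2) 0
  simp [companionOfInvariant, Matrix.mul_apply, Fin.sum_univ_three] at this

lemma companionOfInvariant_mem {p : ℝ × ℝ} (hp : p ∈ RegionR) : companionOfInvariant p ∈ PosQH := by
  obtain ⟨m, n, hlm, hmn, h, ht⟩ := exists_roots_of_mem_regionR hp
  have hc := charpoly_companionOfInvariant h ht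
  have hl := hp.1
  have hl1 := hp.2.1
  have hm := hl.trans_le hlm
  refine ⟨det_companionOfInvariant p, ?_⟩
  rcases hlm.lt_or_eq with hlm | hlm
  · rcases hmn.lt_or_eq with hmn | rfl
    · exact Or.inl ⟨_, m, n, hl, hlm, hmn, hc⟩
    · have hpm : p.1 = m⁻¹ ^ 2 := by
        field_simp
        linarith
      have hq : (companionOfInvariant p).charpoly = (X - C m) ^ 2 * (X - C (m⁻¹ ^ 2)) := by
        rw [hc, ← hpm]
        ring
      refine Or.inr ⟨⟨m, hm, ?_, hq⟩, companionOfInvariant_not_diagonalizable hq⟩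
      rintro rfl
      norm_num at hpm
      linarith
  · have hpn : n = p.1⁻¹ ^ 2 := by
      rw [← hlm] at h
      field_simp
      linarith
    have hq : (companionOfInvariant p).charpoly = (X - C p.1) ^ 2 * (X - C (p.1⁻¹ ^ 2)) := by
      rw [hc, ← hlm, hpn]
      ring
    exact Or.inr ⟨⟨_, hl, hl1.ne, hq⟩, companionOfInvariant_not_diagonalizable hq⟩

/-- The pair `(λ, τ)` of the smallest eigenvalue and the sum of the other two. -/
def invariant (A : Matrix (Fin 3) (Fin 3) ℝ) : ℝ × ℝ :=
  (smallestEig A, A.trace - smallestEig A)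

lemma invariant_eq {A : Matrix (Fin 3) (Fin 3) ℝ} {l m n : ℝ} (hlm : l ≤ m) (hmn : m ≤ n)
    (h : A.charpoly = (X - C l) * (X - C m) * (X - C n)) : invariant A = (l, m + n) := by
  rw [invariant, smallestEig_eq hlm hmn h, ((charpoly_eq_iff A l m n).1 h).1]
  congr 1
  ring

lemma invariant_mem {A : Matrix (Fin 3) (Fin 3) ℝ} (hA : A ∈ PosQH) : invariant A ∈ RegionR := by
  obtain ⟨l, m, n, hl, hlm, hmn, hln, hp, h⟩ := PosQH.exists_roots hA
  rw [invariant_eq hlm hmn h]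
  obtain ⟨⟨h1, h2⟩, -⟩ := region_bounds hl hlm hmn hp
  refine ⟨hl, ?_, h1, h2⟩
  change l < 1
  by_contra! hl1
  have h3 : 1 ≤ l * m := one_le_mul_of_one_le_of_one_le hl1 (hl1.trans hlm)
  have h4 : 1 < l * m * n := one_lt_mul_of_le_of_lt h3 (hl1.trans_lt hln)
  linarith

lemma PosHyperbolic.invariant_mem_interior {A : Matrix (Fin 3) (Fin 3) ℝ} (hA : A ∈ PosQH)
    (h : PosHyperbolic A) : invariant A ∈ interior RegionR := by
  have hR := invariant_mem hA
  obtain ⟨l, m, n, hl, hlm, hmn, h⟩ := h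
  have hp : l * m * n = 1 := by rw [← ((charpoly_eq_iff A l m n).1 h).2.2, hA.1]
  rw [invariant_eq hlm.le hmn.le h] at hR ⊢
  obtain ⟨-, h1, h2⟩ := region_bounds hl hlm.le hmn.le hp
  exact (mem_interior_regionR_iff _).2
    ⟨hl, hR.2.1, h1.2 hmn, h2.2 ⟨hlm, hlm.trans hmn⟩⟩

lemma QuasiHyperbolic.invariant_notMem_interior {A : Matrix (Fin 3) (Fin 3) ℝ}
    (h : QuasiHyperbolic A) : invariant A ∉ interior RegionR := by
  obtain ⟨⟨l, hl, -, h⟩, -⟩ := h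
  have hp : l * l * l⁻¹ ^ 2 = 1 := by field_simp
  rw [mem_interior_regionR_iff]
  rintro ⟨-, -, h1, h2⟩
  rcases le_total l (l⁻¹ ^ 2) with hle | hle
  · rw [invariant_eq le_rfl hle (by rw [h]; ring)] at h2
    exact lt_irrefl _ ((region_bounds hl le_rfl hle hp).2.2.1 h2).1
  · rw [invariant_eq hle le_rfl (by rw [h]; ring)] at h1
    exact lt_irrefl _ ((region_bounds (by positivity) hle le_rfl (by rw [← hp]; ring)).2.1.1 h1)

lemma invariant_companionOfInvariant {p : ℝ × ℝ} (hp : p ∈ RegionR) :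
    invariant (companionOfInvariant p) = p := by
  obtain ⟨m, n, hlm, hmn, h, ht⟩ := exists_roots_of_mem_regionR hp
  rw [invariant_eq hlm hmn (charpoly_companionOfInvariant h ht), ← ht]

lemma charpoly_companionOfInvariant_invariant {A : Matrix (Fin 3) (Fin 3) ℝ} (hA : A ∈ PosQH) :
    (companionOfInvariant (invariant A)).charpoly = A.charpoly := by
  obtain ⟨l, m, n, hl, hlm, hmn, -, hp, h⟩ := PosQH.exists_roots hA
  rw [invariant_eq hlm hmn h, h, charpoly_companionOfInvariant hp rfl]

lemma ConjSL3.invariant_eq {A B : PosQH} (h : ConjSL3 A B) :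
    invariant (A : Matrix (Fin 3) (Fin 3) ℝ) = invariant (B : Matrix (Fin 3) (Fin 3) ℝ) := by
  obtain ⟨P, hP, hAB⟩ := h
  have hch := charpoly_eq_of_isConj (isConj_of_eq_conj (by simp [hP]) hAB)
  obtain ⟨l, m, n, -, hlm, hmn, -, -, h⟩ := PosQH.exists_roots A.2
  rw [_root_.invariant_eq hlm hmn h, _root_.invariant_eq hlm hmn (hch.trans h)]

lemma continuousOn_companionOfInvariant : ContinuousOn companionOfInvariant RegionR := by
  have hinv : ContinuousOn (fun p : ℝ × ℝ => p.1⁻¹) RegionR :=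
    continuousOn_fst.inv₀ fun p hp => hp.1.ne'
  refine continuousOn_pi.2 fun i => continuousOn_pi.2 fun j => ?_
  fin_cases i <;> fin_cases j <;> simp [companionOfInvariant] <;> fun_prop

/-- The homeomorphism induced by the invariant, with inverse given by companion matrices. -/
def invariantHomeomorph : Quot ConjSL3 ≃ₜ {p : ℝ × ℝ // p ∈ RegionR} where
  toFun := Quot.lift (fun A => ⟨invariant A, invariant_mem A.2⟩)
    fun _ _ h => Subtype.ext h.invariant_eq
  invFun p := Quot.mk _ ⟨companionOfInvariant p, companionOfInvariant_mem p.2⟩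
  left_inv := by
    rintro ⟨A⟩
    exact Quot.sound (exists_det_one_of_isConj (isConj_of_charpoly_eq A.2
      (companionOfInvariant_mem (invariant_mem A.2))
      (charpoly_companionOfInvariant_invariant A.2).symm))
  right_inv p := Subtype.ext (invariant_companionOfInvariant p.2)
  continuous_toFun := by
    refine continuous_quot_lift _ ?_
    refine Continuous.subtype_mk (continuous_smallestEig.prodMk ?_) _
    exact continuous_subtype_val.matrix_trace.sub continuous_smallestEig
  continuous_invFun :=
    continuous_quot_mk.comp (Continuous.subtype_mk continuousOn_companionOfInvariant.domRestrict _)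

/-- The invariant `γ ↦ (λ(γ), τ(γ))` descends to a homeomorphism from the quotient of the
set of positive hyperbolic or quasi-hyperbolic elements of `SL₃(ℝ)` by conjugation onto
the region `R`; interior points of `R` correspond to positive hyperbolic classes and
boundary points of `R` to quasi-hyperbolic classes. -/
theorem invariant_homeomorphism :
    ∃ h : Quot ConjSL3 ≃ₜ {p : ℝ × ℝ // p ∈ RegionR},
      (∀ A : PosQH, (h (Quot.mk ConjSL3 A) : ℝ × ℝ) =
        (smallestEig A,
         Matrix.trace (A : Matrix (Fin 3) (Fin 3) ℝ) - smallestEig A)) ∧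
      (∀ A : PosQH,
        (PosHyperbolic (A : Matrix (Fin 3) (Fin 3) ℝ) ↔
          (smallestEig A, Matrix.trace (A : Matrix (Fin 3) (Fin 3) ℝ) - smallestEig A)
            ∈ interior RegionR) ∧
        (QuasiHyperbolic (A : Matrix (Fin 3) (Fin 3) ℝ) ↔
          (smallestEig A, Matrix.trace (A : Matrix (Fin 3) (Fin 3) ℝ) - smallestEig A)
            ∈ RegionR \ interior RegionR)) := by
  refine ⟨invariantHomeomorph, fun A => rfl, fun A => ?_⟩
  have hmem := invariant_mem A.2
  have hpos := PosHyperbolic.invariant_mem_interior A.2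
  have hquasi := QuasiHyperbolic.invariant_notMem_interior (A := A)
  have hA := A.2.2
  rw [Set.mem_sdiff]
  unfold invariant at hmem hpos hquasi
  tauto

end
end

section
/- Let Γ be a finitely generated group, n ≥ 1, and ρ : Γ → GLₙ(ℝ) a group homomorphism. Equip Hom(Γ, GLₙ(ℝ)) with the topology of pointwise convergence (the subspace topology from the product GLₙ(ℝ)^Γ). Suppose that every map u : Γ → Mₙ(ℝ) satisfying the cocycle condition u(γδ) = u(γ) + ρ(γ)·u(δ)·ρ(γ)⁻¹ for all γ, δ ∈ Γ is a coboundary, i.e., there exists m ∈ Mₙ(ℝ) with u(γ) = ρ(γ)·m·ρ(γ)⁻¹ − m for all γ ∈ Γ. Then ρ is locally rigid: there is a neighborhood U of ρ in Hom(Γ, GLₙ(ℝ)) such that every ρ' ∈ U is conjugate to ρ, i.e., ρ' = g·ρ(·)·g⁻¹ for some g ∈ GLₙ(ℝ). -/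
/-- The space of homomorphisms `Γ → GLₙ(ℝ)`, with the topology of pointwise convergence
(as a subspace of the product `GLₙ(ℝ)^Γ`). -/
abbrev RepSpace (Γ : Type*) [Group Γ] (n : ℕ) : Type _ :=
  {f : Γ → GL (Fin n) ℝ // ∀ γ δ : Γ, f (γ * δ) = f γ * f δ}

open Filter Topology

section Rigidity

variable {A Γ : Type*} [NormedRing A] [NormedAlgebra ℝ A] [Group Γ]

/-- A family of representations whose difference quotients against `ρ` converge on a monoid
generating set has difference quotients converging everywhere, to a `ρ`-derivation. -/
theorem exists_derivation_of_tendsto_on_generators {α : Type*} {l : Filter α} [l.NeBot]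
    {S : Set Γ} (hS : Submonoid.closure S = ⊤) (ρ : Γ →* Aˣ) (σ : α → Γ →* Aˣ) {t : α → ℝ}
    (ht : Tendsto t l (𝓝 0)) (ht0 : ∀ᶠ a in l, t a ≠ 0)
    (hσ : ∀ s ∈ S, ∃ x : A, Tendsto (fun a => (t a)⁻¹ • ((σ a s : A) - ρ s)) l (𝓝 x)) :
    ∃ u : Γ → A, (∀ γ δ, u (γ * δ) = u γ * ρ δ + ρ γ * u δ) ∧
      ∀ γ, Tendsto (fun a => (t a)⁻¹ • ((σ a γ : A) - ρ γ)) l (𝓝 (u γ)) := by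
  have conv : ∀ (γ : Γ) (x : A), Tendsto (fun a => (t a)⁻¹ • ((σ a γ : A) - ρ γ)) l (𝓝 x) →
      Tendsto (fun a => (σ a γ : A)) l (𝓝 (ρ γ)) := by
    intro γ x h
    have h1 := (ht.smul h).add_const (ρ γ : A)
    rw [zero_smul, zero_add] at h1
    refine h1.congr' ?_
    filter_upwards [ht0] with a ha
    rw [smul_inv_smul₀ ha, sub_add_cancel]
  have hmul : ∀ (γ δ : Γ) (x y : A),
      Tendsto (fun a => (t a)⁻¹ • ((σ a γ : A) - ρ γ)) l (𝓝 x) →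
      Tendsto (fun a => (t a)⁻¹ • ((σ a δ : A) - ρ δ)) l (𝓝 y) →
      Tendsto (fun a => (t a)⁻¹ • ((σ a (γ * δ) : A) - ρ (γ * δ))) l
        (𝓝 (x * ρ δ + ρ γ * y)) := by
    intro γ δ x y hx hy
    refine ((hx.mul (conv δ y hy)).add (hy.const_mul (ρ γ : A))).congr fun a => ?_
    simp only [map_mul, Units.val_mul, smul_mul_assoc, mul_smul_comm, ← smul_add]
    congr 1
    noncomm_ring
  have hex : ∀ γ : Γ, ∃ x : A, Tendsto (fun a => (t a)⁻¹ • ((σ a γ : A) - ρ γ)) l (𝓝 x) := by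
    intro γ
    have hγ : γ ∈ Submonoid.closure S := hS ▸ Submonoid.mem_top γ
    induction hγ using Submonoid.closure_induction with
    | mem s hs => exact hσ s hs
    | one => exact ⟨0, by simp⟩
    | mul γ δ _ _ hγ hδ =>
      obtain ⟨x, hx⟩ := hγ
      obtain ⟨y, hy⟩ := hδ
      exact ⟨_, hmul γ δ x y hx hy⟩
  choose u hu using hex
  exact ⟨u, fun γ δ => tendsto_nhds_unique (hu _) (hmul γ δ _ _ (hu γ) (hu δ)), hu⟩

variable [FiniteDimensional ℝ A]

/-- If no nonzero `ρ`-derivation restricts into the subspace `C`, then `ρ` has no small nontrivial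
deformation in the direction of `C`. -/
theorem eventually_eq_zero_of_deformation_mem {S : Finset Γ}
    (hS : Submonoid.closure (S : Set Γ) = ⊤) (ρ : Γ →* Aˣ) (C : Submodule ℝ (S → A))
    (hC : ∀ u : Γ → A, (∀ γ δ, u (γ * δ) = u γ * ρ δ + ρ γ * u δ) →
      (fun s : S => u s) ∈ C → (fun s : S => u s) = 0) :
    ∀ᶠ c : S → A in 𝓝 0, c ∈ C →
      ∀ σ : Γ →* Aˣ, (∀ s : S, (σ s : A) = ρ s + c s) → c = 0 := by
  by_contra hcon
  obtain ⟨U, hU⟩ := exists_ultrafilter_iff.2 (frequently_iff_neBot.1 (not_eventually.1 hcon))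
  have hU0 : Tendsto (fun c : S → A => c) U (𝓝 0) := hU.trans inf_le_left
  have hUp : ∀ᶠ c : S → A in U, c ∈ C ∧
      (∃ σ : Γ →* Aˣ, ∀ s : S, (σ s : A) = ρ s + c s) ∧ c ≠ 0 := by
    have hmem := hU.trans inf_le_right (mem_principal_self _)
    filter_upwards [hmem] with c hc
    replace hc := Classical.not_imp.1 hc
    push Not at hc
    obtain ⟨h1, σ, h2, h3⟩ := hc
    exact ⟨h1, ⟨σ, h2⟩, h3⟩
  have hch : ∀ c : S → A, ∃ σ : Γ →* Aˣ, (∃ σ : Γ →* Aˣ, ∀ s : S, (σ s : A) = ρ s + c s) →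
      ∀ s : S, (σ s : A) = ρ s + c s := by
    intro c
    by_cases h : ∃ σ : Γ →* Aˣ, ∀ s : S, (σ s : A) = ρ s + c s
    · exact ⟨h.choose, fun _ => h.choose_spec⟩
    · exact ⟨1, fun h' => absurd h' h⟩
  choose σ hσ using hch
  have : ProperSpace (S → A) := FiniteDimensional.proper ℝ _
  obtain ⟨v, hv, hUv⟩ := (isCompact_sphere (0 : S → A) 1).ultrafilter_le_nhds
    (U.map fun c => ‖c‖⁻¹ • c) (by
      rw [Ultrafilter.coe_map, le_principal_iff, mem_map]
      filter_upwards [hUp] with c hc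
      simp [norm_smul, hc.2.2])
  replace hUv : Tendsto (fun c : S → A => ‖c‖⁻¹ • c) U (𝓝 v) := hUv
  have hvC : v ∈ C := C.closed_of_finiteDimensional.mem_of_tendsto hUv
    (hUp.mono fun c hc => C.smul_mem _ hc.1)
  have hlim : ∀ s : S, Tendsto (fun c : S → A => ‖c‖⁻¹ • ((σ c s : A) - ρ s)) U (𝓝 (v s)) := by
    intro s
    refine (tendsto_pi_nhds.1 hUv s).congr' ?_
    filter_upwards [hUp] with c hc
    rw [hσ c hc.2.1 s, add_sub_cancel_left, Pi.smul_apply]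
  obtain ⟨u, hu, hu'⟩ := exists_derivation_of_tendsto_on_generators hS ρ σ
    (by simpa using hU0.norm) (hUp.mono fun c hc => norm_ne_zero_iff.2 hc.2.2)
    fun s hs => ⟨_, hlim ⟨s, hs⟩⟩
  have huv : (fun s : S => u s) = v := funext fun s => tendsto_nhds_unique (hu' s) (hlim s)
  have hv0 : v = 0 := huv ▸ hC u hu (huv ▸ hvC)
  simp [hv0] at hv

/-- Infinitesimal rigidity implies local rigidity, for representations of a group in the units of
a finite-dimensional real algebra. -/
theorem eventually_conj_of_derivations_inner {S : Finset Γ}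
    (hS : Submonoid.closure (S : Set Γ) = ⊤) (ρ : Γ →* Aˣ)
    (hρ : ∀ u : Γ → A, (∀ γ δ, u (γ * δ) = u γ * ρ δ + ρ γ * u δ) →
      ∃ m : A, ∀ γ, u γ = m * ρ γ - ρ γ * m) :
    ∀ᶠ f : S → A in 𝓝 (fun s : S => (ρ s : A)), ∀ σ : Γ →* Aˣ, (∀ s : S, (σ s : A) = f s) →
      ∃ g : Aˣ, ∀ γ, σ γ = g * ρ γ * g⁻¹ := by
  have : CompleteSpace A := FiniteDimensional.complete ℝ A
  let D : A →ₗ[ℝ] (S → A) :=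
    LinearMap.pi fun s => LinearMap.mulRight ℝ (ρ s : A) - LinearMap.mulLeft ℝ (ρ s : A)
  obtain ⟨C, hDC⟩ := Submodule.exists_isCompl (LinearMap.range D)
  have : CompleteSpace C := FiniteDimensional.complete ℝ C
  have hgood := eventually_eq_zero_of_deformation_mem hS ρ C fun u hu huC => by
    obtain ⟨m, hm⟩ := hρ u hu
    refine (Submodule.disjoint_def.1 hDC.disjoint) _ ⟨m, ?_⟩ huC
    ext s
    simp [D, hm]
  let F : A × C → S → A := fun p s =>
    NormedSpace.exp p.1 * ((ρ s : A) + (p.2 : S → A) s) * NormedSpace.exp (-p.1)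
  let F' : A × C →L[ℝ] (S → A) := (LinearMap.coprod D C.subtype).toContinuousLinearMap
  have hF : HasStrictFDerivAt F F' 0 := by
    rw [hasStrictFDerivAt_pi']
    intro s
    have hfst : HasStrictFDerivAt (fun p : A × C => p.1) (ContinuousLinearMap.fst ℝ A C) 0 :=
      hasStrictFDerivAt_fst
    have hexp : HasStrictFDerivAt (fun p : A × C => NormedSpace.exp p.1)
        ((1 : A →L[ℝ] A).comp (ContinuousLinearMap.fst ℝ A C)) 0 :=
      HasStrictFDerivAt.comp (0 : A × C) (hasStrictFDerivAt_exp_zero (𝕂 := ℝ) (𝔸 := A)) hfst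
    have hexpneg : HasStrictFDerivAt (fun p : A × C => NormedSpace.exp (-p.1))
        ((1 : A →L[ℝ] A).comp (-ContinuousLinearMap.fst ℝ A C)) 0 := by
      refine HasStrictFDerivAt.comp (g := NormedSpace.exp) (0 : A × C) ?_ hfst.neg
      simpa using hasStrictFDerivAt_exp_zero (𝕂 := ℝ) (𝔸 := A)
    let L : A × C →L[ℝ] A :=
      (ContinuousLinearMap.proj s).comp (C.subtypeL.comp (ContinuousLinearMap.snd ℝ A C))
    have hmid : HasStrictFDerivAt (fun p : A × C => (ρ s : A) + (p.2 : S → A) s) L 0 :=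
      L.hasStrictFDerivAt.const_add (ρ s : A)
    refine ((hexp.mul' hmid).mul' hexpneg).congr_fderiv ?_
    ext p <;> simp [F', D, L]
    abel
  have hF'surj : F'.range = ⊤ := by
    change LinearMap.range (LinearMap.coprod D C.subtype) = ⊤
    rw [LinearMap.range_coprod, Submodule.range_subtype]
    exact hDC.sup_eq_top
  have hF0 : F 0 = fun s : S => (ρ s : A) := by
    ext s
    simp [F]
  rw [← hF0, ← hF.map_nhds_eq_of_surj hF'surj]
  have hsmall : Tendsto (fun p : A × C => (p.2 : S → A)) (𝓝 0) (𝓝 0) :=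
    (continuous_subtype_val.comp continuous_snd).tendsto' _ _ rfl
  rw [eventually_map]
  filter_upwards [hsmall.eventually hgood] with p hp σ hσ
  let : NormedAlgebra ℚ A := NormedAlgebra.restrictScalars ℚ ℝ A
  have hinv : NormedSpace.exp p.1 * NormedSpace.exp (-p.1) = 1 := by
    rw [← NormedSpace.exp_add_of_commute (Commute.neg_right (Commute.refl p.1)), add_neg_cancel,
      NormedSpace.exp_zero]
  have hinv' : NormedSpace.exp (-p.1) * NormedSpace.exp p.1 = 1 := by
    rw [← NormedSpace.exp_add_of_commute (Commute.neg_left (Commute.refl p.1)), neg_add_cancel,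
      NormedSpace.exp_zero]
  let g : Aˣ := ⟨NormedSpace.exp p.1, NormedSpace.exp (-p.1), hinv, hinv'⟩
  have hc : (p.2 : S → A) = 0 := by
    refine hp p.2.2 ((MulAut.conj g⁻¹).toMonoidHom.comp σ) fun s => ?_
    have h : (σ s : A) = g * ((ρ s : A) + (p.2 : S → A) s) * (g⁻¹ : Aˣ) := hσ s
    simp [h, mul_assoc]
  refine ⟨g, fun γ => ?_⟩
  refine DFunLike.congr_fun (g := (MulAut.conj g).toMonoidHom.comp ρ)
    (MonoidHom.eq_of_eqOn_denseM hS fun s hs => Units.ext ?_) γ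
  have h : (σ s : A) = g * ((ρ s : A) + (p.2 : S → A) ⟨s, hs⟩) * (g⁻¹ : Aˣ) := hσ ⟨s, hs⟩
  simp [h, hc]

end Rigidity

/-- Weil's rigidity theorem for `GLₙ(ℝ)`: if every `Ad ∘ ρ`-twisted 1-cocycle
`Γ → Mₙ(ℝ)` is a coboundary, then `ρ` is locally rigid. -/
theorem weil_local_rigidity {Γ : Type*} [Group Γ] (hΓ : Group.FG Γ)
    (n : ℕ) (hn : 1 ≤ n) (ρ : RepSpace Γ n)
    (hvanish : ∀ u : Γ → Matrix (Fin n) (Fin n) ℝ,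
      (∀ γ δ : Γ, u (γ * δ) = u γ +
        (ρ.1 γ : Matrix (Fin n) (Fin n) ℝ) * u δ *
          (((ρ.1 γ)⁻¹ : GL (Fin n) ℝ) : Matrix (Fin n) (Fin n) ℝ)) →
      ∃ m : Matrix (Fin n) (Fin n) ℝ, ∀ γ : Γ,
        u γ = (ρ.1 γ : Matrix (Fin n) (Fin n) ℝ) * m *
          (((ρ.1 γ)⁻¹ : GL (Fin n) ℝ) : Matrix (Fin n) (Fin n) ℝ) - m) :
    ∃ U : Set (RepSpace Γ n), IsOpen U ∧ ρ ∈ U ∧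
      ∀ ρ' ∈ U, ∃ g : GL (Fin n) ℝ, ∀ γ : Γ, ρ'.1 γ = g * ρ.1 γ * g⁻¹ := by
  let : NormedRing (Matrix (Fin n) (Fin n) ℝ) := Matrix.linftyOpNormedRing
  let : NormedAlgebra ℝ (Matrix (Fin n) (Fin n) ℝ) := Matrix.linftyOpNormedAlgebra
  obtain ⟨S, hS⟩ := (Group.fg_iff_monoid_fg.1 hΓ).fg_top
  let hom : RepSpace Γ n → Γ →* GL (Fin n) ℝ := fun σ => MonoidHom.mk' σ.1 σ.2
  have hconj := eventually_conj_of_derivations_inner hS (hom ρ) fun u hu => by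
    obtain ⟨m, hm⟩ := hvanish (fun γ => u γ * (((ρ.1 γ)⁻¹ : GL (Fin n) ℝ) :
        Matrix (Fin n) (Fin n) ℝ)) fun γ δ => by
      have h : u (γ * δ) = u γ * (ρ.1 δ : Matrix (Fin n) (Fin n) ℝ) + ρ.1 γ * u δ := hu γ δ
      rw [h, ρ.2, mul_inv_rev, Units.val_mul, add_mul, mul_assoc (u γ), Units.mul_inv_cancel_left]
      simp only [mul_assoc]
    refine ⟨-m, fun γ => ?_⟩
    have h := congrArg (· * (ρ.1 γ : Matrix (Fin n) (Fin n) ℝ)) (hm γ)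
    simp only [Units.inv_mul_cancel_right, sub_mul] at h
    change u γ = -m * (ρ.1 γ : Matrix (Fin n) (Fin n) ℝ) - ρ.1 γ * -m
    rw [h, neg_mul, mul_neg, sub_neg_eq_add, neg_add_eq_sub]
  have hcont : Continuous fun (σ : RepSpace Γ n) (s : S) =>
      (σ.1 s : Matrix (Fin n) (Fin n) ℝ) :=
    continuous_pi fun s =>
      Units.continuous_val.comp ((continuous_apply (s : Γ)).comp continuous_subtype_val)
  obtain ⟨U, hU, hUo, hρU⟩ := eventually_nhds_iff.1 (hcont.continuousAt.eventually hconj)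
  exact ⟨U, hUo, hρU, fun ρ' hρ' => hU ρ' hρ' (hom ρ') fun _ => rfl⟩
end

section
/- Let (S, M) be a Coxeter system with S finite, and suppose it is irreducible, i.e., the graph on S with an edge between s and t whenever M_{st} ≠ 2 is connected. Then the associated Coxeter group W is finite, or virtually abelian, or large. -/
open Real

set_option linter.unusedSectionVars false

namespace CoxeterMatrix

variable {S : Type*} (M : CoxeterMatrix S)

/-- Twice the cosine matrix of a Coxeter matrix; the entry is `-2` where the order is infinite. -/
noncomputable def cartan (s t : S) : ℝ := -2 * cos (π / M s t)

lemma cartan_self (s : S) : M.cartan s s = 2 := by simp [cartan]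

lemma cartan_comm (s t : S) : M.cartan s t = M.cartan t s := by
  rw [cartan, cartan, M.symmetric]

lemma two_le_entry {s t : S} (hst : s ≠ t) (h0 : M s t ≠ 0) : 2 ≤ M s t := by
  have := M.off_diagonal s t hst
  omega

lemma abs_cartan_le (s t : S) : |M.cartan s t| ≤ 2 := by
  rw [cartan, abs_mul]
  have := abs_cos_le_one (π / M s t)
  norm_num
  linarith

lemma cartan_eq_zero {s t : S} (hst : s ≠ t) (h : M.cartan s t = 0) : M s t = 2 := by
  have h0 : M s t ≠ 0 := fun h0 ↦ by simp [cartan, h0] at h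
  have h2 := M.two_le_entry hst h0
  by_contra hne
  have h3 : (3 : ℝ) ≤ M s t := by exact_mod_cast (show 3 ≤ M s t by omega)
  have : 0 < cos (π / M s t) := by
    apply cos_pos_of_mem_Ioo
    have : π / M s t ≤ π / 3 := by gcongr
    have : 0 < π / M s t := by positivity
    constructor <;> linarith [pi_pos]
  rw [cartan] at h
  linarith

/-- The coefficients `sin (j π / m) / sin (π / m)` of the roots of a dihedral group of order `2 * m`,
with their limits `j` when `m = 0` stands for the infinite dihedral group. -/
noncomputable def dihedralCoeff (m j : ℕ) : ℝ :=
  if m = 0 then j else sin (j * (π / m)) / sin (π / m)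

lemma sin_pi_div_pos {m : ℕ} (hm : 2 ≤ m) : 0 < sin (π / m) := by
  have hm' : (2 : ℝ) ≤ m := by exact_mod_cast hm
  apply sin_pos_of_pos_of_lt_pi (by positivity)
  exact div_lt_self pi_pos (by linarith)

lemma dihedralCoeff_zero (m : ℕ) : dihedralCoeff m 0 = 0 := by simp [dihedralCoeff]

lemma dihedralCoeff_one {m : ℕ} (hm : m ≠ 1) : dihedralCoeff m 1 = 1 := by
  by_cases h0 : m = 0
  · simp [dihedralCoeff, h0]
  · have := sin_pi_div_pos (m := m) (by omega)
    simp [dihedralCoeff, h0, this.ne']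

lemma dihedralCoeff_add_two (m j : ℕ) :
    dihedralCoeff m (j + 2) = 2 * cos (π / m) * dihedralCoeff m (j + 1) - dihedralCoeff m j := by
  by_cases h0 : m = 0
  · simp [dihedralCoeff, h0]; ring
  · simp only [dihedralCoeff, h0, if_false]
    have e1 : ((j + 2 : ℕ) : ℝ) * (π / m) = (j + 1 : ℕ) * (π / m) + π / m := by push_cast; ring
    have e2 : (j : ℝ) * (π / m) = (j + 1 : ℕ) * (π / m) - π / m := by push_cast; ring
    rw [e1, e2, sin_add, sin_sub]
    ring

lemma dihedralCoeff_nonneg {m j : ℕ} (h : m = 0 ∨ j ≤ m) : 0 ≤ dihedralCoeff m j := by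
  by_cases h0 : m = 0
  · simp [dihedralCoeff, h0]
  · have hj : (j : ℝ) ≤ m := by exact_mod_cast h.resolve_left h0
    have hm : (1 : ℝ) ≤ m := by exact_mod_cast Nat.one_le_iff_ne_zero.2 h0
    simp only [dihedralCoeff, h0, if_false]
    apply div_nonneg
    · apply sin_nonneg_of_nonneg_of_le_pi (by positivity)
      rw [← mul_div_assoc, div_le_iff₀ (by linarith), mul_comm π]
      gcongr
    · exact sin_nonneg_of_nonneg_of_le_pi (by positivity) (div_le_self pi_pos.le hm)

lemma dihedralCoeff_add_self {m : ℕ} (hm : m ≠ 0) (j : ℕ) :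
    dihedralCoeff m (j + m) = - dihedralCoeff m j := by
  have hm' : (m : ℝ) ≠ 0 := by exact_mod_cast hm
  simp only [dihedralCoeff, hm, if_false]
  have : ((j + m : ℕ) : ℝ) * (π / m) = j * (π / m) + π := by push_cast; field_simp
  rw [this, sin_add_pi, neg_div]

variable [Fintype S] [DecidableEq S]

/-- The symmetric bilinear form of the geometric representation, normalised to take the value `2`
on simple roots. -/
noncomputable def form : (S → ℝ) →ₗ[ℝ] (S → ℝ) →ₗ[ℝ] ℝ :=
  Matrix.toLinearMap₂' ℝ (Matrix.of M.cartan)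

/-- The simple root indexed by `s`. -/
def simpleRoot (s : S) : S → ℝ := Pi.single s 1

lemma form_apply (x y : S → ℝ) : M.form x y = ∑ s, ∑ t, x s * M.cartan s t * y t := by
  simp [form, Matrix.toLinearMap₂'_apply]
  refine Finset.sum_congr rfl fun s _ ↦ Finset.sum_congr rfl fun t _ ↦ ?_
  ring

lemma form_comm (x y : S → ℝ) : M.form x y = M.form y x := by
  rw [form_apply, form_apply, Finset.sum_comm]
  refine Finset.sum_congr rfl fun s _ ↦ Finset.sum_congr rfl fun t _ ↦ ?_
  rw [M.cartan_comm]
  ring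

lemma form_simpleRoot (s t : S) :
    M.form (simpleRoot s) (simpleRoot t) = M.cartan s t := by
  simp [form_apply, simpleRoot, Pi.single_apply]

lemma sum_smul_simpleRoot (v : S → ℝ) : ∑ s, v s • simpleRoot s = v := by
  ext t
  simp [simpleRoot, Pi.single_apply]

/-- The vector `x` minus its component along `v`: the reflection in `v` if `M.form v v = 2`. -/
noncomputable def reflect (v : S → ℝ) : Module.End ℝ (S → ℝ) :=
  Module.preReflection v (M.form v)

lemma reflect_apply (v x : S → ℝ) : M.reflect v x = x - M.form v x • v :=
  Module.preReflection_apply _ _ _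

lemma reflect_reflect {v : S → ℝ} (hv : M.form v v = 2) (x : S → ℝ) :
    M.reflect v (M.reflect v x) = x :=
  Module.involutive_preReflection hv x

lemma form_reflect {v : S → ℝ} (hv : M.form v v = 2) (x y : S → ℝ) :
    M.form (M.reflect v x) (M.reflect v y) = M.form x y := by
  simp only [reflect_apply, map_sub, LinearMap.sub_apply, map_smul, LinearMap.smul_apply, hv,
    smul_eq_mul, M.form_comm x v]
  ring

/-- The `j`-th root met when alternately applying the reflections in the simple roots of `s`
and `t`. -/
noncomputable def dihedralRoot (s t : S) (j : ℕ) : S → ℝ :=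
  dihedralCoeff (M s t) (j + 1) • simpleRoot s + dihedralCoeff (M s t) j • simpleRoot t

lemma cartan_mul_dihedralCoeff (s t : S) (j : ℕ) :
    M.cartan s t * dihedralCoeff (M s t) (j + 1) =
      - dihedralCoeff (M s t) (j + 2) - dihedralCoeff (M s t) j := by
  rw [dihedralCoeff_add_two, cartan]
  ring

lemma reflect_simpleRoot_right (s t : S) (a b : ℝ) :
    M.reflect (simpleRoot t) (a • simpleRoot s + b • simpleRoot t) =
      a • simpleRoot s + (- b - M.cartan s t * a) • simpleRoot t := by
  simp only [reflect_apply, map_add, map_smul, form_simpleRoot, cartan_self,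
    M.cartan_comm t s]
  module

lemma reflect_simpleRoot_left (s t : S) (a b : ℝ) :
    M.reflect (simpleRoot s) (a • simpleRoot s + b • simpleRoot t) =
      (- a - M.cartan s t * b) • simpleRoot s + b • simpleRoot t := by
  simp only [reflect_apply, map_add, map_smul, form_simpleRoot, cartan_self]
  module

lemma reflect_reflect_dihedralRoot (s t : S) (j : ℕ) :
    M.reflect (simpleRoot s) (M.reflect (simpleRoot t) (M.dihedralRoot s t j)) =
      M.dihedralRoot s t (j + 2) := by
  rw [dihedralRoot, reflect_simpleRoot_right, reflect_simpleRoot_left, dihedralRoot,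
    cartan_mul_dihedralCoeff]
  have h := M.cartan_mul_dihedralCoeff s t (j + 1)
  congr 2
  · rw [show -dihedralCoeff (M s t) j - (-dihedralCoeff (M s t) (j + 2) - dihedralCoeff (M s t) j)
      = dihedralCoeff (M s t) (j + 1 + 1) by ring, h]
    ring
  · ring

lemma dihedralRoot_zero {s t : S} (hst : s ≠ t) : M.dihedralRoot s t 0 = simpleRoot s := by
  simp [dihedralRoot, dihedralCoeff_zero, dihedralCoeff_one (M.off_diagonal s t hst)]

lemma dihedralRoot_one {s t : S} (hst : s ≠ t) :
    M.dihedralRoot s t 1 = M.reflect (simpleRoot s) (simpleRoot t) := by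
  have h := dihedralCoeff_add_two (M s t) 0
  simp only [zero_add, dihedralCoeff_zero, dihedralCoeff_one (M.off_diagonal s t hst)] at h
  simp only [dihedralRoot, reflect_apply, form_simpleRoot, Nat.reduceAdd, h,
    dihedralCoeff_one (M.off_diagonal s t hst), cartan]
  module

lemma dihedralRoot_add_entry {s t : S} (h0 : M s t ≠ 0) (j : ℕ) :
    M.dihedralRoot s t (j + M s t) = - M.dihedralRoot s t j := by
  rw [dihedralRoot, dihedralRoot, add_right_comm, dihedralCoeff_add_self h0,
    dihedralCoeff_add_self h0]
  module

lemma form_dihedralRoot {s t : S} (hst : s ≠ t) (h0 : M s t ≠ 0) (i j : ℕ) :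
    M.form (M.dihedralRoot s t i) (M.dihedralRoot s t j) =
      2 * cos (((i : ℝ) - j) * (π / M s t)) := by
  have hsin := sin_pi_div_pos (M.two_le_entry hst h0)
  simp only [dihedralRoot, map_add, map_smul, LinearMap.add_apply, LinearMap.smul_apply,
    form_simpleRoot, cartan_self, smul_eq_mul, M.cartan_comm t s]
  simp only [dihedralCoeff, h0, if_false, cartan]
  set θ := π / M s t
  push_cast
  rw [add_mul, add_mul, one_mul, sin_add, sin_add, sub_mul, cos_sub]
  have h1 := sin_sq_add_cos_sq θ
  have h2 : cos θ ^ 2 = 1 - sin θ ^ 2 := by linarith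
  field_simp
  ring_nf
  simp only [h2]
  ring_nf

lemma isLiftable_reflect : M.IsLiftable fun s ↦ M.reflect (simpleRoot s) := by
  intro s t
  by_cases hst : s = t
  · subst hst
    rw [M.diagonal, pow_one]
    exact LinearMap.ext (M.reflect_reflect (by rw [form_simpleRoot, cartan_self]))
  by_cases h0 : M s t = 0
  · rw [h0, pow_zero]
  set g := M.reflect (simpleRoot s) * M.reflect (simpleRoot t) with hg
  have hpow (k j : ℕ) : (g ^ k) (M.dihedralRoot s t j) = M.dihedralRoot s t (j + 2 * k) := by
    induction k with
    | zero => simp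
    | succ k ih =>
      rw [pow_succ', Module.End.mul_apply, ih, hg, Module.End.mul_apply,
        reflect_reflect_dihedralRoot]
      rfl
  have hroot (j : ℕ) : (g ^ M s t) (M.dihedralRoot s t j) = M.dihedralRoot s t j := by
    rw [hpow, two_mul, ← add_assoc, dihedralRoot_add_entry _ h0, dihedralRoot_add_entry _ h0,
      neg_neg]
  have hs : (g ^ M s t) (simpleRoot s) = simpleRoot s := by
    simpa only [dihedralRoot_zero _ hst] using hroot 0
  have ht : (g ^ M s t) (simpleRoot t) = simpleRoot t := by
    have h2 := M.two_le_entry hst h0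
    have h1 := hroot (M s t - 1)
    have e : M.dihedralRoot s t (M s t - 1) = simpleRoot t := by
      have hu0 := dihedralCoeff_add_self h0 0
      have hu1 := dihedralCoeff_add_two (M s t) (M s t - 1)
      rw [show M s t - 1 + 2 = 1 + M s t by omega, show M s t - 1 + 1 = 0 + M s t by omega,
        dihedralCoeff_add_self h0, dihedralCoeff_add_self h0, dihedralCoeff_zero,
        dihedralCoeff_one (M.off_diagonal s t hst)] at hu1
      rw [dihedralRoot, show M s t - 1 + 1 = 0 + M s t by omega, hu0, dihedralCoeff_zero,
        show dihedralCoeff (M s t) (M s t - 1) = 1 by linarith]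
      module
    rwa [e] at h1
  have hperp (x : S → ℝ) (h1 : M.form (simpleRoot s) x = 0) (h2 : M.form (simpleRoot t) x = 0) :
      (g ^ M s t) x = x := by
    have : g x = x := by simp [hg, reflect_apply, h1, h2]
    rw [Module.End.pow_apply]
    exact Function.iterate_fixed this _
  have hdet : 4 - M.cartan s t ^ 2 ≠ 0 := by
    have hsin := sin_pi_div_pos (M.two_le_entry hst h0)
    have h1 := sin_sq_add_cos_sq (π / M s t)
    rw [cartan]
    nlinarith [sq_pos_of_pos hsin]
  refine LinearMap.ext fun x ↦ ?_
  set d := 4 - M.cartan s t ^ 2 with hd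
  set p := M.form (simpleRoot s) x with hp
  set q := M.form (simpleRoot t) x with hq
  set a := (2 * p - M.cartan s t * q) / d with ha
  set b := (2 * q - M.cartan s t * p) / d with hb
  have key := hperp (x - (a • simpleRoot s + b • simpleRoot t))
    (by simp only [map_sub, map_add, map_smul, form_simpleRoot, cartan_self, smul_eq_mul, ← hp,
          ha, hb]
        field_simp
        rw [hd]
        ring)
    (by simp only [map_sub, map_add, map_smul, form_simpleRoot, cartan_self, smul_eq_mul, ← hq,
          ha, hb, M.cartan_comm t s]
        field_simp
        rw [hd]
        ring)
  rw [Module.End.one_apply]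
  simpa only [map_sub, map_add, map_smul, hs, ht, sub_left_inj] using key

end CoxeterMatrix

namespace CoxeterMatrix

variable {S : Type*} (M : CoxeterMatrix S) [Fintype S] [DecidableEq S]

/-- The geometric representation of a Coxeter group. -/
noncomputable def rep : M.Group →* Module.End ℝ (S → ℝ) :=
  M.toCoxeterSystem.lift ⟨_, M.isLiftable_reflect⟩

lemma rep_simple (s : S) : M.rep (M.toCoxeterSystem.simple s) = M.reflect (simpleRoot s) :=
  M.toCoxeterSystem.lift_apply_simple _ s

lemma rep_mul_apply (a b : M.Group) (x : S → ℝ) : M.rep (a * b) x = M.rep a (M.rep b x) := by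
  rw [map_mul, Module.End.mul_apply]

@[simp] lemma rep_one_apply (x : S → ℝ) : M.rep 1 x = x := by
  rw [map_one, Module.End.one_apply]

@[simp] lemma rep_inv_apply_self (a : M.Group) (x : S → ℝ) : M.rep a⁻¹ (M.rep a x) = x := by
  rw [← rep_mul_apply, inv_mul_cancel, rep_one_apply]

@[simp] lemma rep_apply_inv_self (a : M.Group) (x : S → ℝ) : M.rep a (M.rep a⁻¹ x) = x := by
  rw [← rep_mul_apply, mul_inv_cancel, rep_one_apply]

lemma rep_injective (a : M.Group) : Function.Injective (M.rep a) :=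
  Function.LeftInverse.injective (M.rep_inv_apply_self a)

lemma form_simpleRoot_self (s : S) : M.form (simpleRoot s) (simpleRoot s) = 2 := by
  rw [form_simpleRoot, cartan_self]

lemma form_rep (a : M.Group) (x y : S → ℝ) : M.form (M.rep a x) (M.rep a y) = M.form x y := by
  induction a using M.toCoxeterSystem.simple_induction_left with
  | one => simp
  | mul_simple_left a s ih =>
    rw [rep_mul_apply, rep_mul_apply, rep_simple, form_reflect _ (M.form_simpleRoot_self s), ih]

/-- The roots of a Coxeter group: the images of the simple roots under the group. -/
def IsRoot (v : S → ℝ) : Prop := ∃ a s, v = M.rep a (simpleRoot s)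

variable {M}

lemma isRoot_simpleRoot (s : S) : M.IsRoot (simpleRoot s) := ⟨1, s, by simp⟩

lemma IsRoot.rep {v : S → ℝ} (hv : M.IsRoot v) (a : M.Group) : M.IsRoot (M.rep a v) := by
  obtain ⟨b, s, rfl⟩ := hv
  exact ⟨a * b, s, (M.rep_mul_apply _ _ _).symm⟩

lemma rep_simple_simpleRoot (s : S) :
    M.rep (M.toCoxeterSystem.simple s) (simpleRoot s) = - simpleRoot s := by
  rw [rep_simple, reflect_apply, form_simpleRoot_self]
  module

lemma IsRoot.neg {v : S → ℝ} (hv : M.IsRoot v) : M.IsRoot (-v) := by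
  obtain ⟨a, s, rfl⟩ := hv
  refine ⟨a * M.toCoxeterSystem.simple s, s, ?_⟩
  rw [rep_mul_apply, rep_simple_simpleRoot, map_neg]

lemma IsRoot.form_self {v : S → ℝ} (hv : M.IsRoot v) : M.form v v = 2 := by
  obtain ⟨a, s, rfl⟩ := hv
  rw [form_rep, form_simpleRoot_self]

lemma IsRoot.ne_zero {v : S → ℝ} (hv : M.IsRoot v) : v ≠ 0 := by
  rintro rfl
  simpa using hv.form_self

variable (M) in
lemma rep_conj_simple (a : M.Group) (s : S) :
    M.rep (a * M.toCoxeterSystem.simple s * a⁻¹) = M.reflect (M.rep a (simpleRoot s)) := by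
  refine LinearMap.ext fun x ↦ ?_
  rw [rep_mul_apply, rep_mul_apply, rep_simple, reflect_apply, reflect_apply, map_sub, map_smul,
    rep_apply_inv_self, ← M.form_rep a, rep_apply_inv_self]

lemma IsRoot.exists_rep_eq_reflect {v : S → ℝ} (hv : M.IsRoot v) :
    ∃ r : M.Group, M.rep r = M.reflect v := by
  obtain ⟨a, s, rfl⟩ := hv
  exact ⟨_, M.rep_conj_simple a s⟩

lemma simpleRoot_nonneg (s : S) : (0 : S → ℝ) ≤ simpleRoot s := by
  intro t
  simp only [simpleRoot, Pi.single_apply, Pi.zero_apply]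
  split_ifs <;> norm_num

variable (M)

lemma rep_alternatingWord {s t : S} (hst : s ≠ t) (k : ℕ) :
    M.rep (M.toCoxeterSystem.wordProd (CoxeterSystem.alternatingWord s t k)) (simpleRoot s) =
      if Even k then
        dihedralCoeff (M s t) (k + 1) • simpleRoot s + dihedralCoeff (M s t) k • simpleRoot t
      else
        dihedralCoeff (M s t) k • simpleRoot s + dihedralCoeff (M s t) (k + 1) • simpleRoot t := by
  induction k with
  | zero =>
    simp [CoxeterSystem.alternatingWord, dihedralCoeff_zero,
      dihedralCoeff_one (M.off_diagonal s t hst)]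
  | succ k ih =>
    rw [CoxeterSystem.alternatingWord_succ', CoxeterSystem.wordProd_cons, rep_mul_apply, ih]
    by_cases hk : Even k
    · simp only [hk, if_true, Nat.even_add_one, not_true, if_false]
      rw [rep_simple, reflect_simpleRoot_right, cartan_mul_dihedralCoeff]
      module
    · simp only [hk, if_false, Nat.even_add_one, not_false_eq_true, if_true]
      rw [rep_simple, reflect_simpleRoot_left, cartan_mul_dihedralCoeff]
      module

lemma rep_simpleRoot_nonneg (w : M.Group) (s : S)
    (h : M.toCoxeterSystem.length w < M.toCoxeterSystem.length (w * M.toCoxeterSystem.simple s)) :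
    0 ≤ M.rep w (simpleRoot s) := by
  set cs := M.toCoxeterSystem with hcs
  induction hn : cs.length w using Nat.strong_induction_on generalizing w s with
  | _ n ih =>
  subst hn
  by_cases hw : w = 1
  · subst hw
    rw [rep_one_apply]
    exact simpleRoot_nonneg s
  obtain ⟨t, ht⟩ := cs.exists_rightDescent_of_ne_one hw
  have hst : s ≠ t := by
    rintro rfl
    exact absurd ht h.not_gt
  let P (k : ℕ) : Prop := ∃ v, w = v * cs.wordProd (CoxeterSystem.alternatingWord s t k) ∧
    cs.length w = cs.length v + k
  have hPle (k : ℕ) (hk : P k) : k ≤ cs.length w := by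
    obtain ⟨v, -, h⟩ := hk
    omega
  have hP1 : P 1 := by
    refine ⟨w * cs.simple t, ?_, ?_⟩
    · simp [CoxeterSystem.alternatingWord]
    · exact (cs.isRightDescent_iff.1 ht).symm
  have hPdown (j : ℕ) (hj : P (j + 1)) : P j := by
    obtain ⟨v, hv, hl⟩ := hj
    rw [CoxeterSystem.alternatingWord_succ', CoxeterSystem.wordProd_cons, ← mul_assoc] at hv
    refine ⟨_, hv, ?_⟩
    have h1 := cs.length_mul_le (v * cs.simple (if Even j then t else s))
      (cs.wordProd (CoxeterSystem.alternatingWord s t j))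
    rw [← hv] at h1
    have h2 := cs.length_wordProd_le (CoxeterSystem.alternatingWord s t j)
    rw [CoxeterSystem.length_alternatingWord] at h2
    have h3 := cs.length_mul_le v (cs.simple (if Even j then t else s))
    rw [cs.length_simple] at h3
    omega
  have hPm (k m : ℕ) (hk : P k) (hmk : m ≤ k) : P m := by
    induction k, hmk using Nat.le_induction with
    | base => exact hk
    | succ k _ ih => exact ih (hPdown k hk)
  classical
  obtain ⟨k, hk1, hk, hkmax⟩ : ∃ k, 1 ≤ k ∧ P k ∧ ¬ P (k + 1) := by
    refine ⟨Nat.findGreatest P (cs.length w), Nat.le_findGreatest (hPle 1 hP1) hP1,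
      Nat.findGreatest_spec (hPle 1 hP1) hP1, fun hc ↦ ?_⟩
    exact Nat.findGreatest_is_greatest (Nat.lt_succ_self _) (hPle _ hc) hc
  have hkm : M s t = 0 ∨ k + 1 ≤ M s t := by
    by_contra! hcon
    obtain ⟨h0, hlt⟩ := hcon
    obtain ⟨v, hv, hl⟩ := hPm k (M s t) hk (by omega)
    obtain ⟨m, hm⟩ : ∃ m, M s t = m + 1 := ⟨M s t - 1, by omega⟩
    have hb := cs.wordProd_braidWord_eq s t
    rw [CoxeterSystem.braidWord, CoxeterSystem.braidWord, M.symmetric t s] at hb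
    rw [hb, hm, CoxeterSystem.alternatingWord_succ, CoxeterSystem.wordProd_concat,
      ← mul_assoc] at hv
    have hv' : w * cs.simple s = v * cs.wordProd (CoxeterSystem.alternatingWord s t m) := by
      rw [hv, cs.simple_mul_simple_cancel_right]
    have h1 := cs.length_mul_le v (cs.wordProd (CoxeterSystem.alternatingWord s t m))
    rw [← hv'] at h1
    have h2 := cs.length_wordProd_le (CoxeterSystem.alternatingWord s t m)
    rw [CoxeterSystem.length_alternatingWord] at h2
    omega
  obtain ⟨v, hv, hl⟩ := hk
  have hnext : cs.length v < cs.length (v * cs.simple (if Even k then t else s)) := by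
    by_contra hcon
    have h1 := cs.length_mul_simple v (if Even k then t else s)
    refine hkmax ⟨v * cs.simple (if Even k then t else s), ?_, by omega⟩
    rw [CoxeterSystem.alternatingWord_succ', CoxeterSystem.wordProd_cons, ← mul_assoc,
      cs.simple_mul_simple_cancel_right, hv]
  have hfirst : cs.length v < cs.length (v * cs.simple (if Even k then s else t)) := by
    by_contra hcon
    obtain ⟨j, rfl⟩ : ∃ j, k = j + 1 := ⟨k - 1, by omega⟩
    have hy : (if Even (j + 1) then s else t) = if Even j then t else s := by
      by_cases hj : Even j <;> simp [hj, Nat.even_add_one]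
    rw [hy] at hcon
    have h0 := cs.length_mul_simple v (if Even j then t else s)
    rw [CoxeterSystem.alternatingWord_succ', CoxeterSystem.wordProd_cons, ← mul_assoc] at hv
    have h1 := cs.length_mul_le (v * cs.simple (if Even j then t else s))
      (cs.wordProd (CoxeterSystem.alternatingWord s t j))
    rw [← hv] at h1
    have h2 := cs.length_wordProd_le (CoxeterSystem.alternatingWord s t j)
    rw [CoxeterSystem.length_alternatingWord] at h2
    omega
  have hboth : 0 ≤ M.rep v (simpleRoot s) ∧ 0 ≤ M.rep v (simpleRoot t) := by
    have hvw : cs.length v < cs.length w := by omega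
    by_cases hk : Even k <;> simp only [hk, if_true, if_false] at hnext hfirst
    · exact ⟨ih _ hvw v s hfirst rfl, ih _ hvw v t hnext rfl⟩
    · exact ⟨ih _ hvw v s hnext rfl, ih _ hvw v t hfirst rfl⟩
  have hc0 : 0 ≤ dihedralCoeff (M s t) k := dihedralCoeff_nonneg (hkm.imp_right (by omega))
  have hc1 : 0 ≤ dihedralCoeff (M s t) (k + 1) := dihedralCoeff_nonneg hkm
  rw [hv, rep_mul_apply, rep_alternatingWord _ hst]
  split_ifs <;> rw [map_add, map_smul, map_smul] <;>
    exact add_nonneg (smul_nonneg ‹_› hboth.1) (smul_nonneg ‹_› hboth.2)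

lemma rep_simpleRoot_nonpos (w : M.Group) (s : S)
    (h : M.toCoxeterSystem.IsRightDescent w s) : M.rep w (simpleRoot s) ≤ 0 := by
  have := M.rep_simpleRoot_nonneg (w * M.toCoxeterSystem.simple s) s
    (by rwa [M.toCoxeterSystem.simple_mul_simple_cancel_right])
  rw [rep_mul_apply, rep_simple_simpleRoot, map_neg] at this
  exact neg_nonneg.1 this

variable {M}

lemma IsRoot.nonneg_or_nonpos {v : S → ℝ} (hv : M.IsRoot v) : 0 ≤ v ∨ v ≤ 0 := by
  obtain ⟨a, s, rfl⟩ := hv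
  by_cases h : M.toCoxeterSystem.IsRightDescent a s
  · exact Or.inr (M.rep_simpleRoot_nonpos a s h)
  · refine Or.inl (M.rep_simpleRoot_nonneg a s ?_)
    have := M.toCoxeterSystem.not_isRightDescent_iff.1 h
    omega

variable (M) in
/-- The geometric representation is faithful. -/
lemma rep_faithful : Function.Injective M.rep := by
  rw [injective_iff_map_eq_one]
  intro a ha
  by_contra hne
  obtain ⟨s, hs⟩ := M.toCoxeterSystem.exists_rightDescent_of_ne_one hne
  have h := M.rep_simpleRoot_nonpos a s hs
  rw [ha, Module.End.one_apply] at h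
  have := h s
  simp [simpleRoot] at this
  linarith

/-- The sum of the coefficients with respect to the simple roots. -/
noncomputable def height : (S → ℝ) →ₗ[ℝ] ℝ := ∑ s, LinearMap.proj s

lemma height_apply (v : S → ℝ) : height v = ∑ s, v s := by simp [height]

lemma height_pos {v : S → ℝ} (h0 : v ≠ 0) (hv : 0 ≤ v) : 0 < height v := by
  rw [height_apply]
  exact Fintype.sum_pos (lt_of_le_of_ne hv h0.symm)

lemma IsRoot.height_pos_iff {v : S → ℝ} (hv : M.IsRoot v) : 0 < height v ↔ 0 ≤ v := by
  refine ⟨fun h ↦ hv.nonneg_or_nonpos.resolve_right fun h' ↦ ?_, height_pos hv.ne_zero⟩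
  have := height_pos (neg_ne_zero.2 hv.ne_zero) (neg_nonneg.2 h')
  rw [map_neg] at this
  linarith

lemma IsRoot.height_ne_zero {v : S → ℝ} (hv : M.IsRoot v) : height v ≠ 0 := by
  intro h
  rcases hv.nonneg_or_nonpos with h' | h'
  · exact (height_pos hv.ne_zero h').ne' h
  · have := height_pos (neg_ne_zero.2 hv.ne_zero) (neg_nonneg.2 h')
    rw [map_neg] at this
    linarith

/-- A simple reflection permutes the positive roots other than its own simple root. -/
lemma IsRoot.reflect_nonneg {v : S → ℝ} (hv : M.IsRoot v) (h0 : 0 ≤ v) {s : S}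
    (hs : v ≠ simpleRoot s) : 0 ≤ M.reflect (simpleRoot s) v := by
  obtain ⟨t, hts, ht⟩ : ∃ t, t ≠ s ∧ 0 < v t := by
    by_contra! hcon
    have hz (t : S) (hts : t ≠ s) : v t = 0 := le_antisymm (hcon t hts) (h0 t)
    have e : v = v s • simpleRoot s := by
      ext t
      by_cases hts : t = s
      · simp [simpleRoot, hts]
      · simp [simpleRoot, hts, hz t hts]
    have h2 := hv.form_self
    rw [e] at h2
    simp only [map_smul, LinearMap.smul_apply, form_simpleRoot_self, smul_eq_mul] at h2
    have h1 : v s = 1 := by nlinarith [h0 s, show (0 : ℝ) ≤ v s from h0 s]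
    exact hs (by rw [e, h1, one_smul])
  have hr := hv.rep (M.toCoxeterSystem.simple s)
  rw [rep_simple] at hr
  refine hr.nonneg_or_nonpos.resolve_right fun h ↦ ?_
  have h1 := h t
  rw [reflect_apply] at h1
  simp [simpleRoot, hts] at h1
  linarith

variable (M) in
/-- Only finitely many positive roots are made negative by a given group element. -/
lemma finite_inversions (a : M.Group) :
    {v : S → ℝ | M.IsRoot v ∧ 0 < height v ∧ height (M.rep a v) < 0}.Finite := by
  induction a using M.toCoxeterSystem.simple_induction_left with
  | one =>
    convert Set.finite_empty
    ext v
    simp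
    intros
    linarith
  | mul_simple_left a s ih =>
    refine (ih.union (Set.finite_singleton (M.rep a⁻¹ (simpleRoot s)))).subset ?_
    rintro v ⟨hv, h1, h2⟩
    rcases lt_or_ge (height (M.rep a v)) 0 with h | h
    · exact Or.inl ⟨hv, h1, h⟩
    · right
      have hav := hv.rep a
      by_contra hne
      have hne' : M.rep a v ≠ simpleRoot s := by
        intro h
        apply hne
        rw [← h, rep_inv_apply_self]
        rfl
      have h3 := hav.reflect_nonneg (hav.height_pos_iff.1 (lt_of_le_of_ne h hav.height_ne_zero.symm))
        hne'
      rw [← rep_simple, ← rep_mul_apply, ← (hv.rep _).height_pos_iff] at h3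
      linarith

end CoxeterMatrix

/-- A positive solution of `y (k + 2) + y k = t * y (k + 1)` forces `2 ≤ t`. -/
lemma not_forall_pos_of_recurrence {t : ℝ} (ht : t < 2) {y : ℕ → ℝ}
    (hy : ∀ k, y (k + 2) + y k = t * y (k + 1)) : ¬ ∀ k, 0 < y k := by
  intro hpos
  have key (k : ℕ) : y (k + 1) ≤ (y 1 / y 0 - k * (2 - t)) * y k := by
    induction k with
    | zero =>
      have := (hpos 0).ne'
      simp only [zero_add, CharP.cast_eq_zero, zero_mul, sub_zero]
      field_simp
      rfl
    | succ k ih =>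
      have h0 := hpos k
      have h1 := hpos (k + 1)
      have h2 := hpos (k + 2)
      have e := hy k
      push_cast
      set z := y 1 / y 0 - k * (2 - t) with hz
      have hz' : y 1 / y 0 - ((k : ℝ) + 1) * (2 - t) = z - (2 - t) := by rw [hz]; ring
      rw [hz']
      have hzpos : 0 < z := by
        by_contra! hcon
        nlinarith
      have h3 : y (k + 1) * (2 - z) ≤ y k := by
        by_contra! hcon
        have h4 : z * y k < z * (y (k + 1) * (2 - z)) := mul_lt_mul_of_pos_left hcon hzpos
        nlinarith [mul_nonneg h1.le (sq_nonneg (z - 1))]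
      have : y (k + 1 + 1) = t * y (k + 1) - y k := by rw [← e]; ring
      rw [this]
      nlinarith
  obtain ⟨k, hk⟩ := exists_nat_gt ((y 1 / y 0) / (2 - t))
  rw [div_lt_iff₀ (by linarith)] at hk
  have h1 := key k
  nlinarith [hpos k, hpos (k + 1)]

namespace CoxeterMatrix

variable {S : Type*} {M : CoxeterMatrix S} [Fintype S] [DecidableEq S]

lemma rep_pow_succ_add {a : M.Group} {x : S → ℝ} {t : ℝ}
    (h : M.rep a x + M.rep a⁻¹ x = t • x) (k : ℕ) :
    M.rep (a ^ (k + 2)) x + M.rep (a ^ k) x = t • M.rep (a ^ (k + 1)) x := by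
  have := congrArg (M.rep (a ^ (k + 1))) h
  rw [map_add, map_smul, ← rep_mul_apply, ← rep_mul_apply] at this
  rw [← this, pow_succ a k, mul_inv_cancel_right, pow_succ, pow_succ]

/-- A root on which a group element acts by an elliptic recurrence is periodic. -/
lemma IsRoot.exists_pow_fix {a : M.Group} {x : S → ℝ} (hx : M.IsRoot x) {t : ℝ} (ht : t < 2)
    (h : M.rep a x + M.rep a⁻¹ x = t • x) : ∃ n, 0 < n ∧ M.rep (a ^ n) x = x := by
  set y : ℕ → ℝ := fun k ↦ height (M.rep (a ^ k) x) with hy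
  have hrec (k : ℕ) : y (k + 2) + y k = t * y (k + 1) := by
    have := congrArg height (rep_pow_succ_add h k)
    rwa [map_add, map_smul] at this
  have hne (k : ℕ) : y k ≠ 0 := (hx.rep _).height_ne_zero
  have hinf : {k | 0 < y k ∧ y (k + 1) < 0}.Infinite := by
    intro hfin
    obtain ⟨K, hK⟩ := hfin.bddAbove
    have hstep (k : ℕ) (hk : K < k) (h0 : 0 < y k) : 0 < y (k + 1) := by
      by_contra! hcon
      exact absurd (hK ⟨h0, lt_of_le_of_ne hcon (hne _)⟩) (not_le.2 hk)
    by_cases hex : ∃ k, K < k ∧ 0 < y k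
    · obtain ⟨k, hk, h0⟩ := hex
      refine not_forall_pos_of_recurrence ht (y := fun j ↦ y (k + j))
        (fun j ↦ hrec (k + j)) fun j ↦ ?_
      induction j with
      | zero => exact h0
      | succ j ih => exact hstep (k + j) (by omega) ih
    · push Not at hex
      refine not_forall_pos_of_recurrence ht (y := fun j ↦ -y (K + 1 + j))
        (fun j ↦ ?_) fun j ↦ ?_
      · have := hrec (K + 1 + j)
        simp only [← add_assoc]
        linarith
      · exact neg_pos.2 (lt_of_le_of_ne (hex _ (by omega)) (hne _))
  obtain ⟨k, -, l, -, hkl, he⟩ := hinf.exists_ne_map_eq_of_mapsTo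
    (f := fun k ↦ M.rep (a ^ k) x) (t := {v | M.IsRoot v ∧ 0 < height v ∧ height (M.rep a v) < 0})
    (fun k hk ↦ ⟨hx.rep _, hk.1, by
      rw [← rep_mul_apply, ← pow_succ']
      exact hk.2⟩) (M.finite_inversions a)
  have main {k l : ℕ} (hkl : k < l) (he : M.rep (a ^ k) x = M.rep (a ^ l) x) :
      ∃ n, 0 < n ∧ M.rep (a ^ n) x = x := by
    refine ⟨l - k, by omega, M.rep_injective (a ^ k) ?_⟩
    rw [← rep_mul_apply, ← pow_add, he]
    congr 3
    omega
  rcases lt_or_gt_of_ne hkl with h | h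
  · exact main h he
  · exact main h he.symm

lemma sum_rep_pow_eq_zero {a : M.Group} {x : S → ℝ} {t : ℝ} (ht : t < 2)
    (h : M.rep a x + M.rep a⁻¹ x = t • x) {n : ℕ} (hn : M.rep (a ^ n) x = x) :
    ∑ k ∈ Finset.range n, M.rep (a ^ k) x = 0 := by
  set σ := ∑ k ∈ Finset.range n, M.rep (a ^ k) x with hσ
  have h1 : M.rep a σ = σ := by
    have e1 := Finset.sum_range_succ (fun k ↦ M.rep (a ^ k) x) n
    rw [Finset.sum_range_succ', hn, pow_zero, rep_one_apply] at e1
    rw [hσ, map_sum, ← add_right_cancel e1]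
    exact Finset.sum_congr rfl fun k _ ↦ by rw [← rep_mul_apply, pow_succ']
  have h2 : M.rep a⁻¹ σ = σ := by
    conv_lhs => rw [← h1]
    rw [rep_inv_apply_self]
  have h3 : M.rep a σ + M.rep a⁻¹ σ = t • σ := by
    rw [hσ, map_sum, map_sum, ← Finset.sum_add_distrib, Finset.smul_sum]
    refine Finset.sum_congr rfl fun k _ ↦ ?_
    rw [← map_smul, ← h, map_add, ← rep_mul_apply, ← rep_mul_apply, ← rep_mul_apply,
      ← rep_mul_apply, ← pow_succ', ← pow_succ, (Commute.refl a).inv_left.pow_right k]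
  rw [h1, h2, ← two_smul ℝ σ, ← sub_eq_zero, ← sub_smul, smul_eq_zero] at h3
  exact h3.resolve_left (by linarith)

variable (M) in
/-- The roots supported on a set of simple roots. -/
def supportedRoots (J : Set S) : Set (S → ℝ) := {v | M.IsRoot v ∧ ∀ s, s ∉ J → v s = 0}

lemma exists_supportedRoots_of_nonneg {f : (S → ℝ) →ₗ[ℝ] ℝ}
    (hfin : {v | M.IsRoot v ∧ 0 < height v ∧ f v ≤ 0}.Finite) (hf : ∀ s, 0 ≤ f (simpleRoot s)) :
    ∃ J : Set S, (M.supportedRoots J).Finite ∧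
      ∀ v, M.IsRoot v → f v = 0 → v ∈ M.supportedRoots J := by
  have hsum (v : S → ℝ) : f v = ∑ s, v s * f (simpleRoot s) := by
    conv_lhs => rw [← sum_smul_simpleRoot v]
    simp
  refine ⟨{s | f (simpleRoot s) = 0}, ?_, fun v hv h0 ↦ ⟨hv, fun s hs ↦ ?_⟩⟩
  · refine (hfin.union (hfin.image Neg.neg)).subset ?_
    rintro v ⟨hv, hs⟩
    have h0 : f v = 0 := by
      rw [hsum]
      refine Finset.sum_eq_zero fun s _ ↦ ?_
      by_cases h : f (simpleRoot s) = 0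
      · rw [h, mul_zero]
      · rw [hs s h, zero_mul]
    rcases lt_or_gt_of_ne hv.height_ne_zero with h | h
    · exact Or.inr ⟨-v, ⟨hv.neg, by rw [map_neg]; linarith, by rw [map_neg, h0, neg_zero]⟩,
        neg_neg v⟩
    · exact Or.inl ⟨hv, h, h0.le⟩
  · have hnn {v : S → ℝ} (h0 : f v = 0) (hv : 0 ≤ v) : v s = 0 := by
      rw [hsum, Finset.sum_eq_zero_iff_of_nonneg fun i _ ↦ mul_nonneg (hv i) (hf i)] at h0
      exact (mul_eq_zero.1 (h0 s (Finset.mem_univ s))).resolve_right hs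
    rcases hv.nonneg_or_nonpos with h | h
    · exact hnn h0 h
    · have := hnn (v := -v) (by rw [map_neg, h0, neg_zero]) (neg_nonneg.2 h)
      simpa using this

lemma exists_supportedRoots {f : (S → ℝ) →ₗ[ℝ] ℝ}
    (hfin : {v | M.IsRoot v ∧ 0 < height v ∧ f v ≤ 0}.Finite) :
    ∃ (J : Set S) (a : M.Group), (M.supportedRoots J).Finite ∧
      ∀ v, M.IsRoot v → f v = 0 → M.rep a v ∈ M.supportedRoots J := by
  obtain ⟨n, hn⟩ : ∃ n, {v | M.IsRoot v ∧ 0 < height v ∧ f v < 0}.ncard = n := ⟨_, rfl⟩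
  induction n using Nat.strong_induction_on generalizing f with
  | _ n ih =>
  by_cases hs : ∃ s, f (simpleRoot s) < 0
  swap
  · push Not at hs
    obtain ⟨J, hJ, h⟩ := exists_supportedRoots_of_nonneg hfin hs
    exact ⟨J, 1, hJ, by simpa using h⟩
  obtain ⟨s, hs⟩ := hs
  set r := M.toCoxeterSystem.simple s with hr
  have hrs : M.rep r (simpleRoot s) = -simpleRoot s := M.rep_simple_simpleRoot s
  have hrr (v : S → ℝ) : M.rep r (M.rep r v) = v := by
    rw [← rep_mul_apply, hr, CoxeterSystem.simple_mul_simple_self, rep_one_apply]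
  have hpos {v : S → ℝ} (hv : M.IsRoot v) (h : 0 < height v) (hne : v ≠ simpleRoot s) :
      0 < height (M.rep r v) := by
    rw [(hv.rep _).height_pos_iff, hr, rep_simple]
    exact hv.reflect_nonneg (hv.height_pos_iff.1 h) hne
  set g : (S → ℝ) →ₗ[ℝ] ℝ := f ∘ₗ M.rep r with hg
  have hgfin : {v | M.IsRoot v ∧ 0 < height v ∧ g v ≤ 0}.Finite := by
    refine ((hfin.image (M.rep r)).union (Set.finite_singleton (simpleRoot s))).subset ?_
    rintro v ⟨hv, h1, h2⟩
    by_cases hne : v = simpleRoot s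
    · exact Or.inr hne
    · exact Or.inl ⟨_, ⟨hv.rep r, hpos hv h1 hne, h2⟩, hrr v⟩
  have hlt : {v | M.IsRoot v ∧ 0 < height v ∧ g v < 0}.ncard < n := by
    have hfin' : {v | M.IsRoot v ∧ 0 < height v ∧ f v < 0}.Finite :=
      hfin.subset fun v hv ↦ ⟨hv.1, hv.2.1, hv.2.2.le⟩
    have hmem : simpleRoot s ∈ {v | M.IsRoot v ∧ 0 < height v ∧ f v < 0} :=
      ⟨isRoot_simpleRoot s, (isRoot_simpleRoot (M := M) s).height_pos_iff.2 (simpleRoot_nonneg s),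
        hs⟩
    rw [← hn, ← Set.ncard_image_of_injective _ (M.rep_injective r)]
    refine Set.ncard_lt_ncard ⟨?_, fun hsub ↦ ?_⟩ hfin'
    · rintro _ ⟨v, ⟨hv, h1, h2⟩, rfl⟩
      refine ⟨hv.rep r, hpos hv h1 ?_, h2⟩
      rintro rfl
      simp only [hg, LinearMap.comp_apply, hrs, map_neg] at h2
      linarith
    · obtain ⟨v, ⟨hv, h1, h2⟩, h3⟩ := hsub hmem
      have : v = -simpleRoot s := by rw [← hrr v, h3, hrs]
      rw [this, map_neg] at h1
      have := (isRoot_simpleRoot (M := M) s).height_pos_iff.2 (simpleRoot_nonneg s)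
      linarith
  obtain ⟨J, a, hJ, h⟩ := ih _ hlt hgfin rfl
  refine ⟨J, a * r, hJ, fun v hv h0 ↦ ?_⟩
  rw [rep_mul_apply]
  exact h _ (hv.rep r) (by simp only [hg, LinearMap.comp_apply, hrr, h0])

/-- The elements `r_x r_y` for two roots `x`, `y`. -/
lemma IsRoot.exists_rep_eq_reflect_reflect {x y : S → ℝ} (hx : M.IsRoot x) (hy : M.IsRoot y) :
    ∃ a : M.Group, (∀ v, M.rep a v = M.reflect x (M.reflect y v)) ∧
      ∀ v, M.rep a⁻¹ v = M.reflect y (M.reflect x v) := by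
  obtain ⟨r, hr⟩ := hx.exists_rep_eq_reflect
  obtain ⟨q, hq⟩ := hy.exists_rep_eq_reflect
  have h (v : S → ℝ) : M.rep (r * q) v = M.reflect x (M.reflect y v) := by
    rw [rep_mul_apply, hr, hq]
  refine ⟨r * q, h, fun v ↦ M.rep_injective (r * q) ?_⟩
  rw [rep_apply_inv_self, h, reflect_reflect _ hy.form_self, reflect_reflect _ hx.form_self]

lemma reflect_reflect_add_left {x y : S → ℝ} (hx : M.form x x = 2) :
    M.reflect x (M.reflect y x) + M.reflect y (M.reflect x x) = (M.form x y ^ 2 - 2) • x := by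
  simp only [reflect_apply, map_sub, map_smul, hx, M.form_comm y x]
  module

lemma reflect_reflect_add_right {x y : S → ℝ} (hy : M.form y y = 2) :
    M.reflect x (M.reflect y y) + M.reflect y (M.reflect x y) = (M.form x y ^ 2 - 2) • y := by
  rw [add_comm, reflect_reflect_add_left hy, M.form_comm y x]

variable (M) in
/-- The form takes finitely many values of absolute value less than `2` on pairs of roots. -/
lemma finite_form_lt_two :
    {c : ℝ | |c| < 2 ∧ ∃ x y, M.IsRoot x ∧ M.IsRoot y ∧ M.form x y = c}.Finite := by
  have hfin : (⋃ J : {J : Set S // (M.supportedRoots J).Finite},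
      Set.image2 (fun x y ↦ M.form x y) (M.supportedRoots J.1) (M.supportedRoots J.1)).Finite :=
    Set.finite_iUnion fun J ↦ J.2.image2 _ J.2
  refine hfin.subset ?_
  rintro _ ⟨hc, x, y, hx, hy, rfl⟩
  obtain ⟨a, ha, ha'⟩ := hx.exists_rep_eq_reflect_reflect hy
  have ht : M.form x y ^ 2 - 2 < 2 := by nlinarith [abs_lt.1 hc]
  have hrx : M.rep a x + M.rep a⁻¹ x = (M.form x y ^ 2 - 2) • x := by
    rw [ha, ha', reflect_reflect_add_left hx.form_self]
  have hry : M.rep a y + M.rep a⁻¹ y = (M.form x y ^ 2 - 2) • y := by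
    rw [ha, ha', reflect_reflect_add_right hy.form_self]
  obtain ⟨n, hn, hnx⟩ := hx.exists_pow_fix ht hrx
  obtain ⟨m, hm, hmy⟩ := hy.exists_pow_fix ht hry
  have hpow {z : S → ℝ} {i : ℕ} (h : M.rep (a ^ i) z = z) (j : ℕ) :
      M.rep (a ^ (i * j)) z = z := by
    rw [pow_mul]
    induction j with
    | zero => simp
    | succ j ih => rw [pow_succ, rep_mul_apply, h, ih]
  set N := n * m with hN
  have hNx : M.rep (a ^ N) x = x := hpow hnx m
  have hNy : M.rep (a ^ N) y = y := by rw [hN, mul_comm]; exact hpow hmy n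
  set f : (S → ℝ) →ₗ[ℝ] ℝ := ∑ k ∈ Finset.range N, height ∘ₗ M.rep (a ^ k) with hf
  have hfa (v : S → ℝ) : f v = ∑ k ∈ Finset.range N, height (M.rep (a ^ k) v) := by
    simp [hf]
  have hfx : f x = 0 := by rw [hfa, ← map_sum, sum_rep_pow_eq_zero ht hrx hNx, map_zero]
  have hfy : f y = 0 := by rw [hfa, ← map_sum, sum_rep_pow_eq_zero ht hry hNy, map_zero]
  have hffin : {v | M.IsRoot v ∧ 0 < height v ∧ f v ≤ 0}.Finite := by
    refine (Set.Finite.biUnion (Finset.range N).finite_toSet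
      fun k _ ↦ M.finite_inversions (a ^ k)).subset ?_
    rintro v ⟨hv, h1, h2⟩
    by_contra hcon
    simp only [Set.mem_iUnion, not_exists] at hcon
    refine absurd h2 (not_le.2 ?_)
    rw [hfa]
    refine Finset.sum_pos (fun k hk ↦ ?_) ⟨0, Finset.mem_range.2 (by positivity)⟩
    refine lt_of_le_of_ne (not_lt.1 fun h ↦ hcon k hk ⟨hv, h1, h⟩) (hv.rep _).height_ne_zero.symm
  obtain ⟨J, b, hJ, h⟩ := exists_supportedRoots hffin
  exact Set.mem_iUnion.2 ⟨⟨J, hJ⟩, _, h x hx hfx, _, h y hy hfy, M.form_rep b x y⟩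

end CoxeterMatrix

lemma finiteIndex_of_finite_range {G X : Type*} [Group G] {K : Subgroup G} {f : G → X}
    (hf : (Set.range f).Finite) (h : ∀ a b, f a = f b → a⁻¹ * b ∈ K) : K.FiniteIndex := by
  have := hf.to_subtype
  have hinj : Function.Injective fun q : G ⧸ K ↦ (⟨f q.out, q.out, rfl⟩ : Set.range f) := by
    intro q q' he
    have := QuotientGroup.eq.2 (h _ _ (congrArg Subtype.val he))
    rwa [QuotientGroup.out_eq', QuotientGroup.out_eq'] at this
  have := Finite.of_injective _ hinj
  exact Subgroup.finiteIndex_of_finite_quotient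

/-- A nonzero element of a torsion-free group is divisible by only finitely many integers in a
finitely generated subgroup. -/
lemma exists_forall_ne_nsmul {V : Type*} [AddCommGroup V] [Module ℝ V] {L : Submodule ℤ V}
    (hL : L.FG) {x : V} (hx : x ≠ 0) : ∃ N : ℕ, ∀ n, N ≤ n → ∀ u ∈ L, x ≠ n • u := by
  by_cases hxL : x ∈ L
  swap
  · exact ⟨0, fun n _ u hu h ↦ hxL (h ▸ L.smul_of_tower_mem n hu)⟩
  have : Module.Finite ℤ L := Module.Finite.iff_fg.2 hL
  have : Module ℚ V := Module.compHom V (algebraMap ℚ ℝ)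
  have : IsAddTorsionFree V := IsAddTorsionFree.of_module_rat V
  have : Module.Free ℤ L := inferInstance
  let b := Module.Free.chooseBasis ℤ L
  have h0 : b.repr ⟨x, hxL⟩ ≠ 0 := by
    rw [Ne, LinearEquiv.map_eq_zero_iff, Submodule.mk_eq_zero]
    exact hx
  obtain ⟨i, hi⟩ := Finsupp.ne_iff.1 h0
  refine ⟨(b.repr ⟨x, hxL⟩ i).natAbs + 1, fun n hn u hu h ↦ ?_⟩
  have e : (⟨x, hxL⟩ : L) = n • ⟨u, hu⟩ := Subtype.ext h
  have : b.repr ⟨x, hxL⟩ i = n * b.repr ⟨u, hu⟩ i := by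
    rw [e, map_nsmul]
    simp
  have hdvd : n ∣ (b.repr ⟨x, hxL⟩ i).natAbs := by
    rw [← Int.natCast_dvd]
    exact ⟨_, this⟩
  have := Nat.le_of_dvd (Int.natAbs_pos.2 hi) hdvd
  omega

lemma exists_forall_mem_ne_nsmul {V : Type*} [AddCommGroup V] [Module ℝ V] {L : Submodule ℤ V}
    (hL : L.FG) {X : Set V} (hX : X.Finite) (h0 : ∀ x ∈ X, x ≠ 0) :
    ∃ N : ℕ, ∀ n, N ≤ n → ∀ x ∈ X, ∀ u ∈ L, x ≠ n • u := by
  induction X, hX using Set.Finite.induction_on with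
  | empty => exact ⟨0, by simp⟩
  | @insert a X _ _ ih =>
    obtain ⟨N, hN⟩ := ih fun x hx ↦ h0 x (Set.mem_insert_of_mem _ hx)
    obtain ⟨K, hK⟩ := exists_forall_ne_nsmul hL (h0 a (Set.mem_insert _ _))
    refine ⟨max N K, fun n hn x hx ↦ ?_⟩
    rcases hx with rfl | hx
    · exact hK n (le_of_max_le_right hn)
    · exact hN n (le_of_max_le_left hn) x hx

namespace CoxeterMatrix

variable {S : Type*} (M : CoxeterMatrix S) [Fintype S] [DecidableEq S]

/-- The elements acting trivially modulo the radical of the form. -/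
def radicalKernel : Subgroup M.Group where
  carrier := {a | ∀ x y, M.form (M.rep a x) y = M.form x y}
  one_mem' := by simp
  mul_mem' := by
    intro a b ha hb x y
    rw [rep_mul_apply, ha, hb]
  inv_mem' := by
    intro a ha x y
    rw [← ha, rep_apply_inv_self]

lemma rep_eq_self_of_radical (a : M.Group) {z : S → ℝ} (hz : ∀ y, M.form z y = 0) :
    M.rep a z = z := by
  induction a using M.toCoxeterSystem.simple_induction_left with
  | one => simp
  | mul_simple_left a s ih =>
    rw [rep_mul_apply, ih, rep_simple, reflect_apply, form_comm, hz, zero_smul, sub_zero]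

lemma radicalKernel_comm (a b : M.radicalKernel) : a * b = b * a := by
  have h (a b : M.radicalKernel) (x : S → ℝ) :
      M.rep (a * b) x = M.rep a x + M.rep b x - x := by
    have hz (y) : M.form (M.rep b x - x) y = 0 := by
      rw [map_sub, LinearMap.sub_apply, b.2, sub_self]
    have := M.rep_eq_self_of_radical a hz
    rw [map_sub] at this
    rw [rep_mul_apply]
    linear_combination (exp := 1) this
  apply Subtype.ext
  apply M.rep_faithful
  refine LinearMap.ext fun x ↦ ?_
  rw [Subgroup.coe_mul, Subgroup.coe_mul, h, h, add_comm]

lemma radicalKernel_finiteIndex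
    (h : {c | ∃ x y, M.IsRoot x ∧ M.IsRoot y ∧ M.form x y = c}.Finite) :
    M.radicalKernel.FiniteIndex := by
  set f : M.Group → S × S → ℝ :=
    fun a p ↦ M.form (M.rep a (simpleRoot p.1)) (simpleRoot p.2) with hf
  refine finiteIndex_of_finite_range (f := f) ?_ fun a b hab x y ↦ ?_
  · refine (Set.Finite.pi fun _ : S × S ↦ h).subset ?_
    rintro _ ⟨a, rfl⟩ p -
    exact ⟨_, _, (isRoot_simpleRoot _).rep a, isRoot_simpleRoot _, rfl⟩
  · have key (x y : S → ℝ) : M.form (M.rep a x) y = M.form (M.rep b x) y := by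
      rw [← sum_smul_simpleRoot x, ← sum_smul_simpleRoot y]
      simp only [map_sum, map_smul, LinearMap.sum_apply, LinearMap.smul_apply]
      refine Finset.sum_congr rfl fun t _ ↦ ?_
      congr 1
      refine Finset.sum_congr rfl fun s _ ↦ ?_
      rw [show M.form (M.rep a (simpleRoot s)) (simpleRoot t) =
        M.form (M.rep b (simpleRoot s)) (simpleRoot t) from congrFun hab (s, t)]
    rw [← M.form_rep a, ← rep_mul_apply, mul_inv_cancel_left, ← key, form_rep]

lemma virtuallyAbelian_or_exists_two_lt_form :
    (∃ H : Subgroup M.Group, H.FiniteIndex ∧ ∀ a b : H, a * b = b * a) ∨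
      ∃ x y, M.IsRoot x ∧ M.IsRoot y ∧ 2 < |M.form x y| := by
  by_cases h : ∃ x y, M.IsRoot x ∧ M.IsRoot y ∧ 2 < |M.form x y|
  · exact Or.inr h
  push Not at h
  refine Or.inl ⟨_, M.radicalKernel_finiteIndex ?_, M.radicalKernel_comm⟩
  refine (M.finite_form_lt_two.union (Set.toFinite {2, -2})).subset ?_
  rintro _ ⟨x, y, hx, hy, rfl⟩
  rcases (h x y hx hy).lt_or_eq with hlt | heq
  · exact Or.inl ⟨hlt, x, y, hx, hy, rfl⟩
  · exact Or.inr ((abs_eq (by norm_num)).1 heq)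

/-- The ring generated by the entries of the Cartan matrix. -/
def cartanRing : Subalgebra ℤ ℝ := Algebra.adjoin ℤ (Set.range fun p : S × S ↦ M.cartan p.1 p.2)

lemma cartan_mem (s t : S) : M.cartan s t ∈ M.cartanRing :=
  Algebra.subset_adjoin ⟨(s, t), rfl⟩

lemma cartanRing_fg : (Subalgebra.toSubmodule M.cartanRing).FG := by
  refine fg_adjoin_of_finite (Set.finite_range _) ?_
  rintro _ ⟨⟨s, t⟩, rfl⟩
  have e : M.cartan s t = -(2 * cos (((1 / (M s t : ℚ) : ℚ) : ℝ) * π)) := by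
    rw [cartan]
    push_cast
    rw [one_div_mul_eq_div]
    ring
  change IsIntegral ℤ (M.cartan s t)
  rw [e]
  exact (isIntegral_two_mul_cos_rat_mul_pi _).neg

/-- The vectors with coordinates in the Cartan ring. -/
def lattice : Submodule ℤ (S → ℝ) :=
  Submodule.pi Set.univ fun _ ↦ Subalgebra.toSubmodule M.cartanRing

lemma lattice_fg : M.lattice.FG := Submodule.fg_pi fun _ ↦ M.cartanRing_fg

variable {M}

lemma mem_lattice {x : S → ℝ} : x ∈ M.lattice ↔ ∀ s, x s ∈ M.cartanRing := by
  simp [lattice, Submodule.mem_pi]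

lemma simpleRoot_mem_lattice (s : S) : simpleRoot s ∈ M.lattice := by
  refine mem_lattice.2 fun t ↦ ?_
  by_cases h : t = s
  · simp [simpleRoot, h, one_mem]
  · simp [simpleRoot, h, zero_mem]

lemma smul_mem_lattice {c : ℝ} (hc : c ∈ M.cartanRing) {x : S → ℝ} (hx : x ∈ M.lattice) :
    c • x ∈ M.lattice :=
  mem_lattice.2 fun s ↦ mul_mem hc (mem_lattice.1 hx s)

lemma form_mem_cartanRing {x y : S → ℝ} (hx : x ∈ M.lattice) (hy : y ∈ M.lattice) :
    M.form x y ∈ M.cartanRing := by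
  rw [form_apply]
  exact sum_mem fun s _ ↦ sum_mem fun t _ ↦
    mul_mem (mul_mem (mem_lattice.1 hx s) (M.cartan_mem s t)) (mem_lattice.1 hy t)

lemma rep_mem_lattice (a : M.Group) {x : S → ℝ} (hx : x ∈ M.lattice) :
    M.rep a x ∈ M.lattice := by
  induction a using M.toCoxeterSystem.simple_induction_left with
  | one => simpa
  | mul_simple_left a s ih =>
    rw [rep_mul_apply, rep_simple, reflect_apply]
    exact sub_mem ih (smul_mem_lattice (form_mem_cartanRing (simpleRoot_mem_lattice s) ih)
      (simpleRoot_mem_lattice s))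

lemma IsRoot.mem_lattice {x : S → ℝ} (hx : M.IsRoot x) : x ∈ M.lattice := by
  obtain ⟨a, s, rfl⟩ := hx
  exact rep_mem_lattice a (simpleRoot_mem_lattice s)

variable (M) in
/-- The multiples of `n` in the lattice. -/
def multiples (n : ℕ) : Submodule ℤ (S → ℝ) := M.lattice.map (LinearMap.lsmul ℤ (S → ℝ) n)

lemma mem_multiples {n : ℕ} {x : S → ℝ} : x ∈ M.multiples n ↔ ∃ u ∈ M.lattice, x = n • u := by
  simp [multiples, eq_comm]

lemma smul_mem_multiples {n : ℕ} {c : ℝ} (hc : c ∈ M.cartanRing) {x : S → ℝ}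
    (hx : x ∈ M.multiples n) : c • x ∈ M.multiples n := by
  obtain ⟨u, hu, rfl⟩ := mem_multiples.1 hx
  exact mem_multiples.2 ⟨c • u, smul_mem_lattice hc hu, smul_comm _ _ _⟩

lemma nsmul_smul_mem_multiples {n : ℕ} {c : ℝ} (hc : c ∈ M.cartanRing) {x : S → ℝ}
    (hx : x ∈ M.lattice) : (n • c) • x ∈ M.multiples n :=
  mem_multiples.2 ⟨c • x, smul_mem_lattice hc hx, smul_assoc _ _ _⟩

lemma exists_form_eq_nsmul {n : ℕ} {x y : S → ℝ} (hx : x ∈ M.multiples n) (hy : y ∈ M.lattice) :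
    ∃ c ∈ M.cartanRing, M.form x y = n • c := by
  obtain ⟨u, hu, rfl⟩ := mem_multiples.1 hx
  exact ⟨_, form_mem_cartanRing hu hy, by rw [map_nsmul, LinearMap.smul_apply]⟩

lemma rep_mem_multiples {n : ℕ} (a : M.Group) {x : S → ℝ} (hx : x ∈ M.multiples n) :
    M.rep a x ∈ M.multiples n := by
  obtain ⟨u, hu, rfl⟩ := mem_multiples.1 hx
  exact mem_multiples.2 ⟨_, rep_mem_lattice a hu, map_nsmul _ _ _⟩

variable (M) in
/-- The congruence subgroup of level `n`. -/
def congruence (n : ℕ) : Subgroup M.Group where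
  carrier := {a | ∀ x ∈ M.lattice, M.rep a x - x ∈ M.multiples n}
  one_mem' := by simp
  mul_mem' := by
    intro a b ha hb x hx
    rw [rep_mul_apply]
    have := add_mem (ha _ (rep_mem_lattice b hx)) (hb x hx)
    rwa [sub_add_sub_cancel] at this
  inv_mem' := by
    intro a ha x hx
    have := rep_mem_multiples a⁻¹ (neg_mem (ha x hx))
    rwa [neg_sub, map_sub, rep_inv_apply_self] at this

lemma finite_mk_lattice {n : ℕ} (hn : n ≠ 0) :
    (M.lattice.map (M.multiples n).mkQ : Set ((S → ℝ) ⧸ M.multiples n)).Finite := by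
  set Q := M.lattice.map (M.multiples n).mkQ with hQ
  have : Module.Finite ℤ Q := Module.Finite.iff_fg.2 (M.lattice_fg.map _)
  have htor : Module.IsTorsion ℤ Q := by
    rintro ⟨q, hq⟩
    obtain ⟨u, hu, rfl⟩ := hq
    refine ⟨⟨n, mem_nonZeroDivisors_of_ne_zero (by exact_mod_cast hn)⟩, Subtype.ext ?_⟩
    change (n : ℤ) • (M.multiples n).mkQ u = 0
    rw [← map_smul, Submodule.mkQ_apply, Submodule.Quotient.mk_eq_zero]
    exact mem_multiples.2 ⟨u, hu, by simp⟩
  have := Module.finite_of_fg_torsion Q htor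
  exact Set.toFinite _

lemma congruence_finiteIndex {n : ℕ} (hn : n ≠ 0) : (M.congruence n).FiniteIndex := by
  set f : M.Group → S → (S → ℝ) ⧸ M.multiples n :=
    fun a s ↦ (M.multiples n).mkQ (M.rep a (simpleRoot s)) with hf
  refine finiteIndex_of_finite_range (f := f) ?_ fun a b hab x hx ↦ ?_
  · refine (Set.Finite.pi fun _ : S ↦ finite_mk_lattice (M := M) hn).subset ?_
    rintro _ ⟨a, rfl⟩ s -
    exact ⟨_, rep_mem_lattice a (simpleRoot_mem_lattice s), rfl⟩
  · have key (s : S) : M.rep (a⁻¹ * b) (simpleRoot s) - simpleRoot s ∈ M.multiples n := by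
      have := (Submodule.Quotient.eq _).1 (congrFun hab s)
      have := rep_mem_multiples a⁻¹ (neg_mem this)
      rwa [neg_sub, map_sub, rep_inv_apply_self, ← rep_mul_apply] at this
    have e : M.rep (a⁻¹ * b) x - x =
        ∑ s, x s • (M.rep (a⁻¹ * b) (simpleRoot s) - simpleRoot s) := by
      simp only [smul_sub, Finset.sum_sub_distrib, ← map_smul]
      rw [← map_sum, sum_smul_simpleRoot]
    rw [e]
    exact sum_mem fun s _ ↦ smul_mem_multiples (mem_lattice.1 hx s) (key s)

lemma exists_pow_mem_congruence {n : ℕ} (hn : n ≠ 0) (a : M.Group) :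
    ∃ k, 0 < k ∧ a ^ k ∈ M.congruence n := by
  have := congruence_finiteIndex (M := M) hn
  obtain ⟨k, hk, -, h⟩ := Subgroup.exists_pow_mem_of_index_ne_zero
    (this.index_ne_zero) a
  exact ⟨k, hk, h⟩

end CoxeterMatrix

namespace CoxeterMatrix

variable {S : Type*} (M : CoxeterMatrix S) [Fintype S] [DecidableEq S]

/-- The roots congruent to `α` or `-α` modulo `n`. -/
def congrRoots (n : ℕ) (α : S → ℝ) : Set (S → ℝ) :=
  {v | M.IsRoot v ∧ (v - α ∈ M.multiples n ∨ -v - α ∈ M.multiples n)}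

/-- The group elements preserving a set of vectors. -/
def setStabilizer (Ψ : Set (S → ℝ)) : Subgroup M.Group where
  carrier := {a | ∀ v, M.rep a v ∈ Ψ ↔ v ∈ Ψ}
  one_mem' := by simp
  mul_mem' := by
    intro a b ha hb v
    rw [rep_mul_apply, ha, hb]
  inv_mem' := by
    intro a ha v
    rw [← ha, rep_apply_inv_self]

variable {M} {n : ℕ} {α : S → ℝ}

lemma neg_mem_congrRoots {v : S → ℝ} (hv : v ∈ M.congrRoots n α) : -v ∈ M.congrRoots n α :=
  ⟨hv.1.neg, by rw [neg_neg]; exact hv.2.symm⟩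

lemma self_mem_congrRoots (hα : M.IsRoot α) : α ∈ M.congrRoots n α :=
  ⟨hα, Or.inl (by simp)⟩

lemma rep_sub_mem_iff {a : M.Group} (ha : a ∈ M.congruence n) {v x : S → ℝ}
    (hv : v ∈ M.lattice) : M.rep a v - x ∈ M.multiples n ↔ v - x ∈ M.multiples n := by
  rw [← sub_add_sub_cancel (M.rep a v) v x, add_mem_cancel_left (ha v hv)]

lemma congruence_le_setStabilizer : M.congruence n ≤ M.setStabilizer (M.congrRoots n α) := by
  intro a ha v
  have hr : M.IsRoot (M.rep a v) ↔ M.IsRoot v := by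
    refine ⟨fun h ↦ ?_, fun h ↦ h.rep a⟩
    have := h.rep a⁻¹
    rwa [rep_inv_apply_self] at this
  simp only [congrRoots, Set.mem_ofPred_eq, hr]
  refine and_congr_right fun hv ↦ ?_
  rw [← map_neg, rep_sub_mem_iff ha hv.mem_lattice, rep_sub_mem_iff ha (neg_mem hv.mem_lattice)]

lemma exists_form_sub_two {v w : S → ℝ} (hα : M.IsRoot α) (hv : v - α ∈ M.multiples n)
    (hw : w - α ∈ M.multiples n) (hwl : w ∈ M.lattice) :
    ∃ c ∈ M.cartanRing, M.form v w - 2 = n • c := by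
  obtain ⟨c, hc, h1⟩ := exists_form_eq_nsmul hv hwl
  obtain ⟨d, hd, h2⟩ := exists_form_eq_nsmul hw hα.mem_lattice
  refine ⟨c + d, add_mem hc hd, ?_⟩
  have := hα.form_self
  rw [form_comm] at h2
  rw [map_sub, LinearMap.sub_apply] at h1
  rw [map_sub] at h2
  rw [nsmul_add, ← h1, ← h2, this]
  ring

lemma reflect_mem_congrRoots {v w : S → ℝ} (hα : M.IsRoot α) (hv : v ∈ M.congrRoots n α)
    (hw : w ∈ M.congrRoots n α) : M.reflect v w ∈ M.congrRoots n α := by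
  have hroot : M.IsRoot (M.reflect v w) := by
    obtain ⟨r, hr⟩ := hv.1.exists_rep_eq_reflect
    rw [← hr]
    exact hw.1.rep r
  have key {v w : S → ℝ} (hv : M.IsRoot v) (hw : M.IsRoot w) (h1 : v - α ∈ M.multiples n)
      (h2 : w - α ∈ M.multiples n) : -M.reflect v w - α ∈ M.multiples n := by
    obtain ⟨c, hc, h⟩ := exists_form_sub_two hα h1 h2 hw.mem_lattice
    have e : -M.reflect v w - α = (v - α) + (v - α) - (w - α) + (n • c) • v := by
      rw [reflect_apply, ← h]
      module
    rw [e]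
    exact add_mem (sub_mem (add_mem h1 h1) h2) (nsmul_smul_mem_multiples hc hv.mem_lattice)
  refine ⟨hroot, ?_⟩
  have hneg (v w : S → ℝ) : M.reflect (-v) w = M.reflect v w := by
    simp [reflect_apply]
  rcases hv.2 with h1 | h1 <;> rcases hw.2 with h2 | h2
  · exact Or.inr (key hv.1 hw.1 h1 h2)
  · have := key hv.1 hw.1.neg h1 h2
    rw [map_neg, neg_neg] at this
    exact Or.inl this
  · have := key hv.1.neg hw.1 h1 h2
    rw [hneg] at this
    exact Or.inr this
  · have := key hv.1.neg hw.1.neg h1 h2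
    rw [hneg, map_neg, neg_neg] at this
    exact Or.inl this

lemma reflection_mem_setStabilizer {v : S → ℝ} (hα : M.IsRoot α) (hv : v ∈ M.congrRoots n α)
    {r : M.Group} (hr : M.rep r = M.reflect v) : r ∈ M.setStabilizer (M.congrRoots n α) := by
  intro w
  rw [hr]
  refine ⟨fun h ↦ ?_, reflect_mem_congrRoots hα hv⟩
  have := reflect_mem_congrRoots hα hv h
  rwa [reflect_reflect _ hv.1.form_self] at this

/-- For large `n`, congruent roots pair to at least `2`. -/
lemma exists_level (hα : M.IsRoot α) : ∃ n, n ≠ 0 ∧ α + α ∉ M.multiples n ∧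
    ∀ v ∈ M.congrRoots n α, ∀ w ∈ M.congrRoots n α, 2 ≤ |M.form v w| := by
  obtain ⟨N, hN⟩ := exists_forall_ne_nsmul M.lattice_fg (x := α + α) (by
    rw [← two_smul ℝ]
    exact smul_ne_zero two_ne_zero hα.ne_zero)
  obtain ⟨K, hK⟩ := exists_forall_mem_ne_nsmul M.cartanRing_fg
    (M.finite_form_lt_two.image (· - 2)) (by
      rintro _ ⟨c, ⟨hc, -⟩, rfl⟩
      have := (abs_lt.1 hc).2
      change c - 2 ≠ 0
      linarith)
  set n := max (max N K) 1
  have hnN : N ≤ n := le_trans (le_max_left _ _) (le_max_left _ _)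
  have hnK : K ≤ n := le_trans (le_max_right _ _) (le_max_left _ _)
  refine ⟨n, (lt_of_lt_of_le one_pos (le_max_right _ _)).ne', fun h ↦ ?_, fun v hv w hw ↦ ?_⟩
  · obtain ⟨u, hu, h⟩ := mem_multiples.1 h
    exact hN n hnN u hu h
  have key {v w : S → ℝ} (hv : M.IsRoot v) (hw : M.IsRoot w) (h1 : v - α ∈ M.multiples n)
      (h2 : w - α ∈ M.multiples n) : 2 ≤ |M.form v w| := by
    by_contra! hlt
    obtain ⟨c, hc, h⟩ := exists_form_sub_two hα h1 h2 hw.mem_lattice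
    exact hK n hnK _ ⟨_, ⟨hlt, v, w, hv, hw, rfl⟩, rfl⟩ c hc h
  rcases hv.2 with h1 | h1 <;> rcases hw.2 with h2 | h2
  · exact key hv.1 hw.1 h1 h2
  · simpa using key hv.1 hw.1.neg h1 h2
  · simpa using key hv.1.neg hw.1 h1 h2
  · simpa using key hv.1.neg hw.1.neg h1 h2

variable (M) in
/-- The group elements which can be reached from `1` in the Cayley graph without crossing the
walls of the given roots. -/
inductive Chamber (Ψ : Set (S → ℝ)) : M.Group → Prop
  | one : Chamber Ψ 1
  | mul_simple {a : M.Group} {s : S} : Chamber Ψ a → M.rep a (simpleRoot s) ∉ Ψ →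
      Chamber Ψ (a * M.toCoxeterSystem.simple s)

variable (M) in
/-- The roots defining the walls of the chamber of `1`. -/
def canonicalRoots (Ψ : Set (S → ℝ)) : Set (S → ℝ) :=
  {v | v ∈ Ψ ∧ ∃ a s, M.Chamber Ψ a ∧ v = M.rep a (simpleRoot s)}

lemma congrRoots_subset_span (hα : M.IsRoot α) :
    M.congrRoots n α ⊆ Submodule.span ℝ (M.canonicalRoots (M.congrRoots n α)) := by
  set Ψ := M.congrRoots n α with hΨ
  set U := Submodule.span ℝ (M.canonicalRoots Ψ) with hU
  have key (a : M.Group) : ∃ b c : M.Group, a = b * c ∧ M.Chamber Ψ c ∧ b ∈ M.setStabilizer Ψ ∧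
      ∀ x ∈ U, M.rep b x ∈ U := by
    induction a using M.toCoxeterSystem.simple_induction_right with
    | one => exact ⟨1, 1, by simp, Chamber.one, one_mem _, by simp⟩
    | mul_simple_right a s ih =>
      obtain ⟨b, c, rfl, hc, hb, hbU⟩ := ih
      by_cases h : M.rep c (simpleRoot s) ∈ Ψ
      · set r := c * M.toCoxeterSystem.simple s * c⁻¹ with hr
        have hrr : M.rep r = M.reflect (M.rep c (simpleRoot s)) := M.rep_conj_simple c s
        refine ⟨b * r, c, by simp [hr, mul_assoc], hc,
          mul_mem hb (reflection_mem_setStabilizer hα h hrr), fun x hx ↦ ?_⟩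
        rw [rep_mul_apply, hrr, reflect_apply]
        refine hbU _ (sub_mem hx (U.smul_mem _ (Submodule.subset_span ⟨h, c, s, hc, rfl⟩)))
      · exact ⟨b, _, mul_assoc _ _ _, hc.mul_simple h, hb, hbU⟩
  intro v hv
  obtain ⟨a, s, rfl⟩ := hv.1
  obtain ⟨b, c, rfl, hc, hb, hbU⟩ := key a
  rw [rep_mul_apply] at hv ⊢
  exact hbU _ (Submodule.subset_span ⟨(hb _).1 hv, c, s, hc, rfl⟩)

end CoxeterMatrix

/-- A bounded solution of a hyperbolic recurrence vanishes. -/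
lemma eq_zero_of_bounded_recurrence {t : ℝ} (ht : 2 < t) {y : ℤ → ℝ} (hb : ∀ k, |y k| ≤ 2)
    (hy : ∀ k, y (k + 1) + y (k - 1) = t * y k) (k : ℤ) : y k = 0 := by
  have key (j : ℕ) : ∀ k, |y k| ≤ 2 * (2 / t) ^ j := by
    induction j with
    | zero => simpa using hb
    | succ j ih =>
      intro k
      have h1 : t * |y k| ≤ |y (k + 1)| + |y (k - 1)| := by
        have := abs_add_le (y (k + 1)) (y (k - 1))
        rwa [hy, abs_mul, abs_of_pos (by linarith : 0 < t)] at this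
      have h2 : |y k| ≤ (2 * (2 * (2 / t) ^ j)) / t := by
        rw [le_div_iff₀ (by linarith)]
        linarith [ih (k + 1), ih (k - 1)]
      convert h2 using 1
      rw [pow_succ]
      ring
  by_contra hne
  have hpos : 0 < |y k| / 2 := by positivity
  obtain ⟨j, hj⟩ := exists_pow_lt_of_lt_one hpos
    (show 2 / t < 1 by rw [div_lt_one (by linarith)]; exact ht)
  linarith [key j k]

namespace CoxeterMatrix

variable {S : Type*} {M : CoxeterMatrix S} [Fintype S] [DecidableEq S]

lemma exists_rep_pow_eq {x y : S → ℝ} (hx : M.IsRoot x) (hy : M.IsRoot y)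
    (h : 2 ≤ |M.form x y|) : ∃ a : M.Group,
      (∀ v, M.rep a v = M.reflect y (M.reflect x v)) ∧
      M.rep a x + M.rep a⁻¹ x = (M.form x y ^ 2 - 2) • x ∧
      ∀ k : ℕ, k ≠ 0 → ∃ u w : ℝ, M.rep (a ^ k) x = u • x + w • y ∧ w ≠ 0 := by
  obtain ⟨a, ha, ha'⟩ := hy.exists_rep_eq_reflect_reflect hx
  have hrec : M.rep a x + M.rep a⁻¹ x = (M.form x y ^ 2 - 2) • x := by
    rw [ha, ha', add_comm, reflect_reflect_add_left hx.form_self]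
  refine ⟨a, ha, hrec, ?_⟩
  have key (k : ℕ) : ∃ u w u' w' : ℝ, M.rep (a ^ k) x = u • x + w • y ∧
      M.rep (a ^ (k + 1)) x = u' • x + w' • y ∧ |w| < |w'| := by
    induction k with
    | zero =>
      refine ⟨1, 0, -1, M.form x y, by simp, ?_, by rw [abs_zero]; linarith⟩
      rw [zero_add, pow_one, ha, reflect_apply, reflect_apply, hx.form_self]
      simp only [map_sub, map_smul, M.form_comm y x]
      module
    | succ k ih =>
      obtain ⟨u, w, u', w', h1, h2, hlt⟩ := ih
      set t := M.form x y ^ 2 - 2 with ht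
      refine ⟨u', w', t * u' - u, t * w' - w, h2, ?_, ?_⟩
      · have := rep_pow_succ_add hrec k
        rw [h1, h2] at this
        rw [add_assoc, one_add_one_eq_two, eq_sub_of_add_eq this]
        module
      · have ht2 : 2 ≤ t := by
          rw [ht, ← sq_abs]
          nlinarith
        have h3 := abs_sub_abs_le_abs_sub (t * w') w
        rw [abs_mul, abs_of_nonneg (by linarith : 0 ≤ t)] at h3
        nlinarith [abs_nonneg w']
  intro k hk
  obtain ⟨j, rfl⟩ := Nat.exists_eq_succ_of_ne_zero hk
  obtain ⟨u, w, u', w', -, h2, hlt⟩ := key j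
  exact ⟨u', w', h2, abs_pos.1 (lt_of_le_of_lt (abs_nonneg w) hlt)⟩

lemma form_nonneg_of_card_le_two (h : Fintype.card S ≤ 2) (x : S → ℝ) : 0 ≤ M.form x x := by
  have key (s t : S) : (if s = t then 4 * x s ^ 2 else 0) - (x s ^ 2 + x t ^ 2) ≤
      x s * M.cartan s t * x t := by
    by_cases hst : s = t
    · subst hst
      rw [if_pos rfl, cartan_self]
      apply le_of_eq
      ring
    · rw [if_neg hst]
      have h1 := abs_le.1 (M.abs_cartan_le s t)
      nlinarith [mul_nonneg (sub_nonneg.2 h1.2) (sq_nonneg (x s - x t)),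
        mul_nonneg (by linarith : 0 ≤ M.cartan s t + 2) (sq_nonneg (x s + x t))]
  rw [form_apply]
  refine le_trans ?_ (Finset.sum_le_sum fun s _ ↦ Finset.sum_le_sum fun t _ ↦ key s t)
  simp only [Finset.sum_sub_distrib, Finset.sum_add_distrib, Finset.sum_ite_eq, Finset.mem_univ,
    if_true, Finset.sum_const, Finset.card_univ, nsmul_eq_mul, ← Finset.mul_sum]
  have h0 : 0 ≤ ∑ s, x s ^ 2 := Finset.sum_nonneg fun s _ ↦ sq_nonneg _
  have hc : (Fintype.card S : ℝ) ≤ 2 := by exact_mod_cast h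
  nlinarith

lemma abs_form_le_two_of_card_le_two (h : Fintype.card S ≤ 2) {x y : S → ℝ} (hx : M.IsRoot x)
    (hy : M.IsRoot y) : |M.form x y| ≤ 2 := by
  have h1 := form_nonneg_of_card_le_two (M := M) h (x + y)
  have h2 := form_nonneg_of_card_le_two (M := M) h (x - y)
  simp only [map_add, map_sub, LinearMap.add_apply, LinearMap.sub_apply, hx.form_self,
    hy.form_self, M.form_comm y x] at h1 h2
  rw [abs_le]
  constructor <;> linarith

lemma linearIndependent_pair_of_form {x y : S → ℝ} (hx : M.IsRoot x) (hy : M.IsRoot y)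
    (h : 2 < |M.form x y|) : LinearIndependent ℝ ![x, y] := by
  rw [LinearIndependent.pair_iff]
  intro a b hab
  have h1 := congrArg (M.form x) hab
  have h2 := congrArg (M.form y) hab
  simp only [map_add, map_smul, smul_eq_mul, hx.form_self, hy.form_self, map_zero,
    M.form_comm y x] at h1 h2
  have hc : 4 < M.form x y ^ 2 := by
    rw [← sq_abs]
    nlinarith
  have hb : b * (M.form x y ^ 2 - 4) = 0 := by linear_combination M.form x y * h1 - 2 * h2
  have hb0 : b = 0 := (mul_eq_zero.1 hb).resolve_right (by linarith)
  subst hb0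
  exact ⟨by linarith, rfl⟩

/-- In an irreducible group, a union of simple roots closed under non-orthogonality is everything
or empty. -/
lemma forall_of_connected
    (hirr : (SimpleGraph.fromRel (fun s t : S ↦ M s t ≠ 2)).Connected) {p : S → Prop}
    (hp : ∀ s t, s ≠ t → p s → M.cartan s t ≠ 0 → p t) {s : S} (hs : p s) (t : S) : p t := by
  obtain ⟨w⟩ := hirr.preconnected s t
  induction w with
  | nil => exact hs
  | cons hadj _ ih =>
    refine ih (hp _ _ hadj.ne hs fun h0 ↦ ?_)
    have h2 := M.cartan_eq_zero hadj.ne h0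
    rcases (SimpleGraph.fromRel_adj _ _ _).1 hadj with ⟨_, h | h⟩
    · exact h h2
    · exact h ((M.symmetric _ _).trans h2)

/-- The span of a congruence class of roots is not two-dimensional. -/
lemma not_congrRoots_subset_span_pair
    (hirr : (SimpleGraph.fromRel (fun s t : S ↦ M s t ≠ 2)).Connected) {α β : S → ℝ}
    (hα : M.IsRoot α) (hβ : M.IsRoot β) (h : 2 < |M.form α β|) {n : ℕ} (hn : n ≠ 0)
    (p q : S → ℝ) : ¬ M.congrRoots n α ⊆ Submodule.span ℝ {p, q} := by
  intro hsub
  set U := Submodule.span ℝ (M.congrRoots n α) with hU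
  have hrank : Module.finrank ℝ U ≤ 2 := by
    refine (Submodule.finrank_mono (Submodule.span_le.2 hsub)).trans ?_
    classical
    have := finrank_span_finset_le_card (R := ℝ) ({p, q} : Finset (S → ℝ))
    rw [Finset.coe_pair] at this
    exact this.trans Finset.card_le_two
  have hΨ {x : S → ℝ} (hx : x ∈ M.congrRoots n α) : x ∈ U := Submodule.subset_span hx
  have hUinv {g : M.Group} (hg : g ∈ M.congruence n) {x : S → ℝ} (hx : x ∈ U) :
      M.rep g x ∈ U := by
    have : U ≤ U.comap (M.rep g) :=
      Submodule.span_le.2 fun v hv ↦ hΨ ((congruence_le_setStabilizer hg v).2 hv)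
    exact this hx
  have mem_of_two_le {x y : S → ℝ} (hx : M.IsRoot x) (hy : M.IsRoot y) (hxU : x ∈ U)
      (hxy : 2 ≤ |M.form x y|) : y ∈ U := by
    obtain ⟨a, -, -, ha⟩ := exists_rep_pow_eq hx hy hxy
    obtain ⟨N, hN, hmem⟩ := exists_pow_mem_congruence hn a
    obtain ⟨u, w, he, hw⟩ := ha N hN.ne'
    have h1 := hUinv hmem hxU
    rw [he] at h1
    have h2 := (U.add_mem_iff_right (U.smul_mem u hxU)).1 h1
    exact (U.smul_mem_iff hw).1 h2
  have hαU : α ∈ U := hΨ (self_mem_congrRoots hα)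
  have hβU : β ∈ U := mem_of_two_le hα hβ hαU h.le
  have hle : Submodule.span ℝ (Set.range ![α, β]) ≤ U := by
    rw [Submodule.span_le]
    rintro _ ⟨i, rfl⟩
    fin_cases i
    · exact hαU
    · exact hβU
  have hUeq : Submodule.span ℝ (Set.range ![α, β]) = U := by
    refine Submodule.eq_of_le_of_finrank_le hle ?_
    rw [finrank_span_eq_card (linearIndependent_pair_of_form hα hβ h)]
    simpa using hrank
  obtain ⟨a, ha, hrec, -⟩ := exists_rep_pow_eq hα hβ h.le
  have hinv {x : S → ℝ} (hx : x ∈ U) : M.reflect α x ∈ U ∧ M.reflect β x ∈ U :=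
    ⟨sub_mem hx (U.smul_mem _ hαU), sub_mem hx (U.smul_mem _ hβU)⟩
  have hzU (k : ℤ) : M.rep (a ^ k) α ∈ U := by
    have h1 {x : S → ℝ} (hx : x ∈ U) : M.rep a x ∈ U := by
      rw [ha]
      exact (hinv (hinv hx).1).2
    have h2 {x : S → ℝ} (hx : x ∈ U) : M.rep a⁻¹ x ∈ U := by
      have : M.rep a⁻¹ x = M.reflect α (M.reflect β x) := by
        apply M.rep_injective a
        rw [rep_apply_inv_self, ha, reflect_reflect _ hα.form_self, reflect_reflect _ hβ.form_self]
      rw [this]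
      exact (hinv (hinv hx).2).1
    induction k with
    | zero => simpa
    | succ k ih => rw [add_comm, zpow_add, zpow_one, rep_mul_apply]; exact h1 ih
    | pred k ih =>
      rw [sub_eq_neg_add, zpow_add, zpow_neg_one, rep_mul_apply]
      exact h2 ih
  have dich (s : S) : simpleRoot s ∈ U ∨ ∀ x ∈ U, M.form (simpleRoot s) x = 0 := by
    by_cases hk : ∃ k : ℤ, 2 ≤ |M.form (M.rep (a ^ k) α) (simpleRoot s)|
    · obtain ⟨k, hk⟩ := hk
      exact Or.inl (mem_of_two_le (hα.rep _) (isRoot_simpleRoot s) (hzU k) hk)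
    push Not at hk
    right
    have hc : 4 < M.form α β ^ 2 := by
      rw [← sq_abs]
      nlinarith
    have hzero := eq_zero_of_bounded_recurrence (t := M.form α β ^ 2 - 2) (by linarith)
      (y := fun k ↦ M.form (M.rep (a ^ k) α) (simpleRoot s)) (fun k ↦ (hk k).le) fun k ↦ by
        have := congrArg (fun x ↦ M.form (M.rep (a ^ k) x) (simpleRoot s)) hrec
        simp only [map_add, map_smul, LinearMap.add_apply, LinearMap.smul_apply,
          smul_eq_mul, ← rep_mul_apply] at this
        rw [← this, zpow_add_one, zpow_sub_one]
    have h0 : M.form (simpleRoot s) α = 0 := by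
      have := hzero 0
      rwa [zpow_zero, rep_one_apply, form_comm] at this
    have h1 : M.form (simpleRoot s) β = 0 := by
      have := hzero 1
      simp only [zpow_one, ha, reflect_apply, hα.form_self] at this
      rw [form_comm] at this
      simp only [map_sub, map_smul, h0, smul_eq_mul, M.form_comm β α] at this
      have h3 : M.form α β * M.form (simpleRoot s) β = 0 := by linarith
      refine (mul_eq_zero.1 h3).resolve_left fun h4 ↦ ?_
      rw [h4] at hc
      norm_num at hc
    intro x hx
    rw [← hUeq] at hx
    have : Submodule.span ℝ (Set.range ![α, β]) ≤ LinearMap.ker (M.form (simpleRoot s)) := by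
      rw [Submodule.span_le]
      rintro _ ⟨i, rfl⟩
      fin_cases i
      · exact h0
      · exact h1
    exact this hx
  obtain ⟨s, hs⟩ : ∃ s : S, simpleRoot s ∈ U := by
    by_contra! hcon
    have h2 := hα.form_self
    rw [← sum_smul_simpleRoot α] at h2
    conv_lhs at h2 => arg 2; rw [sum_smul_simpleRoot α]
    rw [map_sum, LinearMap.sum_apply, Finset.sum_eq_zero] at h2
    · norm_num at h2
    · intro s _
      rw [map_smul, LinearMap.smul_apply, (dich s).resolve_left (hcon s) α hαU, smul_zero]
  have hall (t : S) : simpleRoot t ∈ U := by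
    refine forall_of_connected hirr (p := fun t ↦ simpleRoot t ∈ U) ?_ hs t
    intro s t _ hs hst
    refine (dich t).resolve_right fun h ↦ hst ?_
    rw [← form_simpleRoot, form_comm]
    exact h _ hs
  have htop : U = ⊤ := by
    rw [eq_top_iff]
    intro x _
    rw [← sum_smul_simpleRoot x]
    exact sum_mem fun t _ ↦ U.smul_mem _ (hall t)
  rw [htop, finrank_top, Module.finrank_fintype_fun_eq_card] at hrank
  exact absurd (abs_form_le_two_of_card_le_two hrank hα hβ) (not_le.2 h)

end CoxeterMatrix

lemma prod_map_range_of_forall_ne {G : Type*} [Group G] {f : ℕ → G} {m i : ℕ}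
    (hf : ∀ j < m, j ≠ i → f j = 1) :
    ((List.range m).map f).prod = if i < m then f i else 1 := by
  induction m with
  | zero => simp
  | succ m ih =>
    rw [List.range_succ, List.map_append, List.prod_append, ih fun j hj ↦ hf j (by omega)]
    rcases eq_or_ne m i with rfl | h
    · simp
    · simp only [List.map_cons, List.map_nil, List.prod_cons, List.prod_nil, hf m (by omega) h,
        mul_one]
      exact if_congr (by omega) rfl rfl

/-- A product over a symmetric sequence with at most one nontrivial factor in each half. -/
lemma prod_map_range_two_mul {G : Type*} [Group G] {f : ℕ → G} {m : ℕ}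
    (hf : ∀ i < m, ∀ j < m, i ≠ j → f i = 1 ∨ f j = 1) (hm : ∀ j, f (j + m) = (f j)⁻¹) :
    ((List.range (2 * m)).map f).prod = 1 := by
  obtain ⟨i, hi⟩ : ∃ i, ∀ j < m, j ≠ i → f j = 1 := by
    by_cases h : ∃ i < m, f i ≠ 1
    · obtain ⟨i, him, hi⟩ := h
      exact ⟨i, fun j hj hne ↦ (hf j hj i him hne).resolve_right hi⟩
    · push Not at h
      exact ⟨0, fun j hj _ ↦ h j hj⟩
  have e : (List.range m).map (fun j ↦ f (m + j)) = (List.range m).map fun j ↦ (f j)⁻¹ :=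
    List.map_congr_left fun j _ ↦ by rw [add_comm, hm]
  rw [two_mul, List.range_add, List.map_append, List.prod_append, List.map_map]
  change _ * (List.map (fun j ↦ f (m + j)) _).prod = 1
  rw [e, prod_map_range_of_forall_ne hi,
    prod_map_range_of_forall_ne (f := fun j ↦ (f j)⁻¹) (i := i)
      fun j hj hne ↦ by rw [hi j hj hne, inv_one]]
  split_ifs <;> simp

namespace CoxeterMatrix

variable {S : Type*} (M : CoxeterMatrix S) [Fintype S] [DecidableEq S]

/-- A labelling of the walls of a Coxeter complex by group elements, such that walls with
nontrivial labels do not cross. -/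
structure WallLabel (G : Type*) [Group G] where
  /-- The label for crossing the wall of a root from its positive to its negative side. -/
  label : (S → ℝ) → G
  label_neg : ∀ v, label (-v) = (label v)⁻¹
  two_le_form : ∀ v w, M.IsRoot v → M.IsRoot w → label v ≠ 1 → label w ≠ 1 → 2 ≤ |M.form v w|

namespace WallLabel

variable {M} {G : Type*} [Group G] (l : M.WallLabel G)

/-- Crossing a panel while collecting its label. -/
noncomputable def crossing (s : S) : Equiv.Perm (M.Group × G) :=
  Function.Involutive.toPerm
    (fun p ↦ (p.1 * M.toCoxeterSystem.simple s, p.2 * l.label (M.rep p.1 (simpleRoot s)))) <| by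
      rintro ⟨a, g⟩
      simp only [rep_mul_apply, rep_simple_simpleRoot, map_neg, l.label_neg, mul_inv_cancel_right,
        CoxeterSystem.simple_mul_simple_cancel_right]

lemma crossing_apply (s : S) (a : M.Group) (g : G) : l.crossing s (a, g) =
    (a * M.toCoxeterSystem.simple s, g * l.label (M.rep a (simpleRoot s))) := rfl

lemma crossing_mul_crossing_pow_apply {s t : S} (hst : s ≠ t) (k : ℕ) (a : M.Group) (g : G) :
    ((l.crossing s * l.crossing t) ^ k) (a, g) =
      (a * (M.toCoxeterSystem.simple t * M.toCoxeterSystem.simple s) ^ k,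
        g * ((List.range (2 * k)).map fun j ↦ l.label (M.rep a (M.dihedralRoot t s j))).prod) := by
  have hroot (k : ℕ) :
      M.rep ((M.toCoxeterSystem.simple t * M.toCoxeterSystem.simple s) ^ k) (simpleRoot t) =
        M.dihedralRoot t s (2 * k) ∧
      M.rep ((M.toCoxeterSystem.simple t * M.toCoxeterSystem.simple s) ^ k)
        (M.rep (M.toCoxeterSystem.simple t) (simpleRoot s)) = M.dihedralRoot t s (2 * k + 1) := by
    induction k with
    | zero =>
      simp only [pow_zero, rep_one_apply, mul_zero, zero_add, M.dihedralRoot_zero hst.symm,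
        M.dihedralRoot_one hst.symm, rep_simple, and_self]
    | succ k ih =>
      simp only [pow_succ', rep_mul_apply] at ih ⊢
      rw [ih.1, ih.2, rep_simple, rep_simple, reflect_reflect_dihedralRoot,
        reflect_reflect_dihedralRoot]
      exact ⟨rfl, rfl⟩
  induction k with
  | zero => simp
  | succ k ih =>
    rw [pow_succ', Equiv.Perm.mul_apply, ih, Equiv.Perm.mul_apply, crossing_apply, crossing_apply]
    refine Prod.ext ?_ ?_
    · simp only [pow_succ, mul_assoc]
    · rw [mul_add, mul_one, List.range_succ, List.range_succ]
      simp only [rep_mul_apply, (hroot k).1, (hroot k).2, List.map_append, List.map_cons,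
        List.map_nil, List.prod_append, List.prod_cons, List.prod_nil, mul_one, mul_assoc]

lemma isLiftable_crossing : M.IsLiftable l.crossing := by
  intro s t
  rcases eq_or_ne s t with rfl | hst
  · rw [M.diagonal, pow_one]
    exact Equiv.ext fun p ↦ (l.crossing s).left_inv p
  by_cases h0 : M s t = 0
  · rw [h0, pow_zero]
  have h0' : M t s ≠ 0 := by rwa [M.symmetric]
  refine Equiv.ext ?_
  rintro ⟨a, g⟩
  rw [crossing_mul_crossing_pow_apply l hst, M.symmetric s t]
  have h1 : (M.toCoxeterSystem.simple t * M.toCoxeterSystem.simple s) ^ M t s = 1 :=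
    M.toCoxeterSystem.simple_mul_simple_pow t s
  rw [h1, prod_map_range_two_mul, mul_one, mul_one, Equiv.Perm.one_apply]
  · intro i hi j hj hij
    by_contra! hcon
    have hroot (j : ℕ) : M.IsRoot (M.dihedralRoot t s j) := by
      induction j using Nat.twoStepInduction with
      | zero => rw [M.dihedralRoot_zero hst.symm]; exact isRoot_simpleRoot t
      | one =>
        rw [M.dihedralRoot_one hst.symm, ← rep_simple]
        exact (isRoot_simpleRoot s).rep _
      | more j ih _ =>
        rw [← reflect_reflect_dihedralRoot, ← rep_simple, ← rep_simple]
        exact (ih.rep _).rep _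
    have h2 := l.two_le_form _ _ ((hroot i).rep a) ((hroot j).rep a) hcon.1 hcon.2
    rw [form_rep, M.form_dihedralRoot hst.symm h0', abs_mul, abs_two] at h2
    have hm : (0 : ℝ) < M t s := by exact_mod_cast Nat.pos_of_ne_zero h0'
    have hsin {i j : ℕ} (hij : i < j) (hj : j < M t s) :
        |cos (((i : ℝ) - j) * (π / M t s))| < 1 := by
      have e : ((i : ℝ) - j) * (π / M t s) = -(((j : ℝ) - i) * (π / M t s)) := by ring
      have h3 : (0 : ℝ) < j - i := sub_pos.2 (by exact_mod_cast hij)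
      have h4 : (j : ℝ) - i < M t s := by
        have : (j : ℝ) < M t s := by exact_mod_cast hj
        linarith [(Nat.cast_nonneg i : (0 : ℝ) ≤ i)]
      have h5 : 0 < sin (((j : ℝ) - i) * (π / M t s)) := by
        apply sin_pos_of_pos_of_lt_pi
        · positivity
        · rw [← mul_div_assoc, div_lt_iff₀ hm, mul_comm]
          exact mul_lt_mul_of_pos_left h4 pi_pos
      rw [e, cos_neg, ← sq_lt_one_iff_abs_lt_one]
      nlinarith [sin_sq_add_cos_sq (((j : ℝ) - i) * (π / M t s))]
    rcases lt_or_gt_of_ne hij with h | h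
    · linarith [hsin h hj]
    · have e : ((i : ℝ) - j) * (π / M t s) = -(((j : ℝ) - i) * (π / M t s)) := by ring
      rw [e, cos_neg] at h2
      linarith [hsin h hi]
  · intro j
    rw [M.dihedralRoot_add_entry h0', map_neg, l.label_neg]

/-- The action of the Coxeter group by crossing panels. -/
noncomputable def crossingHom : M.Group →* Equiv.Perm (M.Group × G) :=
  M.toCoxeterSystem.lift ⟨_, l.isLiftable_crossing⟩

/-- The product of the labels collected along a gallery from `a` to `a * b`. -/
noncomputable def path (a b : M.Group) : G := (l.crossingHom b⁻¹ (a, 1)).2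

lemma crossingHom_inv_apply (a b : M.Group) (g : G) :
    l.crossingHom b⁻¹ (a, g) = (a * b, g * l.path a b) := by
  have key : ∃ c, ∀ g, l.crossingHom b⁻¹ (a, g) = (a * b, g * c) := by
    induction b using M.toCoxeterSystem.simple_induction_right with
    | one => exact ⟨1, by simp⟩
    | mul_simple_right b s ih =>
      obtain ⟨c, hc⟩ := ih
      refine ⟨c * l.label (M.rep (a * b) (simpleRoot s)), fun g ↦ ?_⟩
      rw [mul_inv_rev, CoxeterSystem.inv_simple, map_mul, Equiv.Perm.mul_apply, hc, crossingHom,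
        CoxeterSystem.lift_apply_simple, crossing_apply, mul_assoc, mul_assoc]
  obtain ⟨c, hc⟩ := key
  rw [path, hc, hc, one_mul]

lemma path_mul (a b c : M.Group) : l.path a (b * c) = l.path a b * l.path (a * b) c := by
  rw [path, mul_inv_rev, map_mul, Equiv.Perm.mul_apply, crossingHom_inv_apply,
    crossingHom_inv_apply, one_mul]

lemma path_one (a : M.Group) : l.path a 1 = 1 := by simp [path]

lemma path_simple (a : M.Group) (s : S) :
    l.path a (M.toCoxeterSystem.simple s) = l.label (M.rep a (simpleRoot s)) := by
  rw [path, CoxeterSystem.inv_simple, crossingHom, CoxeterSystem.lift_apply_simple,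
    crossing_apply, one_mul]

lemma path_inv (a b : M.Group) : l.path (a * b) b⁻¹ = (l.path a b)⁻¹ := by
  rw [eq_inv_iff_mul_eq_one]
  have := l.path_mul (a * b) b⁻¹ b
  rw [inv_mul_cancel, path_one, mul_inv_cancel_right] at this
  exact this.symm

lemma path_mul_left {c : M.Group} (hc : ∀ v, M.IsRoot v → l.label (M.rep c v) = l.label v)
    (a b : M.Group) : l.path (c * a) b = l.path a b := by
  induction b using M.toCoxeterSystem.simple_induction_right with
  | one => rw [path_one, path_one]
  | mul_simple_right b s ih =>
    rw [path_mul, path_mul, ih, path_simple, path_simple, mul_assoc, rep_mul_apply,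
      hc _ ((isRoot_simpleRoot s).rep _)]

/-- On a subgroup preserving the labels, collecting labels is a homomorphism. -/
noncomputable def pathHom (H : Subgroup M.Group)
    (hH : ∀ c ∈ H, ∀ v, M.IsRoot v → l.label (M.rep c v) = l.label v) : H →* G where
  toFun c := l.path 1 c
  map_one' := l.path_one 1
  map_mul' a b := by
    have := l.path_mul_left (hH a a.2) 1 b
    rw [mul_one] at this
    rw [Subgroup.coe_mul, path_mul, one_mul, this]

variable {Ψ : Set (S → ℝ)} (hΨ : ∀ v, l.label v ≠ 1 → v ∈ Ψ)
include hΨ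

lemma path_of_chamber {a b : M.Group} (ha : a ∈ M.setStabilizer Ψ) (hb : M.Chamber Ψ b) :
    l.path a b = 1 := by
  induction hb with
  | one => exact l.path_one a
  | @mul_simple b s _ hs ih =>
    rw [path_mul, ih, path_simple, one_mul, rep_mul_apply]
    by_contra hne
    exact hs ((ha _).1 (hΨ _ hne))

lemma path_conj_simple {a b : M.Group} {s : S} (ha : a ∈ M.setStabilizer Ψ)
    (hb : M.Chamber Ψ b) (hr : b * M.toCoxeterSystem.simple s * b⁻¹ ∈ M.setStabilizer Ψ) :
    l.path a (b * M.toCoxeterSystem.simple s * b⁻¹) =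
      l.label (M.rep a (M.rep b (simpleRoot s))) := by
  rw [path_mul, path_mul, l.path_of_chamber hΨ ha hb, path_simple, one_mul, rep_mul_apply]
  have := l.path_inv (a * (b * M.toCoxeterSystem.simple s * b⁻¹)) b
  rw [l.path_of_chamber hΨ (mul_mem ha hr) hb, mul_assoc, inv_mul_cancel_right, inv_one] at this
  rw [this, mul_one]

end WallLabel

end CoxeterMatrix

/-- A group with a homomorphism to a free group with nonabelian image surjects onto the free group
of rank two. -/
lemma exists_surjective_freeGroup_fin_two {G X : Type*} [Group G] (f : G →* FreeGroup X)
    {a b : G} (hab : f a * f b ≠ f b * f a) :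
    ∃ g : G →* FreeGroup (Fin 2), Function.Surjective g := by
  let e := IsFreeGroup.toFreeGroup f.range
  obtain ⟨x, y, hxy⟩ : ∃ x y : IsFreeGroup.Generators f.range, x ≠ y := by
    by_contra! hcon
    have hs : Subsingleton (IsFreeGroup.Generators f.range) := ⟨hcon⟩
    have hcomm (u v : FreeGroup (IsFreeGroup.Generators f.range)) : u * v = v * u := by
      rcases isEmpty_or_nonempty (IsFreeGroup.Generators f.range) with h | ⟨⟨x⟩⟩
      · exact Subsingleton.elim _ _
      · have : Unique (IsFreeGroup.Generators f.range) := ⟨⟨x⟩, fun _ ↦ Subsingleton.elim _ _⟩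
        have hz (u : FreeGroup (IsFreeGroup.Generators f.range)) :
            u ∈ Subgroup.zpowers (FreeGroup.of x) := by
          have : Set.range (FreeGroup.of : IsFreeGroup.Generators f.range → _) =
              {FreeGroup.of x} := by
            ext w
            simp only [Set.mem_range, Set.mem_singleton_iff]
            exact ⟨fun ⟨z, hz⟩ ↦ by rw [← hz, Subsingleton.elim z x], fun h ↦ ⟨x, h.symm⟩⟩
          rw [Subgroup.zpowers_eq_closure, ← this, FreeGroup.closure_range_of]
          trivial
        obtain ⟨i, rfl⟩ := hz u
        obtain ⟨j, rfl⟩ := hz v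
        simp only [← zpow_add, add_comm]
    apply hab
    have := hcomm (e (f.rangeRestrict a)) (e (f.rangeRestrict b))
    rw [← map_mul e, ← map_mul e] at this
    exact congrArg Subtype.val (e.injective this)
  classical
  have hm : Function.Surjective fun z : IsFreeGroup.Generators f.range ↦
      if z = x then (0 : Fin 2) else 1 := by
    intro i
    fin_cases i
    · exact ⟨x, by simp⟩
    · exact ⟨y, by simp [hxy.symm]⟩
  exact ⟨((FreeGroup.map fun z : IsFreeGroup.Generators f.range ↦
      if z = x then (0 : Fin 2) else 1).comp e.toMonoidHom).comp f.rangeRestrict,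
    ((FreeGroup.map_surjective hm).comp e.surjective).comp f.rangeRestrict_surjective⟩

namespace CoxeterMatrix

variable {S : Type*} (M : CoxeterMatrix S) [Fintype S] [DecidableEq S]

variable {M} {n m : ℕ} {α : S → ℝ}

open Classical in
variable (M n m α) in
/-- The residue class modulo `m` of the representative of `±v` that is congruent to `α` modulo `n`,
as a signed letter. -/
noncomputable def letter (v : S → ℝ) : ((S → ℝ) ⧸ M.multiples m) × Bool :=
  if v - α ∈ M.multiples n then ((M.multiples m).mkQ v, true) else ((M.multiples m).mkQ (-v), false)

lemma letter_rep {a : M.Group} (hn : a ∈ M.congruence n) (hm : a ∈ M.congruence m)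
    {v : S → ℝ} (hv : v ∈ M.lattice) : M.letter n m α (M.rep a v) = M.letter n m α v := by
  have h : (M.multiples m).mkQ (M.rep a v) = (M.multiples m).mkQ v := by
    rw [← sub_eq_zero, ← map_sub]
    exact (Submodule.Quotient.mk_eq_zero _).2 (hm v hv)
  simp only [letter, map_neg, h]
  congr 1
  exact propext (rep_sub_mem_iff hn hv)

variable (M m) in
/-- Two vectors are incongruent if they do not agree up to sign modulo `m`. -/
def Incongruent (v w : S → ℝ) : Prop := v - w ∉ M.multiples m ∧ v + w ∉ M.multiples m

namespace Incongruent

variable {v w : S → ℝ}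

lemma symm (h : M.Incongruent m v w) : M.Incongruent m w v :=
  ⟨fun h' ↦ h.1 (by simpa using neg_mem h'), by rw [add_comm]; exact h.2⟩

lemma neg_left (h : M.Incongruent m v w) : M.Incongruent m (-v) w :=
  ⟨fun h' ↦ h.2 (by simpa [add_comm] using neg_mem h'),
    fun h' ↦ h.1 (by simpa [sub_eq_add_neg, add_comm] using neg_mem h')⟩

lemma rep (h : M.Incongruent m v w) (a : M.Group) :
    M.Incongruent m (M.rep a v) (M.rep a w) := by
  rw [Incongruent, ← map_sub, ← map_add]
  refine ⟨fun h' ↦ h.1 ?_, fun h' ↦ h.2 ?_⟩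
  all_goals
    have := rep_mem_multiples a⁻¹ h'
    rwa [rep_inv_apply_self] at this

lemma letter_fst_ne (h : M.Incongruent m v w) :
    (M.letter n m α v).1 ≠ (M.letter n m α w).1 := by
  have h1 : (M.multiples m).mkQ v ≠ (M.multiples m).mkQ w := by
    rw [Ne, ← sub_eq_zero, ← map_sub]
    exact fun h' ↦ h.1 ((Submodule.Quotient.mk_eq_zero _).1 h')
  have h2 : (M.multiples m).mkQ v + (M.multiples m).mkQ w ≠ 0 := by
    rw [← map_add]
    exact fun h' ↦ h.2 ((Submodule.Quotient.mk_eq_zero _).1 h')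
  unfold letter
  split_ifs <;> simp only [map_neg]
  · exact h1
  · rwa [Ne, eq_neg_iff_add_eq_zero]
  · rwa [Ne, neg_eq_iff_add_eq_zero]
  · rwa [Ne, neg_inj]

end Incongruent

open Classical in
variable (m) in
/-- The labelling of walls of roots congruent to `±α` modulo `n` by free generators given by their
residues modulo `m`. -/
noncomputable def residueLabel (hα : α + α ∉ M.multiples n)
    (h2 : ∀ v ∈ M.congrRoots n α, ∀ w ∈ M.congrRoots n α, 2 ≤ |M.form v w|) :
    M.WallLabel (FreeGroup ((S → ℝ) ⧸ M.multiples m)) where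
  label v := if v ∈ M.congrRoots n α then FreeGroup.mk [M.letter n m α v] else 1
  label_neg v := by
    by_cases hv : v ∈ M.congrRoots n α
    · rw [if_pos hv, if_pos (neg_mem_congrRoots hv), FreeGroup.inv_mk]
      have hnot : ¬ (v - α ∈ M.multiples n ∧ -v - α ∈ M.multiples n) := by
        rintro ⟨h1, h2⟩
        apply hα
        have := neg_mem (add_mem h1 h2)
        rwa [show -(v - α + (-v - α)) = α + α by abel] at this
      by_cases h1 : v - α ∈ M.multiples n
      · have h3 : -v - α ∉ M.multiples n := fun h ↦ hnot ⟨h1, h⟩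
        simp [letter, h1, h3, FreeGroup.invRev]
      · have h3 : -v - α ∈ M.multiples n := hv.2.resolve_left h1
        simp [letter, h1, h3, FreeGroup.invRev]
    · rw [if_neg hv, if_neg, inv_one]
      intro h
      have := neg_mem_congrRoots h
      rw [neg_neg] at this
      exact hv this
  two_le_form v w _ _ hv hw := by
    refine h2 v ?_ w ?_
    · by_contra h
      exact hv (if_neg h)
    · by_contra h
      exact hw (if_neg h)

section

variable (hα : α + α ∉ M.multiples n)
  (h2 : ∀ v ∈ M.congrRoots n α, ∀ w ∈ M.congrRoots n α, 2 ≤ |M.form v w|)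

lemma residueLabel_of_mem {v : S → ℝ} (hv : v ∈ M.congrRoots n α) :
    (residueLabel m hα h2).label v = FreeGroup.mk [M.letter n m α v] := if_pos hv

lemma residueLabel_of_notMem {v : S → ℝ} (hv : v ∉ M.congrRoots n α) :
    (residueLabel m hα h2).label v = 1 := if_neg hv

lemma residueLabel_rep {a : M.Group} (hn : a ∈ M.congruence n) (hm : a ∈ M.congruence m)
    {v : S → ℝ} (hv : M.IsRoot v) :
    (residueLabel m hα h2).label (M.rep a v) = (residueLabel m hα h2).label v := by
  by_cases h : v ∈ M.congrRoots n α
  · rw [residueLabel_of_mem hα h2 h, residueLabel_of_mem hα h2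
      ((congruence_le_setStabilizer hn v).2 h), letter_rep hn hm hv.mem_lattice]
  · rw [residueLabel_of_notMem hα h2 h,
      residueLabel_of_notMem hα h2 fun h' ↦ h ((congruence_le_setStabilizer hn v).1 h')]

variable (hroot : M.IsRoot α)
include hroot

lemma exists_path_eq_letter {p : S → ℝ} (hp : p ∈ M.canonicalRoots (M.congrRoots n α)) :
    ∃ r : M.Group, M.rep r = M.reflect p ∧ r ∈ M.setStabilizer (M.congrRoots n α) ∧
      ∀ a ∈ M.setStabilizer (M.congrRoots n α),
        (residueLabel m hα h2).path a r = FreeGroup.mk [M.letter n m α (M.rep a p)] := by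
  obtain ⟨hp, b, s, hb, rfl⟩ := hp
  have hrr := M.rep_conj_simple b s
  have hmem := reflection_mem_setStabilizer hroot hp hrr
  refine ⟨_, hrr, hmem, fun a ha ↦ ?_⟩
  rw [(residueLabel m hα h2).path_conj_simple (Ψ := M.congrRoots n α) (fun v hv ↦ ?_) ha hb hmem,
    residueLabel_of_mem hα h2 ((ha _).2 hp)]
  by_contra h
  exact hv (residueLabel_of_notMem hα h2 h)

end

lemma reflect_self_eq_neg {p : S → ℝ} (hp : M.form p p = 2) : M.reflect p p = -p := by
  rw [reflect_apply, hp, two_smul, sub_add_cancel_left]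

/-- The labels along powers of a product of two reflections form a reduced word. -/
lemma exists_word {l : M.WallLabel (FreeGroup ((S → ℝ) ⧸ M.multiples m))}
    {H : Subgroup M.Group} {p q : S → ℝ} (hpp : M.form p p = 2) (hqq : M.form q q = 2)
    (hpq : M.Incongruent m p q)
    {x y : M.Group} (hx : M.rep x = M.reflect p) (hy : M.rep y = M.reflect q)
    (hxH : x ∈ H) (hyH : y ∈ H)
    (hxl : ∀ a ∈ H, l.path a x = FreeGroup.mk [M.letter n m α (M.rep a p)])
    (hyl : ∀ a ∈ H, l.path a y = FreeGroup.mk [M.letter n m α (M.rep a q)]) (k : ℕ) :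
    ∃ L, L.length = 2 * k ∧ l.path 1 ((x * y) ^ k) = FreeGroup.mk L ∧
      FreeGroup.IsReduced (L ++ [M.letter n m α (M.rep ((x * y) ^ k) p)]) ∧
      (k ≠ 0 → [M.letter n m α p, M.letter n m α (M.rep x q)] <+: L) := by
  have hxp : M.rep x p = -p := by rw [hx, reflect_self_eq_neg hpp]
  have hyq : M.rep y q = -q := by rw [hy, reflect_self_eq_neg hqq]
  induction k with
  | zero => exact ⟨[], rfl, by rw [pow_zero, l.path_one]; rfl, by simp, by simp⟩
  | succ k ih =>
    obtain ⟨L, hL, hpath, hred, hpre⟩ := ih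
    have hk : (x * y) ^ k ∈ H := pow_mem (mul_mem hxH hyH) k
    set a := (x * y) ^ k with ha
    refine ⟨L ++ [M.letter n m α (M.rep a p), M.letter n m α (M.rep (a * x) q)], ?_, ?_, ?_, ?_⟩
    · simp [hL]; ring
    · rw [pow_succ, ← ha, l.path_mul, hpath, one_mul, l.path_mul, hxl a hk, hyl _ (mul_mem hk hxH),
        FreeGroup.mul_mk, FreeGroup.mul_mk]
      rfl
    · have h1 : M.Incongruent m (M.rep a p) (M.rep (a * x) q) := by
        have := (hpq.rep (a * x)).neg_left
        rwa [rep_mul_apply, hxp, map_neg, neg_neg] at this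
      have h3 : M.Incongruent m (M.rep (a * x) q) (M.rep ((x * y) ^ (k + 1)) p) := by
        have := (hpq.symm.rep (a * x * y)).neg_left
        rwa [M.rep_mul_apply (a * x) y q, hyq, map_neg, neg_neg, mul_assoc, ha, ← pow_succ,
          ← ha] at this
      have e : L ++ [M.letter n m α (M.rep a p), M.letter n m α (M.rep (a * x) q)] ++
          [M.letter n m α (M.rep ((x * y) ^ (k + 1)) p)] =
          L ++ [M.letter n m α (M.rep a p)] ++ [M.letter n m α (M.rep (a * x) q),
            M.letter n m α (M.rep ((x * y) ^ (k + 1)) p)] := by simp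
      rw [e]
      refine hred.append_overlap ?_ (by simp)
      simp only [FreeGroup.IsReduced, List.cons_append, List.nil_append, List.isChain_cons_cons,
        List.isChain_singleton, and_true]
      exact ⟨fun h ↦ absurd h h1.letter_fst_ne, fun h ↦ absurd h h3.letter_fst_ne⟩
    · intro _
      rcases eq_or_ne k 0 with rfl | hk0
      · obtain rfl := List.length_eq_zero_iff.1 hL
        simp [ha]
      · exact (hpre hk0).trans (List.prefix_append _ _)

/-- Reduced words of equal length that can be concatenated in both orders and commute are equal. -/
lemma eq_of_mk_mul_comm {X : Type*} {L L' L₀ L₀' : List (X × Bool)} {z : X × Bool}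
    (hL : FreeGroup.IsReduced (L ++ [z])) (hL' : FreeGroup.IsReduced (L' ++ [z]))
    (hz : L = z :: L₀) (hz' : L' = z :: L₀') (hlen : L.length = L'.length)
    (hcomm : FreeGroup.mk L * FreeGroup.mk L' = FreeGroup.mk L' * FreeGroup.mk L) : L = L' := by
  classical
  have key {L L' L₀ : List (X × Bool)} (hL : FreeGroup.IsReduced (L ++ [z]))
      (hL' : FreeGroup.IsReduced (L' ++ [z])) (hz : L' = z :: L₀) :
      FreeGroup.IsReduced (L ++ L') := by
    subst hz
    have := hL.append_overlap (L₃ := L₀) (List.IsChain.left_of_append hL') (by simp)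
    simpa using this
  rw [FreeGroup.mul_mk, FreeGroup.mul_mk] at hcomm
  have := FreeGroup.reduce.sound hcomm
  rw [(key hL hL' hz').reduce_eq, (key hL' hL hz).reduce_eq] at this
  exact (List.append_inj this hlen).1

/-- A canonical system of at least three roots gives a virtual surjection onto a free group. -/
lemma large_of_canonicalRoots (hroot : M.IsRoot α) (hn : n ≠ 0) (hα : α + α ∉ M.multiples n)
    (h2 : ∀ v ∈ M.congrRoots n α, ∀ w ∈ M.congrRoots n α, 2 ≤ |M.form v w|)
    {p q t : S → ℝ} (hp : p ∈ M.canonicalRoots (M.congrRoots n α))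
    (hq : q ∈ M.canonicalRoots (M.congrRoots n α)) (ht : t ∈ M.canonicalRoots (M.congrRoots n α))
    (hm : m ≠ 0) (hpq : M.Incongruent m p q) (hpt : M.Incongruent m p t)
    (hqt : M.Incongruent m q t) :
    ∃ H : Subgroup M.Group, H.FiniteIndex ∧
      ∃ f : H →* FreeGroup (Fin 2), Function.Surjective f := by
  have := congruence_finiteIndex (M := M) hn
  have := congruence_finiteIndex (M := M) hm
  set l := residueLabel m hα h2 with hl
  let f := l.pathHom (M.congruence n ⊓ M.congruence m)
    fun c hc v hv ↦ residueLabel_rep hα h2 hc.1 hc.2 hv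
  obtain ⟨x, hx, hxH, hxl⟩ := exists_path_eq_letter (m := m) hα h2 hroot hp
  obtain ⟨y, hy, hyH, hyl⟩ := exists_path_eq_letter (m := m) hα h2 hroot hq
  obtain ⟨z, hz, hzH, hzl⟩ := exists_path_eq_letter (m := m) hα h2 hroot ht
  have hpow (a : M.Group) : ∃ k, 0 < k ∧ a ^ k ∈ M.congruence n ⊓ M.congruence m := by
    obtain ⟨i, hi, hin⟩ := exists_pow_mem_congruence (M := M) hn a
    obtain ⟨j, hj, hjm⟩ := exists_pow_mem_congruence (M := M) hm a
    exact ⟨i * j, mul_pos hi hj, by rw [pow_mul]; exact pow_mem hin j,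
      by rw [mul_comm, pow_mul]; exact pow_mem hjm i⟩
  obtain ⟨i, hi, hiy⟩ := hpow (x * y)
  obtain ⟨j, hj, hjz⟩ := hpow (x * z)
  have hN : i * j ≠ 0 := (mul_pos hi hj).ne'
  have hy' : (x * y) ^ (i * j) ∈ M.congruence n ⊓ M.congruence m := by
    rw [pow_mul]; exact pow_mem hiy j
  have hz' : (x * z) ^ (i * j) ∈ M.congruence n ⊓ M.congruence m := by
    rw [mul_comm i, pow_mul]; exact pow_mem hjz i
  obtain ⟨L, hL, hpath, hred, hpre⟩ := exists_word hp.1.1.form_self hq.1.1.form_self hpq hx hy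
    hxH hyH hxl hyl (i * j)
  obtain ⟨L', hL', hpath', hred', hpre'⟩ := exists_word hp.1.1.form_self ht.1.1.form_self hpt hx hz
    hxH hzH hxl hzl (i * j)
  rw [letter_rep hy'.1 hy'.2 hp.1.1.mem_lattice] at hred
  rw [letter_rep hz'.1 hz'.2 hp.1.1.mem_lattice] at hred'
  obtain ⟨K, hK⟩ := hpre hN
  obtain ⟨K', hK'⟩ := hpre' hN
  refine ⟨_, inferInstance, exists_surjective_freeGroup_fin_two f
    (a := ⟨_, hy'⟩) (b := ⟨_, hz'⟩) fun hcomm ↦ ?_⟩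
  have hf : f ⟨_, hy'⟩ = FreeGroup.mk L := hpath
  have hf' : f ⟨_, hz'⟩ = FreeGroup.mk L' := hpath'
  rw [hf, hf'] at hcomm
  have := eq_of_mk_mul_comm hred hred' hK.symm hK'.symm (by rw [hL, hL']) hcomm
  rw [← hK, ← hK'] at this
  simp only [List.cons_append, List.cons.injEq, true_and] at this
  exact (hqt.rep x).letter_fst_ne (congrArg Prod.fst this.1)

lemma large_of_two_lt_form (hirr : (SimpleGraph.fromRel (fun s t : S => M s t ≠ 2)).Connected)
    {β : S → ℝ} (hα : M.IsRoot α) (hβ : M.IsRoot β) (h : 2 < |M.form α β|) :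
    ∃ H : Subgroup M.Group, H.FiniteIndex ∧
      ∃ f : H →* FreeGroup (Fin 2), Function.Surjective f := by
  obtain ⟨n, hn, hn2, hgap⟩ := exists_level hα
  set C := M.canonicalRoots (M.congrRoots n α) with hC
  have hspan := congrRoots_subset_span (n := n) hα
  have hex (p q : S → ℝ) : ∃ t ∈ C, t ∉ Submodule.span ℝ {p, q} := by
    by_contra! hcon
    exact not_congrRoots_subset_span_pair hirr hα hβ h hn p q
      (hspan.trans (SetLike.coe_subset_coe.2 (Submodule.span_le.2 hcon)))
  obtain ⟨p, hp, -⟩ := hex 0 0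
  obtain ⟨q, hq, hpq⟩ := hex p p
  obtain ⟨t, ht, hpqt⟩ := hex p q
  have hpS : p ∈ Submodule.span ℝ {p, q} := Submodule.subset_span (by simp)
  have hqS : q ∈ Submodule.span ℝ {p, q} := Submodule.subset_span (by simp)
  have hpS' : p ∈ Submodule.span ℝ {p, p} := Submodule.subset_span (by simp)
  obtain ⟨N, hN⟩ := exists_forall_mem_ne_nsmul M.lattice_fg
    (X := {p - q, p + q, p - t, p + t, q - t, q + t}) (Set.toFinite _) (by
      rintro x (rfl | rfl | rfl | rfl | rfl | rfl) h0
      · exact hpq (sub_eq_zero.1 h0 ▸ hpS')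
      · exact hpq (by rw [eq_neg_of_add_eq_zero_right h0]; exact neg_mem hpS')
      · exact hpqt (sub_eq_zero.1 h0 ▸ hpS)
      · exact hpqt (by rw [eq_neg_of_add_eq_zero_right h0]; exact neg_mem hpS)
      · exact hpqt (sub_eq_zero.1 h0 ▸ hqS)
      · exact hpqt (by rw [eq_neg_of_add_eq_zero_right h0]; exact neg_mem hqS))
  have key {x : S → ℝ} (hx : x ∈ ({p - q, p + q, p - t, p + t, q - t, q + t} : Set (S → ℝ))) :
      x ∉ M.multiples (max N 1) := by
    rw [mem_multiples]
    rintro ⟨u, hu, hxu⟩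
    exact hN _ (le_max_left _ _) x hx u hu hxu
  exact large_of_canonicalRoots hα hn hn2 hgap hp hq ht (by positivity)
    ⟨key (by simp), key (by simp)⟩ ⟨key (by simp), key (by simp)⟩ ⟨key (by simp), key (by simp)⟩

end CoxeterMatrix

/-- Margulis–Vinberg: an irreducible Coxeter group (on a finite generating set) is
finite, virtually abelian, or large. -/
theorem coxeter_finite_or_virtuallyAbelian_or_large
    {S : Type*} [Fintype S] (M : CoxeterMatrix S)
    (hentries : ∀ s t : S, s ≠ t → M s t ≠ 1)
    (hirr : (SimpleGraph.fromRel (fun s t : S => M s t ≠ 2)).Connected) :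
    Finite M.Group ∨
    (∃ H : Subgroup M.Group, H.FiniteIndex ∧ ∀ a b : H, a * b = b * a) ∨
    (∃ H : Subgroup M.Group, H.FiniteIndex ∧
      ∃ f : H →* FreeGroup (Fin 2), Function.Surjective f) := by
  classical
  rcases M.virtuallyAbelian_or_exists_two_lt_form with h | ⟨α, β, hα, hβ, h⟩
  · exact Or.inr (Or.inl h)
  · exact Or.inr (Or.inr (CoxeterMatrix.large_of_two_lt_form hirr hα hβ h))
end
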